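/- Fix B > 0 and ε > 0 and let 1 ≤ k ≤ d. Set B_k := (k−1)·2^{d−1} and V_k := 2^{d+1−k} − 2. Let f ∈ ℤ[x₁,…,xₙ] of degree at most d with Height(f) ≤ B, let σ := σ_∞(f^{[d]}), let ω ∈ 𝒮⁺(𝐜), and let (α, q) be primitive. Then S(α, P) ≪ P^{n+ε} · ( P^{−2^{1−d}} + ‖qα‖^{1/(B_k+V_k)} + (q·P^{−k})^{1/B_k} + min{ q^{−1/(B_k+V_k)}, (‖qα‖·P^k)^{−1/B_k} } )^{n−σ}, with implicit constant depending only on ε, B, d, n and 𝐜. -/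

import Mathlib

noncomputable section
open scoped Classical
open MvPolynomial MeasureTheory

/-- Distance from a real number to the nearest integer. -/
def nint (x : ℝ) : ℝ := |x - round x|

/-- `α ∈ 𝕋` and `q ∈ ℕ` are *primitive* if there is `a` coprime to `q`
with `‖qα‖ = |qα - a|`. -/
def Primitive (α : ℝ) (q : ℕ) : Prop :=
  ∃ a : ℤ, Int.gcd a q = 1 ∧ nint (q * α) = |q * α - a|

/-- `e(t) = exp(2πit)`. -/
def eC (t : ℝ) : ℂ := Complex.exp (2 * Real.pi * Complex.I * t)

/-- The exponential sum `S(α, P) = Σ_{x ∈ ℤⁿ} ω(x/P) e(α f(x))`. -/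
def expSum (n : ℕ) (f : MvPolynomial (Fin n) ℤ) (ω : (Fin n → ℝ) → ℝ) (α P : ℝ) : ℂ :=
  ∑' x : Fin n → ℤ, (ω (fun i => (x i : ℝ) / P) : ℂ) * eC (α * (MvPolynomial.eval x f : ℝ))

/-- Mixed partial derivative `∂^ε g`. -/
def mpderiv (n : ℕ) (ε : Fin n → ℕ) (g : (Fin n → ℝ) → ℝ) : (Fin n → ℝ) → ℝ :=
  (List.finRange n).foldr
    (fun i h => (fun u : (Fin n → ℝ) → ℝ => fun x => fderiv ℝ u x (Pi.single i 1))^[ε i] h) g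

/-- A super-exponential increasing tuple of positive constants `(c, c₀, c₁, …)`. -/
def SuperSeq (c : ℝ) (cs : ℕ → ℝ) : Prop :=
  0 < c ∧ c ≤ cs 0 ∧ Monotone cs ∧ ∀ i j, cs i * cs j ≤ cs (i + j)

/-- Membership of `ω` in the class `𝒮⁺(𝐜)` of smooth weight functions. -/
def SmoothWeight (n : ℕ) (c : ℝ) (cs : ℕ → ℝ) (ω : (Fin n → ℝ) → ℝ) : Prop :=
  ContDiff ℝ (⊤ : ℕ∞) ω ∧ (∀ x, 0 ≤ ω x) ∧ (∀ x, ω x ≠ 0 → ∀ i, |x i| ≤ c) ∧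
    ∀ (ε : Fin n → ℕ) (x : Fin n → ℝ), |mpderiv n ε ω x| ≤ cs (∑ i, ε i)

/-- Dimension of the singular locus of `g` over `K`, i.e. the Krull dimension
of the coordinate ring of the affine set cut out by `∇g = 0`. -/
def singDim (n : ℕ) (K : Type) [CommRing K] (g : MvPolynomial (Fin n) K) : WithBot (WithTop ℕ) :=
  ringKrullDim (MvPolynomial (Fin n) K ⧸ Ideal.span (Set.range fun i => MvPolynomial.pderiv i g))

/-- `Height f ≤ H`: all coefficients of `f` are at most `H` in absolute value. -/
def HeightLe (n : ℕ) (f : MvPolynomial (Fin n) ℤ) (H : ℝ) : Prop :=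
  ∀ m : Fin n →₀ ℕ, |((f.coeff m : ℤ) : ℝ)| ≤ H

/-- `Height_{P,k} f ≤ H`: the relative height of `f` w.r.t. `P` at scale `k` is at most `H`. -/
def HeightPLe (n k : ℕ) (P : ℝ) (f : MvPolynomial (Fin n) ℤ) (H : ℝ) : Prop :=
  ∀ m : Fin n →₀ ℕ, |((f.coeff m : ℤ) : ℝ)| * P ^ (m.sum fun _ e => e) ≤ H * P ^ k

/-- `b = ∏_{p^e ∥ q, e ≤ 2} p^e`. -/
def bOf (q : ℕ) : ℕ :=
  ∏ p ∈ q.primeFactors, if q.factorization p ≤ 2 then p ^ q.factorization p else 1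

/-- `c₁ = ∏_{p^e ∥ q, e > 2} p^⌊e/2⌋`. -/
def c1Of (q : ℕ) : ℕ :=
  ∏ p ∈ q.primeFactors, if 2 < q.factorization p then p ^ (q.factorization p / 2) else 1

/-- `c₂ = ∏_{p^e ∥ q, e > 2, e odd} p`. -/
def c2Of (q : ℕ) : ℕ :=
  ∏ p ∈ q.primeFactors, if 2 < q.factorization p ∧ Odd (q.factorization p) then p else 1

/-- `η_q = max{(b³c₁c₂²)^{1/(2^d−2)}, (b³c₁²c₂)^{1/(5·2^{d−2}−4)}}`. -/
def etaOf (d q : ℕ) : ℝ :=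
  max (((bOf q : ℝ) ^ 3 * (c1Of q : ℝ) * (c2Of q : ℝ) ^ 2) ^ ((1 : ℝ) / ((2:ℝ) ^ (d : ℝ) - 2)))
      (((bOf q : ℝ) ^ 3 * (c1Of q : ℝ) ^ 2 * (c2Of q : ℝ)) ^
        ((1 : ℝ) / (5 * (2:ℝ) ^ ((d : ℝ) - 2) - 4)))

/-- The `r`-values `r_i = ∏_{p^e ∥ kb, σ_p(g^{[k]}) = i} p^e` of `g` w.r.t. `q`. -/
def rOf (n k q : ℕ) (g : MvPolynomial (Fin n) ℤ) (i : ℕ) : ℕ :=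
  ∏ p ∈ (k * bOf q).primeFactors,
    if singDim n (ZMod p)
        (MvPolynomial.map (Int.castRingHom (ZMod p)) (MvPolynomial.homogeneousComponent k g))
        = (i : WithBot (WithTop ℕ))
    then p ^ ((k * bOf q).factorization p) else 1

/-- `R^{[k]}_ζ(g, q) = ∏_{ζ ≤ i ≤ n} r_i^{i−ζ}`. -/
def ROf (n k q : ℕ) (g : MvPolynomial (Fin n) ℤ) (ζ : ℕ) : ℕ :=
  ∏ i ∈ Finset.Icc ζ n, (rOf n k q g i) ^ (i - ζ)

/-- `ξ = (5 − 2^{4−d})/(3 − 2^{3−d})`. -/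
def xiOf (d : ℕ) : ℝ := (5 - (2:ℝ) ^ ((4 : ℝ) - d)) / (3 - (2:ℝ) ^ ((3 : ℝ) - d))

/-- `γ = 1/(3·2^{d−2} − 2)`. -/
def gamOf (d : ℕ) : ℝ := 1 / (3 * (2:ℝ) ^ ((d : ℝ) - 2) - 2)

/-- `A_d = 7·2^{d−4} − 5/4`. -/
def AdOf (d : ℕ) : ℝ := 7 * (2:ℝ) ^ ((d : ℝ) - 4) - 5 / 4

/-- `B_k = (k−1)·2^{d−1}`. -/
def BkOf (d k : ℕ) : ℝ := ((k : ℝ) - 1) * (2:ℝ) ^ ((d : ℝ) - 1)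

/-- `V_k = 2^{d+1−k} − 2`. -/
def VkOf (d k : ℕ) : ℝ := (2:ℝ) ^ ((d : ℝ) + 1 - (k : ℝ)) - 2

/-- `C(α, q) = (‖qα‖P)^{1/(2^{d−1}−2)} + (qP^{−2})^{1/2^{d−2}} + η_q⁻¹`. -/
def CCof (d : ℕ) (P : ℝ) (q : ℕ) (α : ℝ) : ℝ :=
  (nint (q * α) * P) ^ (1 / ((2:ℝ) ^ ((d : ℝ) - 1) - 2)) +
    ((q : ℝ) * P ^ (-(2 : ℝ))) ^ (1 / (2:ℝ) ^ ((d : ℝ) - 2)) + (etaOf d q)⁻¹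

/-- `W_k(α, q)`; the term `(‖qα‖P^k)^{−1/B_k}` is interpreted as `+∞` when `‖qα‖ = 0`. -/
def WWof (d k : ℕ) (P : ℝ) (q : ℕ) (α : ℝ) : ℝ :=
  P ^ (-((2:ℝ) ^ (1 - (d : ℝ)))) + nint (q * α) ^ (1 / (BkOf d k + VkOf d k)) +
    ((q : ℝ) * P ^ (-(k : ℝ))) ^ (1 / BkOf d k) +
    min ((q : ℝ) ^ (-(1 / (BkOf d k + VkOf d k))))
      (if nint (q * α) = 0 then (q : ℝ) ^ (-(1 / (BkOf d k + VkOf d k)))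
       else (nint (q * α) * P ^ (k : ℝ)) ^ (-(1 / BkOf d k)))

/-- `M(α, q) = min{C(α, q), W₃(α, q), …, W_d(α, q)}`. -/
def MMof (d : ℕ) (P : ℝ) (q : ℕ) (α : ℝ) : ℝ :=
  min (CCof d P q α) (sInf ((fun k => WWof d k P q α) '' Set.Icc 3 d))

/-- `W_k*(α, q)`; the term `(‖qα‖P^k)^{−1/B_k}` is interpreted as `+∞` when `‖qα‖ = 0`. -/
def WSof (d k : ℕ) (P : ℝ) (q : ℕ) (α : ℝ) : ℝ :=
  max (nint (q * α) ^ (1 / (BkOf d k + VkOf d k)))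
    (min ((etaOf d q)⁻¹)
      (if nint (q * α) = 0 then (etaOf d q)⁻¹
       else (nint (q * α) * P ^ (k : ℝ)) ^ (-(1 / BkOf d k))))

/-- `M*(α, q) = min{W₃*(α, q), …, W_d*(α, q)}`. -/
def MSof (d : ℕ) (P : ℝ) (q : ℕ) (α : ℝ) : ℝ :=
  sInf ((fun k => WSof d k P q α) '' Set.Icc 3 d)

/-- The major arcs `𝔐(Δ)`, viewed inside a fundamental domain `[0,1)` for `𝕋 = ℝ/ℤ`. -/
def majorArcs (d : ℕ) (Δ P : ℝ) : Set ℝ :=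
  {α | ∃ q : ℕ, 0 < q ∧ (q : ℝ) ≤ P ^ Δ ∧
    ∃ a : ℕ, a ≤ q ∧ Nat.gcd a q = 1 ∧ nint (α - (a : ℝ) / q) ≤ P ^ (Δ - d)}

/-- The minor arcs `𝔪 = 𝕋 ∖ 𝔐(Δ)`. -/
def minorArcs (d : ℕ) (Δ P : ℝ) : Set ℝ := Set.Ico (0 : ℝ) 1 \ majorArcs d Δ P

/-- Exponents of the standard monomials of `I` for the graded lexicographic order. -/
def stdExponents {n : ℕ} (I : Ideal (MvPolynomial (Fin n) ℚ)) : Set (Fin n →₀ ℕ) :=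
  {b | ∀ p ∈ I, p ≠ 0 → MonomialOrder.degLex.degree p ≠ b}

/-- Number of standard monomials of `I` of degree at most `m` (the affine Hilbert function). -/
def stdCount {n : ℕ} (I : Ideal (MvPolynomial (Fin n) ℚ)) (m : ℕ) : ℕ :=
  Set.ncard {b | b ∈ stdExponents I ∧ b.degree ≤ m}

theorem stdExponents_downward {n : ℕ} {I : Ideal (MvPolynomial (Fin n) ℚ)} {b b' : Fin n →₀ ℕ}
    (hb : b ∈ stdExponents I) (h : b' ≤ b) : b' ∈ stdExponents I := by
  intro p hp hp0 hdeg
  have hm : monomial (b - b') (1 : ℚ) ≠ 0 := by simp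
  refine hb (p * monomial (b - b') 1) (I.mul_mem_right _ hp) (mul_ne_zero hp0 hm) ?_
  rw [MonomialOrder.degree_mul hp0 hm, MonomialOrder.degree_monomial, hdeg]
  simp [add_tsub_cancel_of_le h]

theorem eq_zero_of_mem_of_support_subset_stdExponents {n : ℕ}
    {I : Ideal (MvPolynomial (Fin n) ℚ)} {p : MvPolynomial (Fin n) ℚ} (hp : p ∈ I)
    (hs : ∀ b ∈ p.support, b ∈ stdExponents I) : p = 0 := by
  by_contra h0
  exact hs _ (MonomialOrder.degree_mem_support h0) p hp h0 rfl

theorem exists_stdExponents_remainder {n : ℕ} (I : Ideal (MvPolynomial (Fin n) ℚ))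
    (q : MvPolynomial (Fin n) ℚ) :
    ∃ r : MvPolynomial (Fin n) ℚ, q - r ∈ I ∧ (∀ b ∈ r.support, b ∈ stdExponents I) ∧
      r.totalDegree ≤ q.totalDegree := by
  have hB : ∀ b ∈ {p : MvPolynomial (Fin n) ℚ | p ∈ I ∧ p ≠ 0},
      IsUnit (MonomialOrder.degLex.leadingCoeff b) := by
    intro b hb
    exact isUnit_iff_ne_zero.mpr (by simpa using hb.2)
  obtain ⟨g, r, hq, hdeg, hr⟩ := MonomialOrder.degLex.div_set hB q
  have hmem : (Finsupp.linearCombination (MvPolynomial (Fin n) ℚ)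
      (fun b : {p : MvPolynomial (Fin n) ℚ | p ∈ I ∧ p ≠ 0} => (b : MvPolynomial (Fin n) ℚ))) g
      ∈ I := by
    rw [Finsupp.linearCombination_apply]
    exact Submodule.finsuppSum_mem _ _ _ _ fun c _ => I.mul_mem_left _ c.2.1
  have hstd : ∀ b ∈ r.support, b ∈ stdExponents I := by
    intro c hc p hp hp0 hpc
    exact hr c hc p ⟨hp, hp0⟩ (by rw [hpc])
  refine ⟨r, ?_, hstd, ?_⟩
  · rw [hq]; simpa using hmem
  · apply degLex_totalDegree_monotone
    set s := (Finsupp.linearCombination (MvPolynomial (Fin n) ℚ)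
      (fun b : {p : MvPolynomial (Fin n) ℚ | p ∈ I ∧ p ≠ 0} => (b : MvPolynomial (Fin n) ℚ))) g
      with hs
    have hsle : MonomialOrder.degLex.toSyn (MonomialOrder.degLex.degree s) ≤
        MonomialOrder.degLex.toSyn (MonomialOrder.degLex.degree q) := by
      rw [hs, Finsupp.linearCombination_apply, Finsupp.sum]
      refine (MonomialOrder.degree_sum_le).trans ?_
      refine Finset.sup_le fun b _ => ?_
      have := hdeg b
      rwa [mul_comm] at this
    have : r = q - s := by rw [hq]; ring
    rw [this]
    refine (MonomialOrder.degree_sub_le).trans (max_le le_rfl hsle)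

theorem finite_stdExponents_degree_le {n : ℕ} (I : Ideal (MvPolynomial (Fin n) ℚ)) (m : ℕ) :
    {b | b ∈ stdExponents I ∧ b.degree ≤ m}.Finite :=
  (Finsupp.finite_of_degree_le m).subset fun _ hb => hb.2

theorem ncard_degree_le (n N : ℕ) :
    Set.ncard {γ : Fin n →₀ ℕ | γ.degree ≤ N} ≤ (N + 1) ^ n := by
  have : Set.ncard {γ : Fin n →₀ ℕ | γ.degree ≤ N} ≤
      Set.ncard ((Fintype.piFinset fun _ : Fin n => Finset.range (N + 1) : Finset (Fin n → ℕ)) :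
        Set (Fin n → ℕ)) := by
    refine Set.ncard_le_ncard_of_injOn (fun γ => (γ : Fin n → ℕ)) ?_ ?_ (Finset.finite_toSet _)
    · intro γ hγ
      simp only [Finset.mem_coe, Fintype.mem_piFinset, Finset.mem_range]
      intro i
      exact Nat.lt_succ_of_le ((Finsupp.le_degree i γ).trans hγ)
    · intro a _ b _ h
      exact DFunLike.coe_injective h
  rwa [Set.ncard_coe_finset, Fintype.card_piFinset_const, Finset.card_range] at this

theorem stdCount_mono {n : ℕ} (I : Ideal (MvPolynomial (Fin n) ℚ)) : Monotone (stdCount I) := by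
  intro a b h
  exact Set.ncard_le_ncard (fun x hx => ⟨hx.1, hx.2.trans h⟩) (finite_stdExponents_degree_le I b)

theorem stdCount_mul_le {n : ℕ} (I : Ideal (MvPolynomial (Fin n) ℚ)) {a : ℕ} (ha : 1 ≤ a)
    (b : ℕ) : stdCount I (a * b) ≤ stdCount I (n * a) * stdCount I b := by
  rw [stdCount, stdCount, stdCount, ← Set.ncard_prod]
  refine Set.ncard_le_ncard_of_injOn
    (fun e => (e.mapRange (· % a) (Nat.zero_mod a), e.mapRange (· / a) (Nat.zero_div a)))
    ?_ ?_ ((finite_stdExponents_degree_le I _).prod (finite_stdExponents_degree_le I _))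
  · rintro e ⟨he, hd⟩
    refine ⟨⟨stdExponents_downward he fun i => ?_, ?_⟩, stdExponents_downward he fun i => ?_, ?_⟩
    · simpa using Nat.mod_le _ _
    · rw [Finsupp.degree_eq_sum]
      calc _ ≤ ∑ i : Fin n, a := Finset.sum_le_sum fun i _ => by
            simpa using (Nat.mod_lt (e i) ha).le
        _ = n * a := by simp
    · simpa using Nat.div_le_self _ _
    · rw [Finsupp.degree_eq_sum] at hd ⊢
      refine Nat.le_of_mul_le_mul_left (hd.trans' ?_) ha
      rw [Finset.mul_sum]
      exact Finset.sum_le_sum fun i _ => by simpa using Nat.mul_div_le _ _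
  · intro e _ e' _ h
    simp only [Prod.mk.injEq] at h
    ext i
    have h1 := DFunLike.congr_fun h.1 i
    have h2 := DFunLike.congr_fun h.2 i
    simp only [Finsupp.mapRange_apply] at h1 h2
    rw [← Nat.div_add_mod (e i) a, ← Nat.div_add_mod (e' i) a, h1, h2]

theorem stdCount_mul_pow_le {n : ℕ} (I : Ideal (MvPolynomial (Fin n) ℚ)) (C : ℕ) {X : ℕ}
    (hX : 1 ≤ X) (t : ℕ) :
    stdCount I (C * X ^ (t + 1)) ≤ stdCount I (max n C * X) ^ (t + 1) := by
  induction t with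
  | zero => simpa using stdCount_mono I (Nat.mul_le_mul_right X (le_max_right n C))
  | succ t ih =>
    have h1 : C * X ^ (t + 1 + 1) = X * (C * X ^ (t + 1)) := by ring
    rw [h1, pow_succ' _ (t + 1)]
    refine (stdCount_mul_le I hX _).trans (Nat.mul_le_mul ?_ ih)
    exact stdCount_mono I (Nat.mul_le_mul_right X (le_max_left n C))

theorem card_le_ncard_of_mem_span {ι κ V : Type*} [Fintype ι] [AddCommGroup V] [Module ℚ V]
    {v : ι → V} (hv : LinearIndependent ℚ v) {A : Set κ} (hA : A.Finite) (w : κ → V)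
    (h : ∀ i, v i ∈ Submodule.span ℚ (w '' A)) : Fintype.card ι ≤ A.ncard := by
  have hf : (w '' A).Finite := hA.image w
  have : Fintype (w '' A) := hf.fintype
  have h1 := linearIndependent_le_span' v hv (w '' A) (by rintro _ ⟨i, rfl⟩; exact h i)
  have h2 : Fintype.card ι ≤ Fintype.card (w '' A) := by
    rw [Cardinal.mk_fintype] at h1
    exact_mod_cast h1
  rw [← Nat.card_eq_fintype_card (α := (w '' A)), Nat.card_coe_set_eq] at h2
  exact h2.trans (Set.ncard_image_le hA)

/-- Integer points with all coordinates bounded by `H` in absolute value. -/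
def cube (n H : ℕ) : Finset (Fin n → ℤ) := Finset.Icc (fun _ => -(H : ℤ)) (fun _ => (H : ℤ))

theorem mem_cube {n H : ℕ} {x : Fin n → ℤ} : x ∈ cube n H ↔ ∀ i, |x i| ≤ H := by
  simp only [cube, Finset.mem_Icc, Pi.le_def, abs_le, forall_and]

/-- Pairs `(i, a)` such that the hyperplane `x i = a` meets the cube and misses `s`. -/
def missingHyperplanes {n : ℕ} (H : ℕ) (s : Fin n → ℤ) : Finset (Σ _ : Fin n, ℤ) :=
  Finset.univ.sigma fun i => (Finset.Icc (-(H : ℤ)) H).erase (s i)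

theorem card_missingHyperplanes {n H : ℕ} {s : Fin n → ℤ} (hs : s ∈ cube n H) :
    (missingHyperplanes H s).card = 2 * n * H := by
  rw [missingHyperplanes, Finset.card_sigma]
  have : ∀ i ∈ (Finset.univ : Finset (Fin n)),
      ((Finset.Icc (-(H : ℤ)) H).erase (s i)).card = 2 * H := by
    intro i _
    rw [Finset.card_erase_of_mem]
    · simp; omega
    · rw [Finset.mem_Icc]; exact abs_le.mp (mem_cube.mp hs i)
  rw [Finset.sum_congr rfl this]
  simp; ring

theorem prod_missingHyperplanes_eq_zero {n H : ℕ} {s t : Fin n → ℤ} (ht : t ∈ cube n H)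
    (hst : t ≠ s) : ∏ p ∈ missingHyperplanes H s, ((t p.1 : ℚ) - p.2) = 0 := by
  obtain ⟨i, hi⟩ := Function.ne_iff.mp hst
  refine Finset.prod_eq_zero (i := ⟨i, t i⟩) ?_ (by simp)
  simp only [missingHyperplanes, Finset.mem_sigma, Finset.mem_univ, Finset.mem_erase, true_and]
  exact ⟨hi, Finset.mem_Icc.mpr (abs_le.mp (mem_cube.mp ht i))⟩

theorem prod_missingHyperplanes_ne_zero {n H : ℕ} {s : Fin n → ℤ} :
    ∏ p ∈ missingHyperplanes H s, ((s p.1 : ℚ) - p.2) ≠ 0 := by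
  refine Finset.prod_ne_zero_iff.mpr fun p hp => ?_
  simp only [missingHyperplanes, Finset.mem_sigma, Finset.mem_univ, Finset.mem_erase,
    true_and] at hp
  exact sub_ne_zero.mpr (by exact_mod_cast hp.1.symm)

theorem card_le_stdCount_of_vanishing {n H : ℕ} {I : Ideal (MvPolynomial (Fin n) ℚ)}
    {S : Finset (Fin n → ℤ)} (hS : S ⊆ cube n H)
    (hI : ∀ g ∈ I, ∀ s ∈ S, eval (fun i => (s i : ℚ)) g = 0) :
    S.card ≤ stdCount I (2 * n * H) := by
  have hli : LinearIndependent ℚ (fun s : S => (Pi.single s 1 : S → ℚ)) := by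
    convert (Pi.basisFun ℚ S).linearIndependent using 1
    funext s
    simp
  rw [← Fintype.card_coe]
  refine card_le_ncard_of_mem_span hli (finite_stdExponents_degree_le I _)
    (fun b (t : S) => eval (fun i => ((t : Fin n → ℤ) i : ℚ)) (monomial b 1)) fun s => ?_
  set L : MvPolynomial (Fin n) ℚ := ∏ p ∈ missingHyperplanes H s.1, (X p.1 - C (p.2 : ℚ)) with hL
  have hLdeg : L.totalDegree ≤ 2 * n * H := by
    rw [← card_missingHyperplanes (hS s.2), Finset.card_eq_sum_ones]
    refine (totalDegree_finsetProd _ _).trans (Finset.sum_le_sum fun p _ => ?_)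
    exact (totalDegree_sub_C_le _ _).trans (totalDegree_X _).le
  obtain ⟨r, hr, hstd, hrdeg⟩ := exists_stdExponents_remainder I L
  have hev : ∀ t : S, eval (fun i => ((t : Fin n → ℤ) i : ℚ)) r =
      ∏ p ∈ missingHyperplanes H s.1, ((t.1 p.1 : ℚ) - p.2) := by
    intro t
    have := hI _ hr t t.2
    rw [map_sub, sub_eq_zero] at this
    rw [← this, hL, map_prod]
    simp
  have hmem : (fun t : S => eval (fun i => ((t : Fin n → ℤ) i : ℚ)) r) ∈ Submodule.span ℚ
      ((fun b (t : S) => eval (fun i => ((t : Fin n → ℤ) i : ℚ)) (monomial b (1 : ℚ))) ''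
        {b | b ∈ stdExponents I ∧ b.degree ≤ 2 * n * H}) := by
    have : (fun t : S => eval (fun i => ((t : Fin n → ℤ) i : ℚ)) r) =
        ∑ b ∈ r.support, coeff b r •
          (fun t : S => eval (fun i => ((t : Fin n → ℤ) i : ℚ)) (monomial b (1 : ℚ))) := by
      funext t
      rw [eval_eq']
      simp [eval_monomial]
    rw [this]
    refine Submodule.sum_mem _ fun b hb => Submodule.smul_mem _ _ (Submodule.subset_span ?_)
    refine ⟨b, ⟨hstd b hb, ?_⟩, rfl⟩
    have h1 := le_totalDegree hb
    exact h1.trans (hrdeg.trans hLdeg)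
  have hsingle : (Pi.single s 1 : S → ℚ) =
      (∏ p ∈ missingHyperplanes H s.1, ((s.1 p.1 : ℚ) - p.2))⁻¹ •
        (fun t : S => eval (fun i => ((t : Fin n → ℤ) i : ℚ)) r) := by
    funext t
    simp only [Pi.smul_apply, smul_eq_mul, hev]
    by_cases hts : t = s
    · subst hts
      rw [Pi.single_eq_same, inv_mul_cancel₀ prod_missingHyperplanes_ne_zero]
    · rw [Pi.single_eq_of_ne hts, prod_missingHyperplanes_eq_zero (hS t.2)
        (fun h => hts (Subtype.ext h)), mul_zero]
  rw [hsingle]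
  exact Submodule.smul_mem _ _ hmem

/-- The ideal generated by the partial derivatives of `G`. -/
def jacIdeal {n : ℕ} (G : MvPolynomial (Fin n) ℚ) : Ideal (MvPolynomial (Fin n) ℚ) :=
  Ideal.span (Set.range fun i => pderiv i G)

/-- The derivative of `G` in the direction `h`. -/
def dirDeriv {n : ℕ} {R : Type*} [CommRing R] (h : Fin n → R) (G : MvPolynomial (Fin n) R) :
    MvPolynomial (Fin n) R :=
  ∑ j, C (h j) * pderiv j G

theorem pderiv_comm' {n : ℕ} {R : Type*} [CommRing R] (i j : Fin n) (G : MvPolynomial (Fin n) R) :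
    pderiv i (pderiv j G) = pderiv j (pderiv i G) := by
  induction G using MvPolynomial.induction_on' with
  | monomial u a =>
    simp only [pderiv_monomial]
    by_cases hij : i = j
    · subst hij; rfl
    · congr 1
      · rw [tsub_tsub, tsub_tsub, add_comm]
      · simp [hij, Ne.symm hij, mul_right_comm]
  | add p q hp hq => simp [hp, hq]

theorem pderiv_dirDeriv {n : ℕ} {R : Type*} [CommRing R] (i : Fin n) (h : Fin n → R)
    (G : MvPolynomial (Fin n) R) : pderiv i (dirDeriv h G) = dirDeriv h (pderiv i G) := by
  simp only [dirDeriv, map_sum]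
  refine Finset.sum_congr rfl fun j _ => ?_
  rw [pderiv_C_mul, pderiv_comm']

theorem degree_eq_of_isHomogeneous {n : ℕ} {R : Type*} [CommRing R] {p : MvPolynomial (Fin n) R}
    {e : ℕ} (hp : p.IsHomogeneous e) {m : Fin n →₀ ℕ} (hm : coeff m p ≠ 0) : m.degree = e := by
  have := hp hm
  rwa [Finsupp.degree_eq_weight_one]

theorem coeff_mul_eq_zero_of_isHomogeneous {n : ℕ} {p G : MvPolynomial (Fin n) ℚ} {e s : ℕ}
    (hG : G.IsHomogeneous e) (hp : ∀ m ∈ p.support, s < m.degree + e) {m : Fin n →₀ ℕ}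
    (hm : m.degree ≤ s) : coeff m (p * G) = 0 := by
  rw [coeff_mul]
  refine Finset.sum_eq_zero fun x hx => ?_
  by_contra hne
  have h1 := hp x.1 (mem_support_iff.mpr (left_ne_zero_of_mul hne))
  have h2 : x.2.degree = e := degree_eq_of_isHomogeneous hG (right_ne_zero_of_mul hne)
  have h3 : x.1 + x.2 = m := Finset.HasAntidiagonal.mem_antidiagonal.mp hx
  rw [← h3, map_add, h2] at hm
  omega

theorem exists_bounded_combination {n e s : ℕ} {D : Fin n → MvPolynomial (Fin n) ℚ}
    (hD : ∀ i, (D i).IsHomogeneous e) {p : MvPolynomial (Fin n) ℚ}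
    (hp : p ∈ Ideal.span (Set.range D)) (hs : p.totalDegree ≤ s) :
    ∃ a : Fin n → MvPolynomial (Fin n) ℚ, p = ∑ i, a i * D i ∧
      ∀ i, ∀ m ∈ (a i).support, m.degree + e ≤ s := by
  obtain ⟨b, hb⟩ := Ideal.mem_span_range_iff_exists_fun.mp hp
  let a : Fin n → MvPolynomial (Fin n) ℚ := fun i =>
    ∑ m ∈ (b i).support.filter (fun m => m.degree + e ≤ s), monomial m (coeff m (b i))
  have hacoeff : ∀ i m, coeff m (a i) = if m.degree + e ≤ s then coeff m (b i) else 0 := by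
    intro i m
    simp only [a, coeff_sum, coeff_monomial, Finset.sum_ite_eq', Finset.mem_filter,
      mem_support_iff]
    by_cases h1 : m.degree + e ≤ s <;> by_cases h2 : coeff m (b i) = 0 <;> simp [h1, h2]
  have hasupp : ∀ i, ∀ m ∈ (a i).support, m.degree + e ≤ s := by
    intro i m hm
    rw [mem_support_iff, hacoeff] at hm
    by_contra h
    exact hm (if_neg h)
  refine ⟨a, ?_, hasupp⟩
  ext m
  by_cases hm : m.degree ≤ s
  · rw [← hb, ← sub_eq_zero, ← coeff_sub, ← Finset.sum_sub_distrib, coeff_sum]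
    refine Finset.sum_eq_zero fun i _ => ?_
    rw [← sub_mul]
    refine coeff_mul_eq_zero_of_isHomogeneous (hD i) (fun x hx => ?_) hm
    rw [mem_support_iff, coeff_sub, hacoeff] at hx
    by_contra h
    rw [if_pos (not_lt.mp h), sub_self] at hx
    exact hx rfl
  · rw [coeff_eq_zero_of_totalDegree_lt (lt_of_le_of_lt hs (not_le.mp hm)), coeff_sum]
    symm
    refine Finset.sum_eq_zero fun i _ => ?_
    refine coeff_eq_zero_of_totalDegree_lt (lt_of_le_of_lt ?_ (not_le.mp hm))
    by_cases ha : a i = 0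
    · simp [ha]
    refine (totalDegree_mul _ _).trans ?_
    obtain ⟨m', hm', hd⟩ := (a i).support.exists_mem_eq_sup
      (by simpa using ha) (fun m => m.sum fun _ e => e)
    have h1 := hasupp i m' hm'
    have h2 : (a i).totalDegree = m'.degree := hd
    have h3 := (hD i).totalDegree_le
    omega

section Incidence

variable {n : ℕ} {ι : Type*} (z : ι → Fin n → ℚ)

/-- The family of polynomials `(∏ i, (z h i - X i) ^ α i) * p` indexed by `h`. -/
def shiftFamily (α : Fin n →₀ ℕ) (p : MvPolynomial (Fin n) ℚ) : ι → MvPolynomial (Fin n) ℚ :=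
  fun h => (∏ i, (C (z h i) - X i) ^ α i) * p

theorem shiftFamily_eq_sum (α : Fin n →₀ ℕ) (p : MvPolynomial (Fin n) ℚ) :
    shiftFamily z α p = ∑ b ∈ p.support, coeff b p • shiftFamily z α (monomial b 1) := by
  funext h
  conv_lhs => rw [shiftFamily, p.as_sum]
  rw [Finset.mul_sum, Finset.sum_apply]
  refine Finset.sum_congr rfl fun b _ => ?_
  rw [Pi.smul_apply, shiftFamily, ← mul_smul_comm, smul_monomial, smul_eq_mul, mul_one]

theorem shiftFamily_add_single (α : Fin n →₀ ℕ) (j : Fin n) (p : MvPolynomial (Fin n) ℚ) (h : ι) :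
    shiftFamily z (α + Finsupp.single j 1) p h = (C (z h j) - X j) * shiftFamily z α p h := by
  simp only [shiftFamily, Finsupp.add_apply, pow_add, Finset.prod_mul_distrib]
  have : ∏ i, (C (z h i) - X i : MvPolynomial (Fin n) ℚ) ^ (Finsupp.single j 1 i) =
      C (z h j) - X j := by
    rw [Finset.prod_eq_single j]
    · simp
    · intro b _ hb
      simp [Ne.symm hb]
    · simp
  rw [this]; ring

theorem shiftFamily_mem {W : Submodule ℚ (ι → MvPolynomial (Fin n) ℚ)} {α : Fin n →₀ ℕ}
    {p : MvPolynomial (Fin n) ℚ}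
    (h : ∀ b ∈ p.support, shiftFamily z α (monomial b 1) ∈ W) : shiftFamily z α p ∈ W := by
  rw [shiftFamily_eq_sum]
  exact Submodule.sum_mem _ fun b hb => Submodule.smul_mem _ _ (h b hb)

theorem shiftFamily_monomial_mem {e m : ℕ} {G : MvPolynomial (Fin n) ℚ}
    (hG : G.IsHomogeneous e) (he : 2 ≤ e) {W : Submodule ℚ (ι → MvPolynomial (Fin n) ℚ)}
    (hW : ∀ F : ι → MvPolynomial (Fin n) ℚ, (∀ h, F h ∈ jacIdeal (dirDeriv (z h) G)) → F ∈ W)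
    (hstd : ∀ α b : Fin n →₀ ℕ, b ∈ stdExponents (jacIdeal G) → α.degree + b.degree ≤ m →
      shiftFamily z α (monomial b 1) ∈ W) (α β : Fin n →₀ ℕ) (hαβ : α.degree + β.degree ≤ m) :
    shiftFamily z α (monomial β 1) ∈ W := by
  induction hs : β.degree using Nat.strong_induction_on generalizing α β with
  | _ s ih =>
  obtain ⟨r, hr, hrs, hrd⟩ := exists_stdExponents_remainder (jacIdeal G) (monomial β (1 : ℚ))
  have hβ : (monomial β (1 : ℚ)).totalDegree = s := by
    rw [totalDegree_monomial _ one_ne_zero, ← hs]; rfl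
  rw [hβ] at hrd
  have hpd : (monomial β (1 : ℚ) - r).totalDegree ≤ s := by
    refine (totalDegree_sub _ _).trans (max_le hβ.le hrd)
  obtain ⟨a, ha, had⟩ := exists_bounded_combination (fun i => hG.pderiv (i := i)) hr hpd
  have hmain : shiftFamily z α (monomial β (1 : ℚ)) =
      shiftFamily z α r + ∑ i, shiftFamily z α (a i * pderiv i G) := by
    funext h
    rw [Pi.add_apply, Finset.sum_apply]
    simp only [shiftFamily]
    rw [← Finset.mul_sum, ← mul_add, ← ha]
    congr 1; ring
  rw [hmain]
  refine Submodule.add_mem _ (shiftFamily_mem z fun b hb => hstd α b (hrs b hb) ?_)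
    (Submodule.sum_mem _ fun i _ => ?_)
  · have : b.degree ≤ s := (le_totalDegree hb).trans hrd
    omega
  have heuler : ((e - 1 : ℕ) : MvPolynomial (Fin n) ℚ) * pderiv i G =
      ∑ j, X j * pderiv j (pderiv i G) := by
    rw [(hG.pderiv (i := i)).sum_X_mul_pderiv, nsmul_eq_mul]
  have he1 : ((e - 1 : ℕ) : ℚ) ≠ 0 := by
    have : e - 1 ≠ 0 := by omega
    exact_mod_cast this
  have hkey : ((e - 1 : ℕ) : ℚ) • shiftFamily z α (a i * pderiv i G) =
      (fun h => shiftFamily z α (a i) h * pderiv i (dirDeriv (z h) G)) -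
        ∑ j, shiftFamily z (α + Finsupp.single j 1) (a i * pderiv j (pderiv i G)) := by
    funext h
    have h1 : ((e - 1 : ℕ) : ℚ) • shiftFamily z α (a i * pderiv i G) h =
        shiftFamily z α (a i) h * (((e - 1 : ℕ) : MvPolynomial (Fin n) ℚ) * pderiv i G) := by
      rw [smul_eq_C_mul, C_eq_coe_nat]
      simp only [shiftFamily]; ring
    rw [Pi.smul_apply, h1, heuler, Pi.sub_apply, Finset.sum_apply, pderiv_dirDeriv, dirDeriv,
      Finset.mul_sum, Finset.mul_sum, ← Finset.sum_sub_distrib]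
    refine Finset.sum_congr rfl fun j _ => ?_
    rw [shiftFamily_add_single]
    simp only [shiftFamily]; ring
  have hmem : ((e - 1 : ℕ) : ℚ) • shiftFamily z α (a i * pderiv i G) ∈ W := by
    rw [hkey]
    refine Submodule.sub_mem _ (hW _ fun h => Ideal.mul_mem_left _ _ (Ideal.subset_span ⟨i, rfl⟩))
      (Submodule.sum_mem _ fun j _ => shiftFamily_mem z fun b hb => ?_)
    obtain ⟨x, hx, y, hy, rfl⟩ := Finset.mem_add.mp (support_mul _ _ hb)
    have h1 := had i x hx
    have h2 : y.degree = e - 1 - 1 :=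
      degree_eq_of_isHomogeneous ((hG.pderiv (i := i)).pderiv (i := j)) (mem_support_iff.mp hy)
    have h3 : (x + y).degree = x.degree + y.degree := map_add _ _ _
    have h4 : (α + Finsupp.single j 1).degree = α.degree + 1 := by simp
    refine ih (x + y).degree (by omega) _ _ (by omega) rfl
  have := Submodule.smul_mem W ((e - 1 : ℕ) : ℚ)⁻¹ hmem
  rwa [smul_smul, inv_mul_cancel₀ he1, one_smul] at this

theorem prod_smul_monomial_mem_span (T : Finset (Σ _ : Fin n, ℤ)) (b : Fin n →₀ ℕ) :
    (fun h : ι => C (∏ p ∈ T, (z h p.1 - p.2)) * (monomial b (1 : ℚ))) ∈ Submodule.span ℚ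
      {F | ∃ α β : Fin n →₀ ℕ, α.degree + β.degree ≤ b.degree + T.card ∧
        F = shiftFamily z α (monomial β 1)} := by
  induction T using Finset.induction_on with
  | empty =>
    refine Submodule.subset_span ⟨0, b, by simp, ?_⟩
    funext h; simp [shiftFamily]
  | insert t T ht ih =>
    set M : (ι → MvPolynomial (Fin n) ℚ) →ₗ[ℚ] (ι → MvPolynomial (Fin n) ℚ) :=
      LinearMap.mulLeft ℚ (fun h => C (z h t.1 - t.2)) with hM
    have hfun : (fun h : ι => C (∏ p ∈ insert t T, (z h p.1 - p.2)) * (monomial b (1 : ℚ))) =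
        M (fun h : ι => C (∏ p ∈ T, (z h p.1 - p.2)) * (monomial b (1 : ℚ))) := by
      funext h
      rw [hM, LinearMap.mulLeft_apply, Pi.mul_apply, Finset.prod_insert ht, C_mul, mul_assoc]
    rw [hfun, Finset.card_insert_of_notMem ht]
    refine Submodule.mem_comap.mp (Submodule.span_le.mpr ?_ ih)
    rintro F ⟨α, β, hαβ, rfl⟩
    rw [SetLike.mem_coe, Submodule.mem_comap]
    have : M (shiftFamily z α (monomial β 1)) =
        shiftFamily z (α + Finsupp.single t.1 1) (monomial β 1) +
          shiftFamily z α (monomial (β + Finsupp.single t.1 1) 1) -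
          (t.2 : ℚ) • shiftFamily z α (monomial β 1) := by
      funext h
      rw [Pi.sub_apply, Pi.add_apply, shiftFamily_add_single, Pi.smul_apply, smul_eq_C_mul]
      have hX : monomial (β + Finsupp.single t.1 1) (1 : ℚ) = monomial β 1 * X t.1 := by
        rw [X, monomial_mul, one_mul]
      rw [hM, LinearMap.mulLeft_apply, Pi.mul_apply, C_sub]
      simp only [shiftFamily, hX]
      ring
    rw [this]
    refine Submodule.sub_mem _ (Submodule.add_mem _ (Submodule.subset_span ⟨_, _, ?_, rfl⟩)
      (Submodule.subset_span ⟨_, _, ?_, rfl⟩))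
      (Submodule.smul_mem _ _ (Submodule.subset_span ⟨_, _, ?_, rfl⟩)) <;>
    · first | omega | (rw [map_add, Finsupp.degree_single]; omega)

end Incidence

theorem sum_stdCount_dirDeriv_le {n e : ℕ} {G : MvPolynomial (Fin n) ℚ} (hG : G.IsHomogeneous e)
    (he : 2 ≤ e) (H m : ℕ) :
    ∑ h ∈ cube n H, stdCount (jacIdeal (dirDeriv (fun i => (h i : ℚ)) G)) m ≤
      (m + 2 * n * H + 1) ^ n * stdCount (jacIdeal G) (m + 2 * n * H) := by
  set N := m + 2 * n * H with hN
  let z : cube n H → Fin n → ℚ := fun h i => (h.1 i : ℚ)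
  let Z : Submodule ℚ (cube n H → MvPolynomial (Fin n) ℚ) :=
    Submodule.pi Set.univ fun h => (jacIdeal (dirDeriv (z h) G)).restrictScalars ℚ
  let A : Set ((Fin n →₀ ℕ) × (Fin n →₀ ℕ)) :=
    {α | α.degree ≤ N} ×ˢ {b | b ∈ stdExponents (jacIdeal G) ∧ b.degree ≤ N}
  have hA : A.Finite := (Finsupp.finite_of_degree_le N).prod (finite_stdExponents_degree_le _ _)
  let U : (Fin n →₀ ℕ) × (Fin n →₀ ℕ) → (cube n H → MvPolynomial (Fin n) ℚ) ⧸ Z :=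
    fun c => Z.mkQ (shiftFamily z c.1 (monomial c.2 1))
  let W : Submodule ℚ (cube n H → MvPolynomial (Fin n) ℚ) :=
    (Submodule.span ℚ (U '' A)).comap Z.mkQ
  have hZW : ∀ F : cube n H → MvPolynomial (Fin n) ℚ,
      (∀ h, F h ∈ jacIdeal (dirDeriv (z h) G)) → F ∈ W := by
    intro F hF
    have h0 : Z.mkQ F = 0 := by
      rw [Submodule.mkQ_apply, Submodule.Quotient.mk_eq_zero]
      exact Submodule.mem_pi.mpr fun h _ => hF h
    change Z.mkQ F ∈ Submodule.span ℚ (U '' A)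
    rw [h0]; exact Submodule.zero_mem _
  have hstdW : ∀ α b : Fin n →₀ ℕ, b ∈ stdExponents (jacIdeal G) → α.degree + b.degree ≤ N →
      shiftFamily z α (monomial b 1) ∈ W := by
    intro α b hb hd
    refine Submodule.subset_span ⟨(α, b), ⟨?_, hb, ?_⟩, rfl⟩
    · change α.degree ≤ N; omega
    · change b.degree ≤ N; omega
  have hdelta : ∀ (h : cube n H) (b : Fin n →₀ ℕ), b.degree ≤ m →
      (Pi.single h (monomial b (1 : ℚ)) : cube n H → MvPolynomial (Fin n) ℚ) ∈ W := by
    intro h b hb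
    have h1 := prod_smul_monomial_mem_span z (missingHyperplanes H h.1) b
    rw [card_missingHyperplanes h.2] at h1
    have h2 : (fun h' : cube n H => C (∏ p ∈ missingHyperplanes H h.1, (z h' p.1 - p.2)) *
        (monomial b (1 : ℚ))) ∈ W := by
      refine Submodule.span_le.mpr ?_ h1
      rintro F ⟨α, β, hαβ, rfl⟩
      exact shiftFamily_monomial_mem z hG he hZW hstdW α β (by omega)
    have h3 := Submodule.smul_mem W
      (∏ p ∈ missingHyperplanes H h.1, ((h.1 p.1 : ℚ) - p.2))⁻¹ h2
    convert h3 using 1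
    funext t
    rw [Pi.smul_apply, smul_eq_C_mul, ← mul_assoc, ← C_mul]
    by_cases hts : t = h
    · subst hts
      rw [Pi.single_eq_same, inv_mul_cancel₀ prod_missingHyperplanes_ne_zero, C_1, one_mul]
    · rw [Pi.single_eq_of_ne hts, prod_missingHyperplanes_eq_zero t.2
        (fun h => hts (Subtype.ext h)), mul_zero, C_0, zero_mul]
  let B : cube n H → Set (Fin n →₀ ℕ) := fun h =>
    {b | b ∈ stdExponents (jacIdeal (dirDeriv (z h) G)) ∧ b.degree ≤ m}
  have : ∀ h, Fintype (B h) := fun h => (finite_stdExponents_degree_le _ _).fintype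
  let v : (Σ h : cube n H, B h) → (cube n H → MvPolynomial (Fin n) ℚ) ⧸ Z :=
    fun p => Z.mkQ (Pi.single p.1 (monomial p.2.1 1))
  have hv : LinearIndependent ℚ v := by
    rw [Fintype.linearIndependent_iff]
    intro g hg p
    have h1 : (∑ p : (Σ h : cube n H, B h), g p •
        (Pi.single p.1 (monomial p.2.1 (1 : ℚ)) : cube n H → MvPolynomial (Fin n) ℚ)) ∈ Z := by
      rw [← Submodule.Quotient.mk_eq_zero, ← Submodule.mkQ_apply, map_sum, ← hg]
      refine Finset.sum_congr rfl fun p _ => ?_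
      rw [map_smul]
    have h2 := Submodule.mem_pi.mp h1 p.1 (Set.mem_univ _)
    rw [Submodule.restrictScalars_mem, Finset.sum_apply, Fintype.sum_sigma,
      Finset.sum_eq_single p.1] at h2
    · simp only [Pi.smul_apply, Pi.single_eq_same, smul_monomial, smul_eq_mul, mul_one] at h2
      have hc : ∀ b, coeff b (∑ x : B p.1, monomial x.1 (g ⟨p.1, x⟩)) =
          if hb : b ∈ B p.1 then g ⟨p.1, ⟨b, hb⟩⟩ else 0 := by
        intro b
        rw [coeff_sum]
        simp only [coeff_monomial]
        split_ifs with hb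
        · rw [Finset.sum_eq_single (⟨b, hb⟩ : B p.1)]
          · simp
          · intro c _ hcb
            exact if_neg fun h => hcb (Subtype.ext h)
          · simp
        · refine Finset.sum_eq_zero fun c _ => if_neg ?_
          rintro rfl
          exact hb c.2
      have h3 := eq_zero_of_mem_of_support_subset_stdExponents h2 (by
        intro b hb
        rw [mem_support_iff, hc] at hb
        by_contra hb'
        refine hb (dif_neg fun h => hb' h.1))
      have h4 := hc p.2.1
      rw [h3, coeff_zero, dif_pos p.2.2] at h4
      exact h4.symm
    · intro h _ hne
      refine Finset.sum_eq_zero fun x _ => ?_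
      rw [Pi.smul_apply, Pi.single_eq_of_ne (Ne.symm hne), smul_zero]
    · simp
  have hcard := card_le_ncard_of_mem_span hv hA U fun p => hdelta p.1 p.2.1 p.2.2.2
  rw [Fintype.card_sigma, Set.ncard_prod] at hcard
  rw [← Finset.sum_coe_sort]
  refine le_trans (le_of_eq ?_) (hcard.trans (Nat.mul_le_mul_right _ (ncard_degree_le n N)))
  refine Finset.sum_congr rfl fun h _ => ?_
  rw [← Nat.card_eq_fintype_card, Nat.card_coe_set_eq]
  rfl

theorem exists_fin_generators {R A : Type*} [CommRing R] [CommRing A] (g : R →+* A)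
    (hg : g.Finite) : ∃ (t : ℕ) (b : Fin t → A), ∀ x, ∃ r : Fin t → R, x = ∑ k, g (r k) * b k := by
  let _ := g.toAlgebra
  have : Module.Finite R A := hg
  obtain ⟨t, b, hb⟩ := Module.Finite.exists_fin (R := R) (M := A)
  refine ⟨t, b, fun x => ?_⟩
  have hx : x ∈ Submodule.span R (Set.range b) := hb ▸ Submodule.mem_top
  obtain ⟨r, hr⟩ := (Submodule.mem_span_range_iff_exists_fun R).mp hx
  exact ⟨r, by rw [← hr]; rfl⟩

theorem ringKrullDim_le_of_finite_injective {R A : Type*} [CommRing R] [CommRing A] (g : R →+* A)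
    (hg : g.Finite) (hinj : Function.Injective g) : ringKrullDim R ≤ ringKrullDim A := by
  let _ := g.toAlgebra
  have : Module.Finite R A := hg
  have : FaithfulSMul R A := (faithfulSMul_iff_algebraMap_injective R A).mpr hinj
  refine iSup_le fun l => ?_
  obtain ⟨P, -, hP, hlo⟩ := Ideal.exists_ideal_over_prime_of_isIntegral (S := A)
    l.head.asIdeal ⊥ (by
      intro x hx
      have hx0 : g x = 0 := hx
      rw [(map_eq_zero_iff g hinj).mp hx0]
      exact zero_mem _)
  have : P.LiesOver l.head.asIdeal := ⟨hlo.symm⟩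
  obtain ⟨L, hL, -⟩ := Ideal.exists_ltSeries_of_hasGoingUp l P
  rw [← hL]
  exact Order.LTSeries.length_le_krullDim L

theorem monomial_mem_span_of_finite {n s t : ℕ} {A : Type*} [CommRing A] [Algebra ℚ A]
    (x : Fin n → A) (g : MvPolynomial (Fin s) ℚ →ₐ[ℚ] A) (b : Fin t → A)
    (hb : ∀ x, ∃ r : Fin t → MvPolynomial (Fin s) ℚ, x = ∑ k, g (r k) * b k) :
    ∃ c : ℕ, ∀ β : Fin n →₀ ℕ, ∏ i, x i ^ β i ∈ Submodule.span ℚ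
      ((fun p : (Fin s →₀ ℕ) × Fin t => g (monomial p.1 1) * b p.2) ''
        {p | p.1.degree ≤ c * (β.degree + 1)}) := by
  obtain ⟨r1, hr1⟩ := hb 1
  choose r hr using fun (q : Fin n × Fin t) => hb (x q.1 * b q.2)
  let c : ℕ := (∑ k, (r1 k).totalDegree) + ∑ q, ∑ k, (r q k).totalDegree
  have hc1 : ∀ k, (r1 k).totalDegree ≤ c := fun k =>
    (Finset.single_le_sum (f := fun k => (r1 k).totalDegree) (fun _ _ => Nat.zero_le _)
      (Finset.mem_univ k)).trans (Nat.le_add_right _ _)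
  have hc2 : ∀ q k, (r q k).totalDegree ≤ c := fun q k =>
    ((Finset.single_le_sum (f := fun k => (r q k).totalDegree) (fun _ _ => Nat.zero_le _)
      (Finset.mem_univ k)).trans (Finset.single_le_sum (f := fun q => ∑ k, (r q k).totalDegree)
        (fun _ _ => Nat.zero_le _) (Finset.mem_univ q))).trans (Nat.le_add_left _ _)
  let U : ℕ → Submodule ℚ A := fun N => Submodule.span ℚ
      ((fun p : (Fin s →₀ ℕ) × Fin t => g (monomial p.1 1) * b p.2) '' {p | p.1.degree ≤ N})
  have hpoly : ∀ (N : ℕ) (p : MvPolynomial (Fin s) ℚ) (k : Fin t), p.totalDegree ≤ N →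
      g p * b k ∈ U N := by
    intro N p k hp
    rw [p.as_sum, map_sum, Finset.sum_mul]
    refine Submodule.sum_mem _ fun γ hγ => ?_
    have : monomial γ (coeff γ p) = coeff γ p • monomial γ (1 : ℚ) := by
      rw [smul_monomial, smul_eq_mul, mul_one]
    rw [this, map_smul, smul_mul_assoc]
    exact Submodule.smul_mem _ _ (Submodule.subset_span
      ⟨(γ, k), (le_totalDegree hγ).trans hp, rfl⟩)
  have hmul : ∀ (i : Fin n) (N : ℕ) (y : A), y ∈ U N → x i * y ∈ U (N + c) := by
    intro i N y hy
    induction hy using Submodule.span_induction with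
    | mem y hy =>
      obtain ⟨⟨γ, k⟩, hγ, rfl⟩ := hy
      have : x i * (g (monomial γ 1) * b k) =
          ∑ l, g (monomial γ 1 * r (i, k) l) * b l := by
        rw [mul_left_comm, hr (i, k), Finset.mul_sum]
        refine Finset.sum_congr rfl fun l _ => ?_
        rw [map_mul, mul_assoc]
      simp only [this]
      refine Submodule.sum_mem _ fun l _ => hpoly _ _ _ ?_
      refine (totalDegree_mul _ _).trans (Nat.add_le_add ?_ (hc2 _ _))
      rw [totalDegree_monomial _ one_ne_zero]
      exact hγ
    | zero => simp
    | add y z _ _ hy hz => rw [mul_add]; exact Submodule.add_mem _ hy hz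
    | smul a y _ hy => rw [mul_smul_comm]; exact Submodule.smul_mem _ _ hy
  refine ⟨c, fun β => ?_⟩
  change ∏ i, x i ^ β i ∈ U (c * (β.degree + 1))
  induction hd : β.degree generalizing β with
  | zero =>
    have : β = 0 := (Finsupp.degree_eq_zero_iff β).mp hd
    subst this
    simp only [Finsupp.coe_zero, Pi.zero_apply, pow_zero, Finset.prod_const_one]
    rw [hr1]
    exact Submodule.sum_mem _ fun k _ => hpoly _ _ _ (by simpa using hc1 k)
  | succ m ih =>
    have hne : β ≠ 0 := by rintro rfl; simp at hd
    obtain ⟨i, hi⟩ := Finsupp.ne_iff.mp hne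
    have hle : Finsupp.single i 1 ≤ β := by
      simpa [Finsupp.single_le_iff] using Nat.one_le_iff_ne_zero.mpr hi
    obtain ⟨β', rfl⟩ := exists_add_of_le hle
    have hd' : β'.degree = m := by
      rw [map_add, Finsupp.degree_single] at hd; omega
    have h1 := hmul i _ _ (ih β' hd')
    have h2 : ∏ j, x j ^ (Finsupp.single i 1 + β' : Fin n →₀ ℕ) j = x i * ∏ j, x j ^ β' j := by
      simp only [Finsupp.add_apply, pow_add, Finset.prod_mul_distrib]
      congr 1
      rw [Finset.prod_eq_single i]
      · simp
      · intro j _ hj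
        simp [Ne.symm hj]
      · simp
    rw [h2]
    exact h1

theorem exists_stdCount_le_pow {n σ : ℕ} {I : Ideal (MvPolynomial (Fin n) ℚ)}
    (hI : ringKrullDim (MvPolynomial (Fin n) ℚ ⧸ I) = (σ : WithBot (WithTop ℕ))) :
    ∃ C : ℕ, ∀ m, stdCount I m ≤ C * (m + 1) ^ σ := by
  replace hI : ringKrullDim (MvPolynomial (Fin n) ℚ ⧸ I) = ((σ : ℕ∞) : WithBot ℕ∞) := hI
  have hnt : Nontrivial (MvPolynomial (Fin n) ℚ ⧸ I) := by
    by_contra h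
    rw [not_nontrivial_iff_subsingleton] at h
    rw [ringKrullDim_eq_bot_of_subsingleton] at hI
    exact WithBot.bot_ne_coe hI
  obtain ⟨s, g, hinj, hfin⟩ := exists_finite_inj_algHom_of_fg ℚ (MvPolynomial (Fin n) ℚ ⧸ I)
  have hs : s ≤ σ := by
    have h1 := ringKrullDim_le_of_finite_injective g.toRingHom hfin hinj
    rw [hI, MvPolynomial.ringKrullDim_of_isNoetherianRing, ringKrullDim_eq_zero_of_field,
      zero_add, Nat.card_fin] at h1
    exact_mod_cast h1
  obtain ⟨t, b, hb⟩ := exists_fin_generators g.toRingHom hfin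
  obtain ⟨c, hc⟩ := monomial_mem_span_of_finite
    (fun i => Ideal.Quotient.mkₐ ℚ I (X i)) g b hb
  refine ⟨(c + 1) ^ s * t, fun m => ?_⟩
  let B : Set (Fin n →₀ ℕ) := {b | b ∈ stdExponents I ∧ b.degree ≤ m}
  have : Fintype B := (finite_stdExponents_degree_le I m).fintype
  let v : B → MvPolynomial (Fin n) ℚ ⧸ I := fun β => Ideal.Quotient.mkₐ ℚ I (monomial β.1 1)
  have hv : LinearIndependent ℚ v := by
    rw [Fintype.linearIndependent_iff]
    intro a ha β
    have h1 : (∑ β : B, monomial β.1 (a β)) ∈ I := by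
      rw [← Ideal.Quotient.eq_zero_iff_mem, ← Ideal.Quotient.mkₐ_eq_mk ℚ, map_sum, ← ha]
      refine Finset.sum_congr rfl fun γ _ => ?_
      rw [← map_smul, smul_monomial, smul_eq_mul, mul_one]
    have hcf : ∀ b, coeff b (∑ x : B, monomial x.1 (a x)) =
        if hb : b ∈ B then a ⟨b, hb⟩ else 0 := by
      intro b
      rw [coeff_sum]
      simp only [coeff_monomial]
      split_ifs with hb
      · rw [Finset.sum_eq_single (⟨b, hb⟩ : B)]
        · simp
        · intro c _ hcb
          exact if_neg fun h => hcb (Subtype.ext h)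
        · simp
      · refine Finset.sum_eq_zero fun c _ => if_neg ?_
        rintro rfl
        exact hb c.2
    have h3 := eq_zero_of_mem_of_support_subset_stdExponents h1 (by
      intro b hb
      rw [mem_support_iff, hcf] at hb
      by_contra hb'
      refine hb (dif_neg fun h => hb' h.1))
    have h4 := hcf β.1
    rw [h3, coeff_zero, dif_pos β.2] at h4
    exact h4.symm
  let T : Set ((Fin s →₀ ℕ) × Fin t) := {γ | γ.degree ≤ c * (m + 1)} ×ˢ Set.univ
  have hT : T.Finite := (Finsupp.finite_of_degree_le _).prod Set.finite_univ
  have hcard := card_le_ncard_of_mem_span hv hT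
    (fun p => g (monomial p.1 1) * b p.2) (by
      intro β
      have h1 := hc β.1
      have h2 : v β = ∏ i, (Ideal.Quotient.mkₐ ℚ I (X i)) ^ (β.1 i) := by
        simp only [v]
        rw [← Finsupp.prod_fintype _ _ (by simp), monomial_eq, C_1, one_mul, map_finsuppProd]
        simp only [map_pow]
      rw [h2]
      refine Submodule.span_mono (Set.image_mono ?_) h1
      intro p hp
      refine ⟨le_trans (b := c * (β.1.degree + 1)) hp ?_, Set.mem_univ _⟩
      exact Nat.mul_le_mul_left _ (Nat.succ_le_succ β.2.2))
  rw [Set.ncard_prod, Set.ncard_univ, Nat.card_fin, ← Nat.card_eq_fintype_card,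
    Nat.card_coe_set_eq] at hcard
  calc stdCount I m ≤ _ := hcard
    _ ≤ (c * (m + 1) + 1) ^ s * t := Nat.mul_le_mul_right _ (ncard_degree_le _ _)
    _ ≤ ((c + 1) * (m + 1)) ^ s * t := by
        gcongr
        nlinarith
    _ = (c + 1) ^ s * t * (m + 1) ^ s := by rw [mul_pow]; ring
    _ ≤ _ := Nat.mul_le_mul_left _ (Nat.pow_le_pow_right (Nat.succ_pos _) hs)

theorem dirDeriv_comm {n : ℕ} {R : Type*} [CommRing R] (g h : Fin n → R)
    (G : MvPolynomial (Fin n) R) : dirDeriv g (dirDeriv h G) = dirDeriv h (dirDeriv g G) := by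
  have key : ∀ g h : Fin n → R, dirDeriv g (dirDeriv h G) =
      ∑ j, ∑ i, C (g j) * (C (h i) * pderiv i (pderiv j G)) := by
    intro g h
    conv_lhs => rw [dirDeriv]
    simp_rw [pderiv_dirDeriv, dirDeriv, Finset.mul_sum]
  rw [key, key, Finset.sum_comm]
  refine Finset.sum_congr rfl fun i _ => Finset.sum_congr rfl fun j _ => ?_
  rw [pderiv_comm' i j]
  ring

theorem isHomogeneous_dirDeriv {n e : ℕ} {R : Type*} [CommRing R] {G : MvPolynomial (Fin n) R}
    (hG : G.IsHomogeneous e) (h : Fin n → R) : (dirDeriv h G).IsHomogeneous (e - 1) := by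
  refine IsHomogeneous.sum _ _ _ fun j _ => ?_
  simpa using (isHomogeneous_C (Fin n) (h j)).mul hG.pderiv

theorem map_dirDeriv {n : ℕ} (h : Fin n → ℤ) (G : MvPolynomial (Fin n) ℤ) :
    map (Int.castRingHom ℚ) (dirDeriv h G) =
      dirDeriv (fun i => (h i : ℚ)) (map (Int.castRingHom ℚ) G) := by
  simp [dirDeriv, map_sum, pderiv_map]

theorem eval_eq_coeff_zero_dirDeriv {n : ℕ} {R : Type*} [CommRing R] {L : MvPolynomial (Fin n) R}
    (hL : L.IsHomogeneous 1) (h : Fin n → R) : eval h L = coeff 0 (dirDeriv h L) := by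
  have h1 := congrArg (eval h) hL.sum_X_mul_pderiv
  rw [one_smul] at h1
  rw [← h1, map_sum, dirDeriv, coeff_sum]
  refine Finset.sum_congr rfl fun j _ => ?_
  have h0 : (pderiv j L).IsHomogeneous 0 := hL.pderiv
  have h2 : pderiv j L = C (coeff 0 (pderiv j L)) :=
    totalDegree_eq_zero_iff_eq_C.mp (Nat.le_zero.mp h0.totalDegree_le)
  rw [h2]
  simp

/-- Every monomial of `p` has degree at most `N - k`. -/
def DegreeDrop {n : ℕ} (k N : ℕ) (p : MvPolynomial (Fin n) ℤ) : Prop :=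
  ∀ m, coeff m p ≠ 0 → m.degree + k ≤ N

theorem DegreeDrop.add {n k N : ℕ} {p q : MvPolynomial (Fin n) ℤ} (hp : DegreeDrop k N p)
    (hq : DegreeDrop k N q) : DegreeDrop k N (p + q) := by
  intro m hm
  by_cases h : coeff m p = 0
  · rw [coeff_add, h, zero_add] at hm; exact hq m hm
  · exact hp m h

theorem DegreeDrop.sum {n k N : ℕ} {ι : Type*} {s : Finset ι} {p : ι → MvPolynomial (Fin n) ℤ}
    (hp : ∀ i ∈ s, DegreeDrop k N (p i)) : DegreeDrop k N (∑ i ∈ s, p i) := by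
  refine Finset.sum_induction p (DegreeDrop k N) (fun _ _ => DegreeDrop.add) ?_ hp
  intro m hm; simp at hm

theorem DegreeDrop.C_mul {n k N : ℕ} {p : MvPolynomial (Fin n) ℤ} (hp : DegreeDrop k N p)
    (a : ℤ) : DegreeDrop k N (C a * p) := by
  intro m hm
  rw [coeff_C_mul] at hm
  exact hp m (right_ne_zero_of_mul hm)

theorem DegreeDrop.X_mul {n k N : ℕ} {p : MvPolynomial (Fin n) ℤ} (hp : DegreeDrop k N p)
    (i : Fin n) : DegreeDrop k (N + 1) (X i * p) := by
  intro m hm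
  rw [coeff_X_mul'] at hm
  split_ifs at hm with h
  · have h1 := hp _ hm
    have hle : Finsupp.single i 1 ≤ m := by
      rw [Finsupp.single_le_iff]
      exact Nat.one_le_iff_ne_zero.mpr (Finsupp.mem_support_iff.mp h)
    have h2 : (m - Finsupp.single i 1).degree + 1 = m.degree := by
      conv_rhs => rw [← tsub_add_cancel_of_le hle]
      rw [map_add, Finsupp.degree_single]
    omega
  · exact absurd rfl hm

theorem DegreeDrop.mono {n k k' N N' : ℕ} {p : MvPolynomial (Fin n) ℤ} (hp : DegreeDrop k N p)
    (h : k' + N ≤ k + N') : DegreeDrop k' N' p := by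
  intro m hm
  have := hp m hm
  omega

/-- The polynomial `p (x + h)`. -/
def shiftPoly {n : ℕ} (h : Fin n → ℤ) : MvPolynomial (Fin n) ℤ →ₐ[ℤ] MvPolynomial (Fin n) ℤ :=
  aeval fun i => X i + C (h i)

theorem eval_shiftPoly {n : ℕ} (h x : Fin n → ℤ) (p : MvPolynomial (Fin n) ℤ) :
    eval x (shiftPoly h p) = eval (x + h) p := by
  induction p using MvPolynomial.induction_on with
  | C a => simp [shiftPoly]
  | add p q hp hq => simp [hp, hq]
  | mul_X p i hp => simp [hp]; simp [shiftPoly]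

theorem degreeDrop_monomial_shiftPoly {n : ℕ} (h : Fin n → ℤ) (m : Fin n →₀ ℕ) :
    DegreeDrop 0 m.degree (monomial m (1 : ℤ)) ∧
    DegreeDrop 1 m.degree (shiftPoly h (monomial m (1 : ℤ)) - monomial m 1) ∧
    DegreeDrop 2 m.degree (shiftPoly h (monomial m (1 : ℤ)) - monomial m 1 -
      dirDeriv h (monomial m 1)) := by
  induction hd : m.degree generalizing m with
  | zero =>
    have : m = 0 := (Finsupp.degree_eq_zero_iff m).mp hd
    subst this
    have h1 : shiftPoly h (monomial 0 (1 : ℤ)) - monomial 0 1 = 0 := by simp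
    have h2 : dirDeriv h (monomial 0 (1 : ℤ)) = 0 := by simp [dirDeriv]
    rw [h1, h2, sub_zero]
    refine ⟨fun m hm => ?_, fun m hm => by simp at hm, fun m hm => by simp at hm⟩
    rw [coeff_monomial] at hm
    split_ifs at hm with h
    · subst h; simp
    · exact absurd rfl hm
  | succ N ih =>
    have hne : m ≠ 0 := by rintro rfl; simp at hd
    obtain ⟨i, hi⟩ := Finsupp.ne_iff.mp hne
    have hle : Finsupp.single i 1 ≤ m := by
      simpa [Finsupp.single_le_iff] using Nat.one_le_iff_ne_zero.mpr hi
    obtain ⟨m', rfl⟩ := exists_add_of_le hle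
    have hd' : m'.degree = N := by
      rw [map_add, Finsupp.degree_single] at hd; omega
    obtain ⟨h0, h1, h2⟩ := ih m' hd'
    have hX : monomial (Finsupp.single i 1 + m') (1 : ℤ) = X i * monomial m' 1 := by
      rw [X, monomial_mul, one_mul]
    set p := monomial m' (1 : ℤ)
    have hT : shiftPoly h (X i * p) = (X i + C (h i)) * shiftPoly h p := by
      rw [map_mul]; simp [shiftPoly]
    have hD : dirDeriv h (X i * p) = C (h i) * p + X i * dirDeriv h p := by
      simp only [dirDeriv, Derivation.leibniz, smul_eq_mul, mul_add, Finset.sum_add_distrib,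
        pderiv_X, Finset.mul_sum]
      rw [add_comm]
      congr 1
      · rw [Finset.sum_eq_single i]
        · simp
        · intro j _ hj; simp [Ne.symm hj]
        · simp
      · exact Finset.sum_congr rfl fun j _ => by ring
    rw [hX]
    refine ⟨h0.X_mul i, ?_, ?_⟩
    · have : shiftPoly h (X i * p) - X i * p =
          X i * (shiftPoly h p - p) + C (h i) * (shiftPoly h p - p) + C (h i) * p := by
        rw [hT]; ring
      rw [this]
      exact ((h1.X_mul i).add ((h1.C_mul _).mono (by omega))).add ((h0.C_mul _).mono (by omega))
    · have : shiftPoly h (X i * p) - X i * p - dirDeriv h (X i * p) =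
          X i * (shiftPoly h p - p - dirDeriv h p) + C (h i) * (shiftPoly h p - p) := by
        rw [hT, hD]; ring
      rw [this]
      exact (h2.X_mul i).add ((h1.C_mul _).mono (by omega))

theorem degreeDrop_shiftPoly {n N : ℕ} (h : Fin n → ℤ) {p : MvPolynomial (Fin n) ℤ}
    (hp : DegreeDrop 0 N p) : DegreeDrop 1 N (shiftPoly h p - p) ∧
      DegreeDrop 2 N (shiftPoly h p - p - dirDeriv h p) := by
  have hsum : p = ∑ m ∈ p.support, C (coeff m p) * monomial m 1 := by
    conv_lhs => rw [p.as_sum]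
    exact Finset.sum_congr rfl fun m _ => by rw [C_mul_monomial, mul_one]
  have hdeg : ∀ m ∈ p.support, m.degree ≤ N := fun m hm => hp m (mem_support_iff.mp hm)
  have h1 : shiftPoly h p - p = ∑ m ∈ p.support,
      C (coeff m p) * (shiftPoly h (monomial m 1) - monomial m 1) := by
    conv_lhs => rw [hsum]
    rw [map_sum, ← Finset.sum_sub_distrib]
    refine Finset.sum_congr rfl fun m _ => ?_
    rw [map_mul, mul_sub]; simp [shiftPoly]
  have h2 : dirDeriv h p = ∑ m ∈ p.support, C (coeff m p) * dirDeriv h (monomial m 1) := by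
    conv_lhs => rw [hsum]
    simp only [dirDeriv, map_sum, pderiv_C_mul, Finset.mul_sum]
    rw [Finset.sum_comm]
    refine Finset.sum_congr rfl fun i _ => Finset.sum_congr rfl fun j _ => by ring
  constructor
  · rw [h1]
    exact DegreeDrop.sum fun m hm => ((degreeDrop_monomial_shiftPoly h m).2.1.C_mul _).mono
      (by have := hdeg m hm; omega)
  · rw [h1, h2, ← Finset.sum_sub_distrib]
    refine DegreeDrop.sum fun m hm => ?_
    rw [← mul_sub]
    exact ((degreeDrop_monomial_shiftPoly h m).2.2.C_mul _).mono (by have := hdeg m hm; omega)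

/-- `G` is the homogeneous part of degree `e` of the polynomial `p` of degree at most `e`. -/
def HasLeadingForm {n : ℕ} (p : MvPolynomial (Fin n) ℤ) (e : ℕ) (G : MvPolynomial (Fin n) ℤ) :
    Prop :=
  G.IsHomogeneous e ∧ DegreeDrop 1 e (p - G)

theorem HasLeadingForm.difference {n e : ℕ} {p G : MvPolynomial (Fin n) ℤ}
    (hp : HasLeadingForm p (e + 1) G) (h : Fin n → ℤ) :
    HasLeadingForm (shiftPoly h p - p) e (dirDeriv h G) := by
  refine ⟨isHomogeneous_dirDeriv hp.1 h, ?_⟩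
  have hG : DegreeDrop 0 (e + 1) G := fun m hm => (degree_eq_of_isHomogeneous hp.1 hm).le
  have h1 := (degreeDrop_shiftPoly h hG).2
  have h2 := (degreeDrop_shiftPoly h (hp.2.mono (by omega : 0 + (e + 1) ≤ 1 + e))).1
  have : shiftPoly h p - p - dirDeriv h G =
      (shiftPoly h G - G - dirDeriv h G) + (shiftPoly h (p - G) - (p - G)) := by
    rw [map_sub]; ring
  rw [this]
  exact (h1.mono (by omega)).add h2

theorem hasLeadingForm_homogeneousComponent {n d : ℕ} {f : MvPolynomial (Fin n) ℤ}
    (hf : f.totalDegree ≤ d) : HasLeadingForm f d (homogeneousComponent d f) := by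
  refine ⟨homogeneousComponent_isHomogeneous d f, fun m hm => ?_⟩
  rw [coeff_sub, coeff_homogeneousComponent] at hm
  by_cases h : m.degree = d
  · rw [if_pos h, sub_self] at hm; exact absurd rfl hm
  · rw [if_neg h, sub_zero] at hm
    have h1 : m.degree ≤ f.totalDegree := le_totalDegree (mem_support_iff.mpr hm)
    omega

theorem HasLeadingForm.eval_eq {n : ℕ} {p G : MvPolynomial (Fin n) ℤ} (hp : HasLeadingForm p 1 G) :
    ∃ a : ℤ, ∀ x, eval x p = a + ∑ i, x i * coeff 0 (pderiv i G) := by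
  refine ⟨coeff 0 (p - G), fun x => ?_⟩
  have h1 : p - G = C (coeff 0 (p - G)) := by
    ext m
    rw [coeff_C]
    split_ifs with h
    · rw [h]
    · by_contra hne
      have := hp.2 m hne
      exact h ((Finsupp.degree_eq_zero_iff m).mp (by omega)).symm
  have h2 : eval x p = eval x (p - G) + eval x G := by rw [map_sub]; ring
  rw [h2, eval_eq_coeff_zero_dirDeriv hp.1, dirDeriv, coeff_sum]
  conv_lhs => rw [h1, eval_C]
  simp only [coeff_C_mul]

/-- The sum of `w (∇ (D_{h₁} ⋯ D_{h_k} G) (0))` over `h_i` in the cubes of the given radii. -/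
def iterSum {n : ℕ} (w : (Fin n → ℤ) → ℝ) : List ℕ → MvPolynomial (Fin n) ℤ → ℝ
  | [], G => w fun i => coeff 0 (pderiv i G)
  | r :: l, G => ∑ h ∈ cube n r, iterSum w l (dirDeriv h G)

theorem iterSum_perm {n : ℕ} (w : (Fin n → ℤ) → ℝ) {l l' : List ℕ} (h : l.Perm l')
    (G : MvPolynomial (Fin n) ℤ) : iterSum w l G = iterSum w l' G := by
  induction h generalizing G with
  | nil => rfl
  | cons x _ ih => exact Finset.sum_congr rfl fun h _ => ih _
  | swap x y l =>
    simp only [iterSum]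
    rw [Finset.sum_comm]
    exact Finset.sum_congr rfl fun g _ => Finset.sum_congr rfl fun h _ => by rw [dirDeriv_comm]
  | trans _ _ ih1 ih2 => exact (ih1 G).trans (ih2 G)

theorem iterSum_nonneg {n : ℕ} {w : (Fin n → ℤ) → ℝ} (hw : ∀ v, 0 ≤ w v) (l : List ℕ)
    (G : MvPolynomial (Fin n) ℤ) : 0 ≤ iterSum w l G := by
  induction l generalizing G with
  | nil => exact hw _
  | cons r l ih => exact Finset.sum_nonneg fun h _ => ih _

theorem iterSum_append_le {n : ℕ} {w w' : (Fin n → ℤ) → ℝ} {c : ℝ} {l₁ l₂ : List ℕ}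
    (h : ∀ G, iterSum w l₁ G ≤ c * iterSum w' l₂ G) (l : List ℕ) (G : MvPolynomial (Fin n) ℤ) :
    iterSum w (l ++ l₁) G ≤ c * iterSum w' (l ++ l₂) G := by
  induction l generalizing G with
  | nil => exact h G
  | cons r l ih =>
    simp only [List.cons_append, iterSum]
    rw [Finset.mul_sum]
    exact Finset.sum_le_sum fun h _ => ih _

theorem iterSum_replicate_mono {n : ℕ} {w : (Fin n → ℤ) → ℝ} (hw : ∀ v, 0 ≤ w v) {r r' : ℕ}
    (hr : r ≤ r') (b : ℕ) (G : MvPolynomial (Fin n) ℤ) :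
    iterSum w (List.replicate b r) G ≤ iterSum w (List.replicate b r') G := by
  induction b generalizing G with
  | zero => rfl
  | succ b ih =>
    simp only [List.replicate_succ, iterSum]
    refine (Finset.sum_le_sum fun h _ => ih _).trans
      (Finset.sum_le_sum_of_subset_of_nonneg (fun h hh => ?_) fun _ _ _ => iterSum_nonneg hw _ _)
    rw [mem_cube] at hh ⊢
    exact fun i => (hh i).trans (by exact_mod_cast hr)

theorem sum_stdCount_dirDeriv_le_int {n e : ℕ} {G : MvPolynomial (Fin n) ℤ}
    (hG : G.IsHomogeneous e) (he : 2 ≤ e) (H m : ℕ) :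
    ∑ h ∈ cube n H, stdCount (jacIdeal (map (Int.castRingHom ℚ) (dirDeriv h G))) m ≤
      (m + 2 * n * H + 1) ^ n * stdCount (jacIdeal (map (Int.castRingHom ℚ) G))
        (m + 2 * n * H) := by
  simp_rw [map_dirDeriv]
  exact sum_stdCount_dirDeriv_le (hG.map _) he H m

theorem iterSum_zero_le {n : ℕ} (t : ℕ) : ∃ C : ℕ, 1 ≤ C ∧ ∀ (Y : ℕ), 1 ≤ Y →
    ∀ G : MvPolynomial (Fin n) ℤ, G.IsHomogeneous (t + 2) →
      iterSum (fun v => if v = 0 then 1 else 0) (List.replicate (t + 1) Y) G ≤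
        C * (Y : ℝ) ^ (n * t) * stdCount (jacIdeal (map (Int.castRingHom ℚ) G)) (C * Y) := by
  induction t with
  | zero =>
    refine ⟨2 * n + 1, by omega, fun Y hY G hG => ?_⟩
    simp only [zero_add, List.replicate_one, iterSum, mul_zero, pow_zero, mul_one]
    rw [Finset.sum_boole]
    set S := (cube n Y).filter fun h => (fun i => coeff 0 (pderiv i (dirDeriv h G))) = 0
    have hS : S.card ≤ stdCount (jacIdeal (map (Int.castRingHom ℚ) G)) (2 * n * Y) := by
      refine card_le_stdCount_of_vanishing (Finset.filter_subset _ _) fun g hg s hs => ?_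
      have hs2 := (Finset.mem_filter.mp hs).2
      refine Submodule.span_induction (p := fun g _ => eval (fun i => (s i : ℚ)) g = 0)
        ?_ (by simp) (fun x y _ _ hx hy => by rw [map_add, hx, hy, add_zero])
        (fun a x _ hx => by rw [smul_eq_mul, map_mul, hx, mul_zero]) hg
      rintro _ ⟨i, rfl⟩
      have hL : (pderiv i G).IsHomogeneous 1 := hG.pderiv
      have h1 := eval_eq_coeff_zero_dirDeriv hL s
      rw [← pderiv_dirDeriv, show coeff 0 (pderiv i (dirDeriv s G)) = 0 from congrFun hs2 i] at h1
      change eval (fun i => (s i : ℚ)) (pderiv i (map (Int.castRingHom ℚ) G)) = 0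
      rw [pderiv_map, show (fun i => (s i : ℚ)) = (fun i => Int.castRingHom ℚ (s i)) from rfl,
        ← Function.comp_def, eval_map, ← eval₂_comp, h1, map_zero]
    have h1 : stdCount (jacIdeal (map (Int.castRingHom ℚ) G)) (2 * n * Y) ≤
        (2 * n + 1) * stdCount (jacIdeal (map (Int.castRingHom ℚ) G)) ((2 * n + 1) * Y) :=
      (stdCount_mono _ (Nat.mul_le_mul_right Y (by omega))).trans
        (Nat.le_mul_of_pos_left _ (by omega))
    exact_mod_cast hS.trans h1
  | succ t ih =>
    obtain ⟨C, hC1, hC⟩ := ih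
    set C' := C * (C + 2 * n + 1) ^ n + (C + 2 * n) with hC'
    refine ⟨C', by omega, fun Y hY G hG => ?_⟩
    have h1 : ∀ h ∈ cube n Y, iterSum (fun v => if v = 0 then 1 else 0)
        (List.replicate (t + 1) Y) (dirDeriv h G) ≤ C * (Y : ℝ) ^ (n * t) *
          stdCount (jacIdeal (map (Int.castRingHom ℚ) (dirDeriv h G))) (C * Y) :=
      fun h _ => hC Y hY _ (by simpa using isHomogeneous_dirDeriv hG h)
    have h2 := sum_stdCount_dirDeriv_le_int hG (by omega) Y (C * Y)
    have h3 : (C * Y + 2 * n * Y + 1) ^ n * stdCount (jacIdeal (map (Int.castRingHom ℚ) G))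
        (C * Y + 2 * n * Y) ≤ ((C + 2 * n + 1) ^ n * Y ^ n) *
          stdCount (jacIdeal (map (Int.castRingHom ℚ) G)) (C' * Y) := by
      rw [← mul_pow]
      refine Nat.mul_le_mul (Nat.pow_le_pow_left (by nlinarith) n) (stdCount_mono _ ?_)
      rw [← add_mul]
      exact Nat.mul_le_mul_right _ (by omega)
    have h4 : (∑ h ∈ cube n Y, (stdCount (jacIdeal (map (Int.castRingHom ℚ)
        (dirDeriv h G))) (C * Y) : ℝ)) ≤ ((C + 2 * n + 1) ^ n * Y ^ n) *
          stdCount (jacIdeal (map (Int.castRingHom ℚ) G)) (C' * Y) := by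
      exact_mod_cast h2.trans h3
    rw [List.replicate_succ, iterSum]
    refine (Finset.sum_le_sum h1).trans ?_
    rw [← Finset.mul_sum]
    have hCC : (C : ℝ) * (C + 2 * n + 1) ^ n ≤ C' := by
      rw [hC']; push_cast
      have : (0 : ℝ) ≤ C + 2 * n := by positivity
      linarith
    calc _ ≤ C * (Y : ℝ) ^ (n * t) * (((C + 2 * n + 1) ^ n * Y ^ n) *
          stdCount (jacIdeal (map (Int.castRingHom ℚ) G)) (C' * Y)) := by gcongr
      _ = (C * (C + 2 * n + 1) ^ n) * (Y : ℝ) ^ (n * (t + 1)) *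
          stdCount (jacIdeal (map (Int.castRingHom ℚ) G)) (C' * Y) := by ring
      _ ≤ _ := by gcongr

theorem abs_coeff_dirDeriv_le {n e : ℕ} {G : MvPolynomial (Fin n) ℤ} (hG : G.IsHomogeneous e)
    {B : ℝ} (hB : ∀ m, |((coeff m G : ℤ) : ℝ)| ≤ B) {H : ℕ} {h : Fin n → ℤ} (hh : h ∈ cube n H)
    (m : Fin n →₀ ℕ) : |((coeff m (dirDeriv h G) : ℤ) : ℝ)| ≤ n * e * H * B := by
  have hB0 : 0 ≤ B := (abs_nonneg _).trans (hB 0)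
  rw [dirDeriv, coeff_sum, Int.cast_sum]
  refine (Finset.abs_sum_le_sum_abs _ _).trans ?_
  have : ∀ j ∈ (Finset.univ : Finset (Fin n)),
      |((coeff m (C (h j) * pderiv j G) : ℤ) : ℝ)| ≤ e * H * B := by
    intro j _
    rw [coeff_C_mul, coeff_pderiv]
    push_cast
    rw [abs_mul, abs_mul]
    have h1 : |(h j : ℝ)| ≤ H := by exact_mod_cast mem_cube.mp hh j
    by_cases hc : coeff (m + Finsupp.single j 1) G = 0
    · rw [hc]; simp; positivity
    · have hd := degree_eq_of_isHomogeneous hG hc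
      rw [map_add, Finsupp.degree_single] at hd
      have h2 := Finsupp.le_degree j m
      have h3 : |(m j : ℝ) + 1| ≤ e := by
        rw [abs_of_nonneg (by positivity)]
        exact_mod_cast (by omega : m j + 1 ≤ e)
      calc _ ≤ (H : ℝ) * (B * e) := by
            gcongr
            exact hB _
        _ = _ := by ring
  refine (Finset.sum_le_sum this).trans (le_of_eq ?_)
  rw [Finset.sum_const, Finset.card_univ, Fintype.card_fin, nsmul_eq_mul]
  ring

open scoped Function in
theorem card_le_of_lt_dist {E : Type*} [NormedAddCommGroup E] [NormedSpace ℝ E]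
    [FiniteDimensional ℝ E] {Z τ : ℝ} (hZ : 0 ≤ Z) (hτ : 0 < τ) (s : Finset E)
    (hs : ∀ x ∈ s, ‖x‖ ≤ Z) (h : ∀ x ∈ s, ∀ y ∈ s, x ≠ y → τ < ‖x - y‖) :
    (s.card : ℝ) ≤ (2 * Z / τ + 1) ^ Module.finrank ℝ E := by
  borelize E
  let μ : Measure E := Measure.addHaar
  have hδ : 0 < τ / 2 := by positivity
  have hρ : 0 < Z + τ / 2 := by positivity
  have hD : Set.Pairwise (s : Set E) (Disjoint on fun x => Metric.ball (x : E) (τ / 2)) := by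
    rintro x hx y hy hxy
    apply Metric.ball_disjoint_ball
    rw [dist_eq_norm]
    linarith [h x hx y hy hxy]
  have hA : (⋃ x ∈ s, Metric.ball (x : E) (τ / 2)) ⊆ Metric.ball (0 : E) (Z + τ / 2) := by
    refine Set.iUnion₂_subset fun x hx => Metric.ball_subset_ball' ?_
    rw [dist_zero_right]
    linarith [hs x hx]
  have hI : (s.card : ENNReal) * ENNReal.ofReal ((τ / 2) ^ Module.finrank ℝ E) *
      μ (Metric.ball 0 1) ≤
        ENNReal.ofReal ((Z + τ / 2) ^ Module.finrank ℝ E) * μ (Metric.ball 0 1) :=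
    calc _ = μ (⋃ x ∈ s, Metric.ball (x : E) (τ / 2)) := by
          rw [measure_biUnion_finset hD fun x _ => measurableSet_ball]
          simp only [μ.addHaar_ball_of_pos _ hδ, Finset.sum_const, nsmul_eq_mul, mul_assoc]
      _ ≤ μ (Metric.ball (0 : E) (Z + τ / 2)) := measure_mono hA
      _ = _ := by simp only [μ.addHaar_ball_of_pos _ hρ]
  have hJ := (ENNReal.mul_le_mul_iff_left (Metric.measure_ball_pos _ _ zero_lt_one).ne'
    measure_ball_lt_top.ne).1 hI
  have hK := ENNReal.toReal_le_of_le_ofReal (pow_nonneg hρ.le _) hJ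
  rw [ENNReal.toReal_mul, ENNReal.toReal_natCast, ENNReal.toReal_ofReal (by positivity)] at hK
  rw [show 2 * Z / τ + 1 = (Z + τ / 2) / (τ / 2) by field_simp, div_pow,
    le_div_iff₀ (by positivity)]
  exact hK

theorem card_le_of_card_close_le {ι E : Type*} [NormedAddCommGroup E] [NormedSpace ℝ E]
    [FiniteDimensional ℝ E] {Z τ : ℝ} (hZ : 0 ≤ Z) (hτ : 0 < τ) (A : Finset ι) (γ : ι → E)
    (hγ : ∀ a ∈ A, ‖γ a‖ ≤ Z) {N : ℝ} (hN0 : 0 ≤ N)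
    (hN : ∀ a₀ ∈ A, ((A.filter fun a => ‖γ a - γ a₀‖ ≤ τ).card : ℝ) ≤ N) :
    (A.card : ℝ) ≤ N * (2 * Z / τ + 1) ^ Module.finrank ℝ E := by
  obtain ⟨sep, hsep⟩ : ∃ sep : Finset ι → Prop, ∀ S, sep S ↔
    ∀ x ∈ S, ∀ y ∈ S, x ≠ y → τ < ‖γ x - γ y‖ := ⟨_, fun _ => Iff.rfl⟩
  obtain ⟨S, hS, hmax⟩ := (A.powerset.filter sep).exists_max_image Finset.card
    ⟨∅, by simp [hsep]⟩
  rw [Finset.mem_filter, Finset.mem_powerset, hsep] at hS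
  have hcov : A ⊆ S.biUnion fun a₀ => A.filter fun a => ‖γ a - γ a₀‖ ≤ τ := by
    intro a ha
    by_contra hna
    simp only [Finset.mem_biUnion, Finset.mem_filter, not_exists, not_and, not_le] at hna
    have haS : a ∉ S := fun h => by
      have := hna a h ha
      rw [sub_self, norm_zero] at this
      linarith
    have := hmax (insert a S) (by
      rw [Finset.mem_filter, Finset.mem_powerset, hsep]
      refine ⟨Finset.insert_subset ha hS.1, fun x hx y hy hxy => ?_⟩
      rw [Finset.mem_insert] at hx hy
      rcases hx with rfl | hx <;> rcases hy with rfl | hy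
      · exact absurd rfl hxy
      · exact hna y hy ha
      · rw [norm_sub_rev]; exact hna x hx ha
      · exact hS.2 x hx y hy hxy)
    rw [Finset.card_insert_of_notMem haS] at this
    omega
  have hinj : Set.InjOn γ S := by
    intro x hx y hy hxy
    by_contra hne
    have := hS.2 x hx y hy hne
    rw [hxy, sub_self, norm_zero] at this
    linarith
  have hScard := card_le_of_lt_dist hZ hτ (S.image γ)
    (fun x hx => by
      obtain ⟨a, ha, rfl⟩ := Finset.mem_image.mp hx
      exact hγ a (hS.1 ha))
    (fun x hx y hy hxy => by
      obtain ⟨a, ha, rfl⟩ := Finset.mem_image.mp hx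
      obtain ⟨b, hb, rfl⟩ := Finset.mem_image.mp hy
      exact hS.2 a ha b hb fun h => hxy (h ▸ rfl))
  rw [Finset.card_image_of_injOn hinj] at hScard
  calc (A.card : ℝ) ≤ ∑ a₀ ∈ S, ((A.filter fun a => ‖γ a - γ a₀‖ ≤ τ).card : ℝ) := by
        exact_mod_cast (Finset.card_le_card hcov).trans Finset.card_biUnion_le
    _ ≤ ∑ _a₀ ∈ S, N := Finset.sum_le_sum fun a ha => hN a (hS.1 ha)
    _ = N * S.card := by rw [Finset.sum_const, nsmul_eq_mul, mul_comm]
    _ ≤ _ := by gcongr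

theorem nint_le_abs_sub (x : ℝ) (m : ℤ) : nint x ≤ |x - m| := round_le x m

theorem nint_nonneg (x : ℝ) : 0 ≤ nint x := abs_nonneg _

theorem card_le_of_card_close_le_submodule {ι E : Type*} [NormedAddCommGroup E]
    [NormedSpace ℝ E] [FiniteDimensional ℝ E] {Z τ : ℝ} (hZ : 0 ≤ Z) (hτ : 0 < τ)
    (A : Finset ι) (γ : ι → E) (V : Submodule ℝ E) (hV : ∀ a ∈ A, γ a ∈ V)
    (hγ : ∀ a ∈ A, ‖γ a‖ ≤ Z) {N : ℝ} (hN0 : 0 ≤ N)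
    (hN : ∀ a₀ ∈ A, ((A.filter fun a => ‖γ a - γ a₀‖ ≤ τ).card : ℝ) ≤ N) :
    (A.card : ℝ) ≤ N * (2 * Z / τ + 1) ^ Module.finrank ℝ V := by
  have hγV : ∀ a ∈ A, (((if h : γ a ∈ V then ⟨γ a, h⟩ else 0 : V)) : E) = γ a := fun a ha => by
    rw [dif_pos (hV a ha)]
  refine card_le_of_card_close_le hZ hτ A (fun a => if h : γ a ∈ V then ⟨γ a, h⟩ else 0)
    (fun a ha => ?_) hN0 (fun a₀ ha₀ => ?_)
  · rw [← Submodule.norm_coe, hγV a ha]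
    exact hγ a ha
  · refine le_trans (le_of_eq ?_) (hN a₀ ha₀)
    congr 2
    refine Finset.filter_congr fun a ha => ?_
    rw [← Submodule.norm_coe, Submodule.coe_sub, hγV a ha, hγV a₀ ha₀]

theorem finrank_le_of_isotropic {n : ℕ} (V : Submodule ℝ ((Fin n → ℝ) × (Fin n → ℝ)))
    (hV : ∀ x ∈ V, ∀ y ∈ V, x.1 ⬝ᵥ y.2 - y.1 ⬝ᵥ x.2 = 0) : Module.finrank ℝ V ≤ n := by
  let J : ((Fin n → ℝ) × (Fin n → ℝ)) ≃ₗ[ℝ] ((Fin n → ℝ) × (Fin n → ℝ)) :=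
    (LinearEquiv.prodComm ℝ _ _).trans
      (LinearEquiv.prodCongr (LinearEquiv.neg ℝ) (LinearEquiv.refl ℝ _))
  have hJ : ∀ w, J w = (-w.2, w.1) := fun w => rfl
  have hdis : Disjoint V (V.map (J : _ →ₗ[ℝ] _)) := by
    rw [Submodule.disjoint_def]
    rintro z hz ⟨w, hw, rfl⟩
    have h1 := hV w hw _ hz
    simp only [LinearEquiv.coe_coe, hJ, neg_dotProduct, sub_neg_eq_add] at h1 ⊢
    have h2 : 0 ≤ w.1 ⬝ᵥ w.1 := Finset.sum_nonneg fun i _ => mul_self_nonneg _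
    have h3 : 0 ≤ w.2 ⬝ᵥ w.2 := Finset.sum_nonneg fun i _ => mul_self_nonneg _
    have h4 := dotProduct_self_eq_zero.mp (show w.1 ⬝ᵥ w.1 = 0 by linarith)
    have h5 := dotProduct_self_eq_zero.mp (show w.2 ⬝ᵥ w.2 = 0 by linarith)
    rw [h4, h5, neg_zero]
    rfl
  have h1 := Submodule.finrank_add_finrank_le_of_disjoint hdis
  rw [LinearEquiv.finrank_map_eq J V, Module.finrank_prod, Module.finrank_fintype_fun_eq_card,
    Fintype.card_fin] at h1
  omega

/-- Davenport's shrinking lemma: the number of integer points `g` in a cube at which a symmetric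
system of linear forms is close to the integers controls the same number for a smaller cube. -/
theorem card_near_int_le {n : ℕ} (α : ℝ) (v : (Fin n → ℤ) →+ (Fin n → ℤ))
    (hv : ∀ g g', ∑ i, g i * v g' i = ∑ i, g' i * v g i) {r ρ : ℕ} (hρ : 1 ≤ ρ) (hr : ρ ≤ r)
    {δ : ℝ} (hδ : 0 < δ) (hrδ : r * δ ≤ 2) :
    (((cube n r).filter fun g => ∀ i, nint (α * v g i) ≤ δ).card : ℝ) ≤
      ((4 * n + 5) ^ (2 * n) * 3 ^ n) * ((r : ℝ) / ρ) ^ n *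
        ((cube n ρ).filter fun g => ∀ i, nint (α * v g i) ≤ δ * (ρ / r)).card := by
  have hr0 : (0 : ℝ) < r := by exact_mod_cast (by omega : 0 < r)
  have hρ0 : (0 : ℝ) < ρ := by exact_mod_cast (by omega : 0 < ρ)
  let A : ℝ → Finset (Fin n → ℤ) := fun t => (cube n r).filter fun g =>
    ∀ i, |(g i : ℝ)| ≤ t * r ∧ nint (α * v g i) ≤ t * δ
  have memA : ∀ t g, g ∈ A t ↔ g ∈ cube n r ∧
      ∀ i, |(g i : ℝ)| ≤ t * r ∧ nint (α * v g i) ≤ t * δ := fun t g => Finset.mem_filter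
  let γ : (Fin n → ℤ) → (Fin n → ℝ) × (Fin n → ℝ) := fun g =>
    (fun i => g i / r, fun i => (α * v g i - round (α * v g i)) / δ)
  have hγn : ∀ t, 0 ≤ t → ∀ g ∈ A t, ‖γ g‖ ≤ t := by
    intro t ht g hg
    have hg2 := ((memA t g).mp hg).2
    rw [Prod.norm_def, max_le_iff, pi_norm_le_iff_of_nonneg ht, pi_norm_le_iff_of_nonneg ht]
    refine ⟨fun i => ?_, fun i => ?_⟩
    · rw [Real.norm_eq_abs, abs_div, abs_of_pos hr0, div_le_iff₀ hr0]
      exact (hg2 i).1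
    · rw [Real.norm_eq_abs, abs_div, abs_of_pos hδ, div_le_iff₀ hδ]
      exact (hg2 i).2
  have hclose : ∀ t, 0 ≤ t → t ≤ 1 → ∀ a a₀, ‖γ a - γ a₀‖ ≤ t → a - a₀ ∈ A t := by
    intro t ht ht1 a a₀ h
    rw [Prod.norm_def, max_le_iff, pi_norm_le_iff_of_nonneg ht, pi_norm_le_iff_of_nonneg ht] at h
    have h1 : ∀ i, |((a - a₀) i : ℝ)| ≤ t * r := fun i => by
      have := h.1 i
      simp only [γ, Prod.fst_sub, Pi.sub_apply, Real.norm_eq_abs] at this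
      rw [← sub_div, abs_div, abs_of_pos hr0, div_le_iff₀ hr0] at this
      simpa using this
    rw [memA, mem_cube]
    refine ⟨fun i => ?_, fun i => ⟨h1 i, ?_⟩⟩
    · have := (h1 i).trans (mul_le_of_le_one_left hr0.le ht1)
      exact_mod_cast this
    · have := h.2 i
      simp only [γ, Prod.snd_sub, Pi.sub_apply, Real.norm_eq_abs] at this
      rw [← sub_div, abs_div, abs_of_pos hδ, div_le_iff₀ hδ] at this
      refine (nint_le_abs_sub _ (round (α * v a i) - round (α * v a₀ i))).trans
        (le_trans (le_of_eq ?_) this)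
      rw [map_sub, Pi.sub_apply]
      push_cast
      congr 1
      ring
  have hfib : ∀ (B : Finset (Fin n → ℤ)) (t : ℝ), 0 ≤ t → t ≤ 1 → ∀ a₀ ∈ B,
      (((B.filter fun a => ‖γ a - γ a₀‖ ≤ t).card : ℕ) : ℝ) ≤ (A t).card := by
    intro B t ht ht1 a₀ _
    norm_cast
    refine Finset.card_le_card_of_injOn (fun a => a - a₀) (fun a ha => ?_)
      fun a _ b _ hab => by simpa using hab
    exact hclose t ht ht1 a a₀ (Finset.mem_filter.mp ha).2
  set c₀ : ℝ := 1 / (2 * n + 2) with hc₀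
  have hc₀0 : 0 < c₀ := by positivity
  have hc₀1 : c₀ ≤ 1 := by
    rw [hc₀, div_le_one (by positivity)]
    linarith [(Nat.cast_nonneg n : (0 : ℝ) ≤ n)]
  have step1 : ((A 1).card : ℝ) ≤ (A c₀).card * (2 * 1 / c₀ + 1) ^ (2 * n) := by
    have := card_le_of_card_close_le zero_le_one hc₀0 (A 1) γ (hγn 1 zero_le_one)
      (Nat.cast_nonneg _) (hfib (A 1) c₀ hc₀0.le hc₀1)
    rwa [Module.finrank_prod, Module.finrank_fintype_fun_eq_card, Fintype.card_fin,
      ← two_mul] at this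
  have hiso : ∀ a ∈ A c₀, ∀ b ∈ A c₀, (γ a).1 ⬝ᵥ (γ b).2 - (γ b).1 ⬝ᵥ (γ a).2 = 0 := by
    intro a ha b hb
    have ha2 := ((memA _ _).mp ha).2
    have hb2 := ((memA _ _).mp hb).2
    set m : ℤ := ∑ i, (b i * round (α * v a i) - a i * round (α * v b i)) with hm
    have key : ∑ i, ((a i : ℝ) * (α * v b i - round (α * v b i)) -
        b i * (α * v a i - round (α * v a i))) = m := by
      have h1 : (∑ i, (a i : ℝ) * v b i) = ∑ i, (b i : ℝ) * v a i := by exact_mod_cast hv a b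
      have h2 : ∀ i, (a i : ℝ) * (α * v b i - round (α * v b i)) -
          b i * (α * v a i - round (α * v a i)) = α * ((a i : ℝ) * v b i) - α * (b i * v a i) +
            (b i * round (α * v a i) - a i * round (α * v b i)) := fun i => by ring
      simp_rw [h2]
      rw [Finset.sum_add_distrib, Finset.sum_sub_distrib, ← Finset.mul_sum, ← Finset.mul_sum, h1,
        sub_self, zero_add, hm]
      push_cast
      rfl
    have hbound : |(m : ℝ)| < 1 := by
      rw [← key]
      have hterm : ∀ i ∈ (Finset.univ : Finset (Fin n)),
          |(a i : ℝ) * (α * v b i - round (α * v b i)) -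
            b i * (α * v a i - round (α * v a i))| ≤ 2 * (c₀ * c₀ * (r * δ)) := by
        intro i _
        refine (abs_sub _ _).trans ?_
        rw [abs_mul, abs_mul]
        have e1 : |(a i : ℝ)| * |α * v b i - round (α * v b i)| ≤ (c₀ * r) * (c₀ * δ) :=
          mul_le_mul (ha2 i).1 (hb2 i).2 (abs_nonneg _) (by positivity)
        have e2 : |(b i : ℝ)| * |α * v a i - round (α * v a i)| ≤ (c₀ * r) * (c₀ * δ) :=
          mul_le_mul (hb2 i).1 (ha2 i).2 (abs_nonneg _) (by positivity)
        linarith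
      refine (Finset.abs_sum_le_sum_abs _ _).trans_lt
        ((Finset.sum_le_sum hterm).trans_lt ?_)
      rw [Finset.sum_const, Finset.card_univ, Fintype.card_fin, nsmul_eq_mul]
      have h3 : (n : ℝ) * (2 * (c₀ * c₀ * (r * δ))) ≤ n * (2 * (c₀ * c₀ * 2)) := by gcongr
      refine h3.trans_lt ?_
      rw [hc₀, div_mul_div_comm, one_mul, div_mul_eq_mul_div, mul_div_assoc', mul_div_assoc',
        div_lt_one (by positivity)]
      nlinarith [(Nat.cast_nonneg n : (0 : ℝ) ≤ n)]
    have hm0 : m = 0 := by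
      have : |m| < 1 := by exact_mod_cast hbound
      exact Int.abs_lt_one_iff.mp this
    rw [hm0, Int.cast_zero] at key
    have : (γ a).1 ⬝ᵥ (γ b).2 - (γ b).1 ⬝ᵥ (γ a).2 = (∑ i, ((a i : ℝ) * (α * v b i -
        round (α * v b i)) - b i * (α * v a i - round (α * v a i)))) / (r * δ) := by
      simp only [dotProduct, γ]
      rw [← Finset.sum_sub_distrib, Finset.sum_div]
      refine Finset.sum_congr rfl fun i _ => ?_
      field_simp
    rw [this, key, zero_div]
  set V := Submodule.span ℝ (γ '' (A c₀ : Set (Fin n → ℤ))) with hVdef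
  have hVn : Module.finrank ℝ V ≤ n := by
    refine finrank_le_of_isotropic V fun x hx y hy => ?_
    refine Submodule.span_induction₂ (p := fun x y _ _ => x.1 ⬝ᵥ y.2 - y.1 ⬝ᵥ x.2 = 0)
      ?_ ?_ ?_ ?_ ?_ ?_ ?_ hx hy
    · rintro _ _ ⟨a, ha, rfl⟩ ⟨b, hb, rfl⟩
      exact hiso a ha b hb
    · intro y _; simp
    · intro x _; simp
    · intro x y z _ _ _ h1 h2
      simp only [Prod.fst_add, Prod.snd_add, add_dotProduct, dotProduct_add]
      linarith
    · intro x y z _ _ _ h1 h2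
      simp only [Prod.fst_add, Prod.snd_add, add_dotProduct, dotProduct_add]
      linarith
    · intro s x y _ _ h
      simp only [Prod.smul_fst, Prod.smul_snd, smul_dotProduct, dotProduct_smul, ← smul_sub, h,
        smul_zero]
    · intro s x y _ _ h
      simp only [Prod.smul_fst, Prod.smul_snd, smul_dotProduct, dotProduct_smul, ← smul_sub, h,
        smul_zero]
  set t : ℝ := ρ / r with ht
  have ht0 : 0 < t := by positivity
  have ht1 : t ≤ 1 := by rw [ht, div_le_one hr0]; exact_mod_cast hr
  have step2 : ((A c₀).card : ℝ) ≤ (A t).card * (3 / t) ^ n := by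
    have h1 := card_le_of_card_close_le_submodule zero_le_one ht0 (A c₀) γ V
      (fun a ha => Submodule.subset_span ⟨a, ha, rfl⟩)
      (fun a ha => (hγn c₀ hc₀0.le a ha).trans hc₀1) (Nat.cast_nonneg _)
      (hfib (A c₀) t ht0.le ht1)
    refine h1.trans (mul_le_mul_of_nonneg_left ?_ (Nat.cast_nonneg _))
    have h2 : 1 ≤ 2 * 1 / t + 1 := by
      have : 0 ≤ 2 * 1 / t := by positivity
      linarith
    refine (pow_le_pow_right₀ h2 hVn).trans (pow_le_pow_left₀ (by positivity) ?_ n)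
    rw [le_div_iff₀ ht0, add_mul, div_mul_cancel₀ _ ht0.ne']
    linarith
  have hA1 : (cube n r).filter (fun g => ∀ i, nint (α * v g i) ≤ δ) ⊆ A 1 := by
    intro g hg
    rw [Finset.mem_filter] at hg
    rw [memA]
    refine ⟨hg.1, fun i => ⟨?_, by rw [one_mul]; exact hg.2 i⟩⟩
    rw [one_mul]
    exact_mod_cast mem_cube.mp hg.1 i
  have hAt : A t ⊆ (cube n ρ).filter (fun g => ∀ i, nint (α * v g i) ≤ δ * (ρ / r)) := by
    intro g hg
    rw [memA] at hg
    rw [Finset.mem_filter, mem_cube]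
    refine ⟨fun i => ?_, fun i => (hg.2 i).2.trans_eq (mul_comm _ _)⟩
    have := (hg.2 i).1
    rw [ht, div_mul_cancel₀ _ hr0.ne'] at this
    exact_mod_cast this
  have e1 : 2 * 1 / c₀ + 1 = 4 * n + 5 := by rw [hc₀]; field_simp; ring
  have e2 : 3 / t = 3 * (r / ρ) := by rw [ht]; field_simp
  rw [e1] at step1
  rw [e2, mul_pow] at step2
  calc _ ≤ ((A 1).card : ℝ) := by exact_mod_cast Finset.card_le_card hA1
    _ ≤ _ := step1
    _ ≤ ((A t).card * (3 ^ n * (r / ρ) ^ n)) * (4 * n + 5) ^ (2 * n) := by gcongr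
    _ = ((4 * n + 5) ^ (2 * n) * 3 ^ n) * ((r : ℝ) / ρ) ^ n * (A t).card := by ring
    _ ≤ _ := by gcongr

/-- Indicator function of the integer vectors `v` such that all entries of `α v` are within `δ` of
the integers. -/
def nearWeight {n : ℕ} (α δ : ℝ) (v : Fin n → ℤ) : ℝ :=
  if ∀ i, nint (α * v i) ≤ δ then 1 else 0

theorem nearWeight_nonneg {n : ℕ} (α δ : ℝ) (v : Fin n → ℤ) : 0 ≤ nearWeight α δ v := by
  unfold nearWeight
  split_ifs <;> norm_num

theorem coeff_zero_dirDeriv {n : ℕ} (g : Fin n → ℤ) (Q : MvPolynomial (Fin n) ℤ) :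
    coeff 0 (dirDeriv g Q) = ∑ i, g i * coeff 0 (pderiv i Q) := by
  rw [dirDeriv, coeff_sum]
  simp_rw [coeff_C_mul]

/-- The additive map sending `g` to `∇ (D_g Q) (0)`. -/
def gradDir {n : ℕ} (Q : MvPolynomial (Fin n) ℤ) : (Fin n → ℤ) →+ (Fin n → ℤ) where
  toFun g i := coeff 0 (pderiv i (dirDeriv g Q))
  map_zero' := by
    ext i
    simp [dirDeriv]
  map_add' g g' := by
    ext i
    simp [dirDeriv, add_mul, Finset.sum_add_distrib]

theorem iterSum_nearWeight_singleton_le {n : ℕ} (α : ℝ) {r ρ : ℕ} (hρ : 1 ≤ ρ) (hr : ρ ≤ r)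
    {δ : ℝ} (hδ : 0 < δ) (hrδ : r * δ ≤ 2) (Q : MvPolynomial (Fin n) ℤ) :
    iterSum (nearWeight α δ) [r] Q ≤ ((4 * n + 5) ^ (2 * n) * 3 ^ n) * ((r : ℝ) / ρ) ^ n *
      iterSum (nearWeight α (δ * (ρ / r))) [ρ] Q := by
  simp only [iterSum, nearWeight, Finset.sum_boole]
  exact card_near_int_le α (gradDir Q)
    (fun g g' => by
      change ∑ i, g i * coeff 0 (pderiv i (dirDeriv g' Q)) =
        ∑ i, g' i * coeff 0 (pderiv i (dirDeriv g Q))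
      rw [← coeff_zero_dirDeriv, ← coeff_zero_dirDeriv, dirDeriv_comm]) hρ hr hδ hrδ

theorem iterSum_nearWeight_shrink {n : ℕ} (α : ℝ) {r ρ : ℕ} (hρ : 1 ≤ ρ) (hr : ρ ≤ r)
    (b : ℕ) : ∀ (j : ℕ) {δ : ℝ}, 0 < δ → r * δ ≤ 2 → ∀ (G : MvPolynomial (Fin n) ℤ),
    iterSum (nearWeight α δ) (List.replicate j ρ ++ List.replicate b r) G ≤
      (((4 * n + 5) ^ (2 * n) * 3 ^ n) * ((r : ℝ) / ρ) ^ n) ^ b *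
        iterSum (nearWeight α (δ * (ρ / r) ^ b)) (List.replicate (j + b) ρ) G := by
  have hr0 : (0 : ℝ) < r := by exact_mod_cast (by omega : 0 < r)
  have hρ0 : (0 : ℝ) < ρ := by exact_mod_cast (by omega : 0 < ρ)
  have ht1 : (ρ : ℝ) / r ≤ 1 := by rw [div_le_one hr0]; exact_mod_cast hr
  induction b with
  | zero => intro j δ _ _ G; simp
  | succ b ih =>
    intro j δ hδ hrδ G
    have h1 := iterSum_append_le (fun Q => iterSum_nearWeight_singleton_le α hρ hr hδ hrδ Q)
      (List.replicate j ρ ++ List.replicate b r) G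
    have h2 := iterSum_perm (nearWeight (n := n) α (δ * (ρ / r)))
      (l := List.replicate j ρ ++ List.replicate b r ++ [ρ])
      (l' := List.replicate (j + 1) ρ ++ List.replicate b r) (by
        rw [List.replicate_succ', List.append_assoc, List.append_assoc]
        exact List.Perm.append_left _ List.perm_append_comm) G
    have h3 := ih (j + 1) (δ := δ * (ρ / r)) (by positivity)
      (le_trans (by
        rw [← mul_assoc]
        exact mul_le_of_le_one_right (by positivity) ht1) hrδ) G
    rw [h2] at h1
    rw [List.replicate_succ', ← List.append_assoc]
    refine h1.trans ((mul_le_mul_of_nonneg_left h3 (by positivity)).trans (le_of_eq ?_))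
    rw [← mul_assoc, ← pow_succ', mul_assoc δ, ← pow_succ', add_right_comm, add_assoc]

theorem iterSum_nearWeight_le_zero {n : ℕ} (α δ : ℝ) (E Y b : ℕ) (hbE : b + 1 ≤ E) :
    ∀ (B : ℝ) (G : MvPolynomial (Fin n) ℤ), G.IsHomogeneous (b + 1) →
    (∀ m, |((coeff m G : ℤ) : ℝ)| ≤ B) →
    (∀ m : ℤ, |(m : ℝ)| ≤ (n * E * Y) ^ b * B → nint (α * m) ≤ δ → m = 0) →
    iterSum (nearWeight α δ) (List.replicate b Y) G ≤
      iterSum (fun v => if v = 0 then 1 else 0) (List.replicate b Y) G := by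
  induction b with
  | zero =>
    intro B G hG hB hm
    simp only [List.replicate_zero, iterSum, nearWeight]
    split_ifs with h1 h2
    · rfl
    · refine absurd (funext fun i => hm _ ?_ (h1 i)) h2
      rw [coeff_pderiv]
      simpa using hB _
    · norm_num
    · rfl
  | succ b ih =>
    intro B G hG hB hm
    have hB0 : 0 ≤ B := (abs_nonneg _).trans (hB 0)
    simp only [List.replicate_succ, iterSum]
    refine Finset.sum_le_sum fun h hh => ih (by omega) (n * E * Y * B) _
      (by simpa using isHomogeneous_dirDeriv hG h) (fun m => ?_) fun m hm1 => hm m (hm1.trans ?_)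
    · refine (abs_coeff_dirDeriv_le hG hB hh m).trans ?_
      gcongr
    · exact le_of_eq (by ring)

theorem norm_eC (x : ℝ) : ‖eC x‖ = 1 := by
  rw [eC, show 2 * (Real.pi : ℂ) * Complex.I * x = ((2 * Real.pi * x : ℝ) : ℂ) * Complex.I by
    push_cast; ring]
  exact Complex.norm_exp_ofReal_mul_I _

theorem eC_add (x y : ℝ) : eC (x + y) = eC x * eC y := by
  rw [eC, eC, eC, ← Complex.exp_add]
  push_cast
  ring_nf

theorem eC_int (m : ℤ) : eC m = 1 := by
  rw [eC, show 2 * (Real.pi : ℂ) * Complex.I * ((m : ℝ) : ℂ) = m * (2 * Real.pi * Complex.I) by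
    push_cast; ring]
  exact Complex.exp_int_mul_two_pi_mul_I m

theorem conj_eC (x : ℝ) : (starRingEnd ℂ) (eC x) = eC (-x) := by
  rw [eC, eC, ← Complex.exp_conj]
  simp [map_ofNat]

theorem norm_sum_sq_mul_le {n : ℕ} {F : (Fin n → ℤ) → ℂ} {R H : ℕ}
    (hF : ∀ x, x ∉ cube n R → F x = 0) (hH : 1 ≤ H) :
    ‖∑ x ∈ cube n R, F x‖ ^ 2 * (H : ℝ) ^ n ≤ (2 * R + 2 * H + 1) ^ n *
      ∑ h ∈ cube n H, ‖∑' x, F (x + h) * (starRingEnd ℂ) (F x)‖ := by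
  set K : Finset (Fin n → ℤ) := Finset.Icc 0 (fun _ => (H : ℤ) - 1) with hK
  have memK : ∀ h, h ∈ K ↔ ∀ i, 0 ≤ h i ∧ h i ≤ H - 1 := fun h => by
    rw [hK, Finset.mem_Icc, Pi.le_def, Pi.le_def, ← forall_and]; rfl
  have cardK : K.card = H ^ n := by
    rw [hK, Pi.card_Icc]
    simp
  set c : ((Fin n → ℤ)) → ℂ := fun h => ∑' x, F (x + h) * (starRingEnd ℂ) (F x) with hc
  have hsupp : ∀ h ∈ K, ∀ x, x ∉ cube n (R + H) → F (x + h) = 0 := by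
    intro h hh x hx
    refine hF _ fun hxh => hx ?_
    rw [mem_cube] at hxh ⊢
    intro i
    have h1 := (memK h).mp hh i
    have h2 := hxh i
    rw [Pi.add_apply, abs_le] at h2
    rw [abs_le]
    push_cast
    constructor <;> linarith
  have hshift : ∀ h ∈ K, ∑ x ∈ cube n (R + H), F (x + h) = ∑ x ∈ cube n R, F x := by
    intro h hh
    rw [← tsum_eq_sum (L := .unconditional _) (fun x hx => hsupp h hh x hx), ← tsum_eq_sum (L := .unconditional _) (fun x hx => hF x hx)]
    exact (Equiv.addRight h).tsum_eq F
  have hcorr : ∀ h ∈ K, ∀ h' ∈ K, ∑ x ∈ cube n (R + H), F (x + h) * (starRingEnd ℂ) (F (x + h')) =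
      c (h - h') := by
    intro h hh h' hh'
    rw [← tsum_eq_sum (L := .unconditional _) (fun x hx => by rw [hsupp h hh x hx, zero_mul]), hc]
    beta_reduce
    rw [← (Equiv.addRight h').tsum_eq fun y => F (y + (h - h')) * (starRingEnd ℂ) (F y)]
    refine tsum_congr fun x => ?_
    simp only [Equiv.coe_addRight]
    rw [show x + h' + (h - h') = x + h by abel]
  have hsum : (H : ℂ) ^ n * ∑ x ∈ cube n R, F x = ∑ x ∈ cube n (R + H), ∑ h ∈ K, F (x + h) := by
    rw [Finset.sum_comm, Finset.sum_congr rfl hshift, Finset.sum_const, cardK, nsmul_eq_mul]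
    push_cast
    rfl
  have hcube : ((cube n (R + H)).card : ℝ) = (2 * R + 2 * H + 1) ^ n := by
    rw [cube, Pi.card_Icc]
    simp only [Int.card_Icc, Finset.prod_const, Finset.card_univ, Fintype.card_fin]
    rw [show ((R + H : ℕ) : ℤ) + 1 - -((R + H : ℕ) : ℤ) = ((2 * R + 2 * H + 1 : ℕ) : ℤ) by
      push_cast; ring, Int.toNat_natCast]
    push_cast
    rfl
  have hcs : ‖(H : ℂ) ^ n * ∑ x ∈ cube n R, F x‖ ^ 2 ≤ (2 * R + 2 * H + 1) ^ n *
      ∑ x ∈ cube n (R + H), ‖∑ h ∈ K, F (x + h)‖ ^ 2 := by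
    rw [hsum, ← hcube]
    refine (pow_le_pow_left₀ (norm_nonneg _) (norm_sum_le _ _) 2).trans ?_
    exact sq_sum_le_card_mul_sum_sq
  have hexp : ((∑ x ∈ cube n (R + H), ‖∑ h ∈ K, F (x + h)‖ ^ 2 : ℝ) : ℂ) =
      ∑ h ∈ K, ∑ h' ∈ K, c (h - h') := by
    push_cast
    have : ∀ x, ((‖∑ h ∈ K, F (x + h)‖ : ℂ)) ^ 2 =
        ∑ h ∈ K, ∑ h' ∈ K, F (x + h) * (starRingEnd ℂ) (F (x + h')) := fun x => by
      rw [← Complex.mul_conj', map_sum, Finset.sum_mul_sum]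
    simp_rw [this]
    rw [Finset.sum_comm]
    refine Finset.sum_congr rfl fun h hh => ?_
    rw [Finset.sum_comm]
    exact Finset.sum_congr rfl fun h' hh' => hcorr h hh h' hh'
  have hle : ∑ x ∈ cube n (R + H), ‖∑ h ∈ K, F (x + h)‖ ^ 2 ≤
      (H : ℝ) ^ n * ∑ h ∈ cube n H, ‖c h‖ := by
    have h1 : ∑ x ∈ cube n (R + H), ‖∑ h ∈ K, F (x + h)‖ ^ 2 =
        ‖∑ h ∈ K, ∑ h' ∈ K, c (h - h')‖ := by
      rw [← hexp, Complex.norm_real, Real.norm_of_nonneg]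
      positivity
    rw [h1]
    refine (norm_sum_le _ _).trans ((Finset.sum_le_sum fun h _ => norm_sum_le _ _).trans ?_)
    rw [Finset.sum_comm]
    have h2 : ∀ h' ∈ K, ∑ h ∈ K, ‖c (h - h')‖ ≤ ∑ h ∈ cube n H, ‖c h‖ := by
      intro h' hh'
      rw [← Finset.sum_image (f := fun y => ‖c y‖) (g := fun h => h - h')
        (fun a _ b _ hab => by simpa using hab)]
      refine Finset.sum_le_sum_of_subset_of_nonneg (fun y hy => ?_) fun _ _ _ => norm_nonneg _
      obtain ⟨h, hh, rfl⟩ := Finset.mem_image.mp hy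
      rw [mem_cube]
      intro i
      have h3 := (memK h).mp hh i
      have h4 := (memK h').mp hh' i
      rw [Pi.sub_apply, abs_le]
      constructor <;> linarith
    refine (Finset.sum_le_sum h2).trans (le_of_eq ?_)
    rw [Finset.sum_const, cardK, nsmul_eq_mul]
    push_cast
    rfl
  have hH0 : (0 : ℝ) < (H : ℝ) ^ n := by positivity
  refine le_of_mul_le_mul_left ?_ hH0
  calc (H : ℝ) ^ n * (‖∑ x ∈ cube n R, F x‖ ^ 2 * (H : ℝ) ^ n)
      = ‖(H : ℂ) ^ n * ∑ x ∈ cube n R, F x‖ ^ 2 := by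
        rw [norm_mul, norm_pow, Complex.norm_natCast]; ring
    _ ≤ _ := hcs
    _ ≤ (2 * R + 2 * H + 1) ^ n * ((H : ℝ) ^ n * ∑ h ∈ cube n H, ‖c h‖) := by gcongr
    _ = _ := by ring

/-- The exponential sum of `α p` over the box `[a, b]`. -/
def boxSum {n : ℕ} (α : ℝ) (p : MvPolynomial (Fin n) ℤ) (a b : Fin n → ℤ) : ℂ :=
  ∑ x ∈ Finset.Icc a b, eC (α * (eval x p : ℤ))

theorem norm_boxSum_sq_mul_le {n : ℕ} (α : ℝ) (p : MvPolynomial (Fin n) ℤ) {a b : Fin n → ℤ}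
    {R H : ℕ} (hab : Finset.Icc a b ⊆ cube n R) (hH : 1 ≤ H) :
    ‖boxSum α p a b‖ ^ 2 * (H : ℝ) ^ n ≤ (2 * R + 2 * H + 1) ^ n *
      ∑ h ∈ cube n H, ‖boxSum α (shiftPoly h p - p) (a ⊔ (a - h)) (b ⊓ (b - h))‖ := by
  set F : (Fin n → ℤ) → ℂ := fun x =>
    if x ∈ Finset.Icc a b then eC (α * (eval x p : ℤ)) else 0 with hF
  have h1 := norm_sum_sq_mul_le (F := F) (R := R) (fun x hx => if_neg fun h => hx (hab h)) hH
  rw [hF, ← Finset.sum_filter, Finset.filter_mem_eq_inter, Finset.inter_eq_right.mpr hab] at h1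
  refine h1.trans (le_of_eq ?_)
  congr 1
  refine Finset.sum_congr rfl fun h _ => ?_
  congr 1
  beta_reduce
  have hmem : ∀ x, x ∈ Finset.Icc (a ⊔ (a - h)) (b ⊓ (b - h)) ↔
      x ∈ Finset.Icc a b ∧ x + h ∈ Finset.Icc a b := fun x => by
    simp only [Finset.mem_Icc, sup_le_iff, le_inf_iff, sub_le_iff_le_add, le_sub_iff_add_le]
    tauto
  rw [boxSum, tsum_eq_sum (L := .unconditional _) (s := Finset.Icc (a ⊔ (a - h)) (b ⊓ (b - h)))]
  · refine Finset.sum_congr rfl fun x hx => ?_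
    rw [hmem] at hx
    rw [if_pos hx.1, if_pos hx.2, conj_eC, ← eC_add, map_sub, eval_shiftPoly]
    congr 1
    push_cast
    ring
  · intro x hx
    rw [hmem, not_and_or] at hx
    rcases hx with hx | hx
    · rw [if_neg hx, map_zero, mul_zero]
    · rw [if_neg hx, zero_mul]

theorem eC_sub_int (x : ℝ) (m : ℤ) : eC (x - m) = eC x := by
  rw [sub_eq_add_neg, eC_add, ← conj_eC, eC_int, map_one, mul_one]

theorem four_mul_nint_le (x : ℝ) : 4 * nint x ≤ ‖eC x - 1‖ := by
  rw [← eC_sub_int x (round x), nint]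
  set t := x - round x with ht
  have ht2 : |t| ≤ 1 / 2 := abs_sub_round x
  rw [eC, show 2 * (Real.pi : ℂ) * Complex.I * t = Complex.I * ((2 * Real.pi * t : ℝ) : ℂ) by
    push_cast; ring, Complex.norm_exp_I_mul_ofReal_sub_one, norm_mul, Real.norm_eq_abs,
    Real.norm_eq_abs, abs_two, show 2 * Real.pi * t / 2 = Real.pi * t by ring]
  have := Real.mul_abs_le_abs_sin (x := Real.pi * t) (by
    rw [abs_mul, abs_of_pos Real.pi_pos]
    nlinarith [Real.pi_pos])
  rw [abs_mul, abs_of_pos Real.pi_pos, ← mul_assoc, div_mul_cancel₀ _ Real.pi_pos.ne'] at this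
  linarith

theorem norm_geom_sum_le (θ : ℝ) {a b : ℤ} (hab : a ≤ b) :
    ‖eC θ - 1‖ * ‖∑ x ∈ Finset.Icc a b, eC (θ * x)‖ ≤ 2 := by
  have key : ∀ b, a ≤ b → (eC θ - 1) * ∑ x ∈ Finset.Icc a b, eC (θ * x) =
      eC (θ * (b + 1)) - eC (θ * a) := by
    intro b hb
    induction b, hb using Int.leInduction with
    | base =>
      rw [Finset.Icc_self, Finset.sum_singleton, mul_add, eC_add, mul_one]
      ring
    | succ b hb ih =>
      have : Finset.Icc a (b + 1) = insert (b + 1) (Finset.Icc a b) := by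
        ext x
        simp only [Finset.mem_Icc, Finset.mem_insert]
        omega
      rw [this, Finset.sum_insert (by simp), mul_add, ih]
      push_cast
      rw [mul_add θ ((b : ℝ) + 1) 1, eC_add _ (θ * 1), mul_one]
      ring
  rw [← norm_mul, key b hab]
  refine (norm_sub_le _ _).trans ?_
  rw [norm_eC, norm_eC]
  norm_num

/-- A bound for a linear exponential sum over a box in the cube of radius `R`. -/
def linWeight {n : ℕ} (R : ℕ) (α : ℝ) (v : Fin n → ℤ) : ℝ :=
  ∏ i, 6 * (R : ℝ) / (1 + R * nint (α * v i))

theorem linWeight_nonneg {n : ℕ} (R : ℕ) (α : ℝ) (v : Fin n → ℤ) : 0 ≤ linWeight R α v :=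
  Finset.prod_nonneg fun i _ => by
    have := nint_nonneg (α * v i)
    positivity

theorem norm_sum_Icc_le (θ : ℝ) {a b : ℤ} {R : ℕ} (hR : 1 ≤ R) (hab : a ≤ b) (ha : -(R : ℤ) ≤ a)
    (hb : b ≤ R) : ‖∑ x ∈ Finset.Icc a b, eC (θ * x)‖ ≤ 6 * (R : ℝ) / (1 + R * nint θ) := by
  have hy := nint_nonneg θ
  have hR0 : (1 : ℝ) ≤ R := by exact_mod_cast hR
  rw [le_div_iff₀ (by positivity)]
  set s := ‖∑ x ∈ Finset.Icc a b, eC (θ * x)‖ with hs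
  have h1 : 4 * nint θ * s ≤ 2 :=
    (mul_le_mul_of_nonneg_right (four_mul_nint_le θ) (norm_nonneg _)).trans
      (norm_geom_sum_le θ hab)
  have h2 : s ≤ 3 * R := by
    refine (norm_sum_le _ _).trans ?_
    simp_rw [norm_eC]
    rw [Finset.sum_const, nsmul_eq_mul, mul_one, Int.card_Icc]
    have : ((b + 1 - a).toNat : ℤ) ≤ 3 * R := by omega
    exact_mod_cast this
  nlinarith

theorem norm_boxSum_le_linWeight {n : ℕ} (α : ℝ) {p G : MvPolynomial (Fin n) ℤ}
    (hp : HasLeadingForm p 1 G) {R : ℕ} (hR : 1 ≤ R) {a b : Fin n → ℤ}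
    (hab : Finset.Icc a b ⊆ cube n R) :
    ‖boxSum α p a b‖ ≤ linWeight R α fun i => coeff 0 (pderiv i G) := by
  by_cases hle : a ≤ b
  swap
  · rw [boxSum, Finset.Icc_eq_empty hle, Finset.sum_empty, norm_zero]
    exact linWeight_nonneg _ _ _
  obtain ⟨c, hc⟩ := hp.eval_eq
  have ha := mem_cube.mp (hab (Finset.left_mem_Icc.mpr hle))
  have hb := mem_cube.mp (hab (Finset.right_mem_Icc.mpr hle))
  have h1 : boxSum α p a b = eC (α * c) *
      ∏ i, ∑ x ∈ Finset.Icc (a i) (b i), eC (α * (coeff 0 (pderiv i G) : ℤ) * x) := by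
    rw [Finset.prod_univ_sum, boxSum, Finset.mul_sum, Pi.Icc_eq]
    refine Finset.sum_congr rfl fun x _ => ?_
    have hexp : ∀ (s : Finset (Fin n)) (y : Fin n → ℝ), eC (∑ i ∈ s, y i) = ∏ i ∈ s, eC (y i) := by
      intro s y
      induction s using Finset.induction_on with
      | empty => simpa using eC_int 0
      | insert j s hj ih => rw [Finset.sum_insert hj, Finset.prod_insert hj, eC_add, ih]
    rw [hc, ← hexp, ← eC_add]
    congr 1
    push_cast
    rw [mul_add, Finset.mul_sum]
    congr 1
    exact Finset.sum_congr rfl fun i _ => by ring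
  rw [h1, norm_mul, norm_eC, one_mul, norm_prod]
  exact Finset.prod_le_prod (fun _ _ => norm_nonneg _) fun i _ =>
    norm_sum_Icc_le _ hR (hle i) (abs_le.mp (ha i)).1 (abs_le.mp (hb i)).2

theorem div_one_add_mul_nint_le (x : ℝ) {R : ℕ} (hR : 1 ≤ R) :
    6 * (R : ℝ) / (1 + R * nint x) ≤ 6 * R * (((⌊R * Int.fract x⌋₊ : ℝ) + 1)⁻¹ +
      (((R - 1 - ⌊R * Int.fract x⌋₊ : ℕ) : ℝ) + 1)⁻¹) := by
  have hR0 : (0 : ℝ) < R := by exact_mod_cast hR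
  have hf0 := Int.fract_nonneg x
  have hf1 := Int.fract_lt_one x
  set f := Int.fract x
  set j := ⌊R * f⌋₊ with hj
  have hj1 : (j : ℝ) ≤ R * f := Nat.floor_le (by positivity)
  have hj2 : R * f < j + 1 := Nat.lt_floor_add_one _
  have hjR : j < R := by
    rw [hj, Nat.floor_lt (by positivity)]
    exact mul_lt_of_lt_one_right hR0 hf1
  have hcast : (((R - 1 - j : ℕ) : ℝ) + 1) = R - j := by
    have : R - 1 - j + 1 + j = R := by omega
    have : (((R - 1 - j + 1 + j : ℕ)) : ℝ) = R := by rw [this]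
    push_cast at this
    linarith
  have hjR' : (0 : ℝ) < R - j := by
    rw [← hcast]; positivity
  rw [hcast, div_eq_mul_inv]
  refine mul_le_mul_of_nonneg_left ?_ (by positivity)
  have hn : nint x = min f (1 - f) := abs_sub_round_eq_min x
  rw [hn]
  rcases min_cases f (1 - f) with ⟨h, _⟩ | ⟨h, _⟩ <;> rw [h]
  · refine le_trans ?_ (le_add_of_nonneg_right (by positivity))
    exact inv_anti₀ (by positivity) (by linarith)
  · refine le_trans ?_ (le_add_of_nonneg_left (by positivity))
    exact inv_anti₀ hjR' (by linarith)

theorem sum_inv_reflect_le (R : ℕ) :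
    ∑ j ∈ Finset.range R, 6 * (R : ℝ) * (((j : ℝ) + 1)⁻¹ + (((R - 1 - j : ℕ) : ℝ) + 1)⁻¹) ≤
      12 * R * (1 + Real.log R) := by
  rw [← Finset.mul_sum, Finset.sum_add_distrib,
    Finset.sum_range_reflect (fun j => ((j : ℝ) + 1)⁻¹) R]
  have h : ∑ j ∈ Finset.range R, ((j : ℝ) + 1)⁻¹ ≤ 1 + Real.log R := by
    have := harmonic_le_one_add_log R
    rw [harmonic] at this
    push_cast at this
    exact this
  have hR0 : (0 : ℝ) ≤ R := Nat.cast_nonneg R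
  nlinarith

theorem sum_linWeight_le {n : ℕ} (α : ℝ) (v : (Fin n → ℤ) →+ (Fin n → ℤ)) {R : ℕ}
    (hR : 1 ≤ R) :
    ∑ h ∈ cube n R, linWeight R α (v h) ≤ (12 * R * (1 + Real.log R)) ^ n *
      ((cube n (2 * R)).filter fun g => ∀ i, nint (α * v g i) ≤ 1 / R).card := by
  have hR0 : (0 : ℝ) < R := by exact_mod_cast hR
  set N := ((cube n (2 * R)).filter fun g => ∀ i, nint (α * v g i) ≤ 1 / R).card
  set c : ℕ → ℝ := fun j => 6 * (R : ℝ) * (((j : ℝ) + 1)⁻¹ + (((R - 1 - j : ℕ) : ℝ) + 1)⁻¹)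
    with hc
  have hc0 : ∀ j, 0 ≤ c j := fun j => by positivity
  let cell : (Fin n → ℤ) → (Fin n → ℕ) := fun h i => ⌊R * Int.fract (α * v h i)⌋₊
  have hmaps : ∀ h ∈ cube n R, cell h ∈ Fintype.piFinset fun _ : Fin n => Finset.range R := by
    intro h _
    rw [Fintype.mem_piFinset]
    intro i
    rw [Finset.mem_range, Nat.floor_lt (mul_nonneg hR0.le (Int.fract_nonneg _))]
    exact mul_lt_of_lt_one_right hR0 (Int.fract_lt_one _)
  have hcard : ∀ j, (((cube n R).filter fun h => cell h = j).card : ℝ) ≤ N := by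
    intro j
    norm_cast
    rcases ((cube n R).filter fun h => cell h = j).eq_empty_or_nonempty with he | ⟨h₀, hh₀⟩
    · rw [he]; simp
    · rw [Finset.mem_filter] at hh₀
      refine Finset.card_le_card_of_injOn (fun h => h - h₀) (fun h hh => ?_)
        fun a _ b _ hab => by simpa using hab
      have hh' := Finset.mem_filter.mp hh
      rw [SetLike.mem_coe, Finset.mem_filter, mem_cube]
      refine ⟨fun i => ?_, fun i => ?_⟩
      · have h1 := abs_le.mp (mem_cube.mp hh'.1 i)
        have h2 := abs_le.mp (mem_cube.mp hh₀.1 i)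
        rw [abs_le]
        push_cast
        constructor <;> simp only [Pi.sub_apply] <;> linarith [h1.1, h1.2, h2.1, h2.2]
      · have hcell : ⌊R * Int.fract (α * v h i)⌋₊ = ⌊R * Int.fract (α * v h₀ i)⌋₊ :=
          congrFun (hh'.2.trans hh₀.2.symm) i
        have e1 := Nat.floor_le (mul_nonneg hR0.le (Int.fract_nonneg (α * v h i)))
        have e2 := Nat.lt_floor_add_one (R * Int.fract (α * v h i))
        have e3 := Nat.floor_le (mul_nonneg hR0.le (Int.fract_nonneg (α * v h₀ i)))
        have e4 := Nat.lt_floor_add_one (R * Int.fract (α * v h₀ i))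
        rw [hcell] at e1 e2
        refine (nint_le_abs_sub _ (⌊α * v h i⌋ - ⌊α * v h₀ i⌋)).trans ?_
        rw [map_sub, Pi.sub_apply]
        push_cast
        rw [show α * ((v h i : ℝ) - v h₀ i) - (⌊α * v h i⌋ - ⌊α * v h₀ i⌋) =
          Int.fract (α * v h i) - Int.fract (α * v h₀ i) by
            rw [Int.fract, Int.fract]; ring, abs_le, ← neg_div, div_le_iff₀ hR0, le_div_iff₀ hR0]
        constructor <;> nlinarith
  rw [← Finset.sum_fiberwise_of_maps_to hmaps]
  have hterm : ∀ j ∈ Fintype.piFinset fun _ : Fin n => Finset.range R,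
      ∑ h ∈ (cube n R).filter (fun h => cell h = j), linWeight R α (v h) ≤
        N * ∏ i, c (j i) := by
    intro j _
    have : ∀ h ∈ (cube n R).filter (fun h => cell h = j), linWeight R α (v h) ≤
        ∏ i, c (j i) := by
      intro h hh
      rw [← (Finset.mem_filter.mp hh).2]
      exact Finset.prod_le_prod (fun i _ => by
        have := nint_nonneg (α * v h i)
        positivity) fun i _ => div_one_add_mul_nint_le _ hR
    refine (Finset.sum_le_sum this).trans ?_
    rw [Finset.sum_const, nsmul_eq_mul]
    exact mul_le_mul_of_nonneg_right (hcard j) (Finset.prod_nonneg fun i _ => hc0 _)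
  refine (Finset.sum_le_sum hterm).trans ?_
  rw [← Finset.mul_sum, ← Finset.prod_univ_sum (fun _ : Fin n => Finset.range R) fun _ j => c j,
    Finset.prod_const, Finset.card_univ, Fintype.card_fin, mul_comm]
  exact mul_le_mul_of_nonneg_right (pow_le_pow_left₀ (Finset.sum_nonneg fun j _ => hc0 j)
    (sum_inv_reflect_le R) n) (Nat.cast_nonneg _)

theorem iterSum_linWeight_singleton_le {n : ℕ} (α : ℝ) {R : ℕ} (hR : 1 ≤ R)
    (Q : MvPolynomial (Fin n) ℤ) :
    iterSum (linWeight R α) [R] Q ≤ (12 * R * (1 + Real.log R)) ^ n *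
      iterSum (nearWeight α (1 / R)) [2 * R] Q := by
  simp only [iterSum, nearWeight, Finset.sum_boole]
  exact sum_linWeight_le α (gradDir Q) hR

theorem Icc_sup_inf_subset {n : ℕ} (a b h : Fin n → ℤ) :
    Finset.Icc (a ⊔ (a - h)) (b ⊓ (b - h)) ⊆ Finset.Icc a b :=
  Finset.Icc_subset_Icc le_sup_left inf_le_left

theorem card_cube (n R : ℕ) : (cube n R).card = (2 * R + 1) ^ n := by
  rw [cube, Pi.card_Icc]
  simp only [Int.card_Icc, Finset.prod_const, Finset.card_univ, Fintype.card_fin]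
  congr 1
  omega

/-- Weyl differencing down to linear exponential sums. -/
theorem norm_boxSum_pow_le_iterSum {n : ℕ} (s : ℕ) : ∃ C : ℝ, 0 < C ∧ ∀ (R : ℕ), 1 ≤ R →
    ∀ (α : ℝ) (p G : MvPolynomial (Fin n) ℤ), HasLeadingForm p (s + 1) G →
    ∀ a b, Finset.Icc a b ⊆ cube n R →
      ‖boxSum α p a b‖ ^ 2 ^ s * (R : ℝ) ^ (n * (s + 1)) ≤
        C * (R : ℝ) ^ (n * 2 ^ s) * iterSum (linWeight R α) (List.replicate s R) G := by
  induction s with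
  | zero =>
    refine ⟨1, one_pos, fun R hR α p G hp a b hab => ?_⟩
    have := norm_boxSum_le_linWeight α hp hR hab
    simp only [pow_zero, pow_one, zero_add, mul_one, one_mul, List.replicate_zero, iterSum]
    rw [mul_comm]
    gcongr
  | succ s ih =>
    obtain ⟨C, hC0, hC⟩ := ih
    set m := 2 ^ s with hm
    obtain ⟨m', hm'⟩ : ∃ m', m = m' + 1 := ⟨m - 1, by have := Nat.one_le_two_pow (n := s); omega⟩
    refine ⟨5 ^ (n * m) * 3 ^ (n * m') * C, by positivity, fun R hR α p G hp a b hab => ?_⟩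
    have hR0 : (0 : ℝ) < R := by exact_mod_cast hR
    have hR1 : (1 : ℝ) ≤ R := by exact_mod_cast hR
    set S : (Fin n → ℤ) → ℝ := fun h =>
      ‖boxSum α (shiftPoly h p - p) (a ⊔ (a - h)) (b ⊓ (b - h))‖ with hS
    have h1 : ‖boxSum α p a b‖ ^ 2 ≤ 5 ^ n * ∑ h ∈ cube n R, S h := by
      have h := norm_boxSum_sq_mul_le α p hab hR
      have h' : (2 * (R : ℝ) + 2 * R + 1) ^ n ≤ 5 ^ n * (R : ℝ) ^ n := by
        rw [← mul_pow]
        gcongr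
        linarith
      refine le_of_mul_le_mul_right (h.trans ?_) (by positivity : 0 < (R : ℝ) ^ n)
      calc _ ≤ (5 ^ n * (R : ℝ) ^ n) * ∑ h ∈ cube n R, S h := by gcongr
        _ = _ := by ring
    have h2 : (∑ h ∈ cube n R, S h) ^ m ≤ (3 * (R : ℝ)) ^ (n * m') *
        ∑ h ∈ cube n R, S h ^ m := by
      rw [hm', pow_mul]
      refine (pow_sum_le_card_mul_sum_pow (fun h _ => norm_nonneg _) m').trans ?_
      rw [card_cube]
      push_cast
      have : 2 * (R : ℝ) + 1 ≤ 3 * R := by linarith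
      gcongr
    have h3 : ∀ h ∈ cube n R, S h ^ m * (R : ℝ) ^ (n * (s + 1)) ≤ C * (R : ℝ) ^ (n * m) *
        iterSum (linWeight R α) (List.replicate s R) (dirDeriv h G) := fun h _ =>
      hC R hR α _ _ (hp.difference h) _ _ ((Icc_sup_inf_subset a b h).trans hab)
    calc ‖boxSum α p a b‖ ^ 2 ^ (s + 1) * (R : ℝ) ^ (n * (s + 1 + 1))
        = (‖boxSum α p a b‖ ^ 2) ^ m * ((R : ℝ) ^ n * R ^ (n * (s + 1))) := by
          rw [← pow_mul, ← pow_add, hm, pow_succ' 2 s]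
          congr 2
          ring
      _ ≤ (5 ^ n * ∑ h ∈ cube n R, S h) ^ m * ((R : ℝ) ^ n * R ^ (n * (s + 1))) := by gcongr
      _ = 5 ^ (n * m) * (R : ℝ) ^ n * R ^ (n * (s + 1)) * (∑ h ∈ cube n R, S h) ^ m := by
          rw [mul_pow, pow_mul]; ring
      _ ≤ 5 ^ (n * m) * (R : ℝ) ^ n * R ^ (n * (s + 1)) * ((3 * (R : ℝ)) ^ (n * m') *
            ∑ h ∈ cube n R, S h ^ m) := by gcongr
      _ = 5 ^ (n * m) * 3 ^ (n * m') * (R : ℝ) ^ (n * m) *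
            ∑ h ∈ cube n R, S h ^ m * (R : ℝ) ^ (n * (s + 1)) := by
          rw [← Finset.sum_mul, hm', mul_pow]; ring
      _ ≤ 5 ^ (n * m) * 3 ^ (n * m') * (R : ℝ) ^ (n * m) * ∑ h ∈ cube n R,
            C * (R : ℝ) ^ (n * m) *
              iterSum (linWeight R α) (List.replicate s R) (dirDeriv h G) := by
          exact mul_le_mul_of_nonneg_left (Finset.sum_le_sum h3) (by positivity)
      _ = _ := by
          rw [← Finset.mul_sum, List.replicate_succ, iterSum, pow_succ 2 s, ← hm]; ring

/-- The bound for `S` over boxes obtained from `i` van der Corput steps of lengths `X ^ 2 ^ j`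
followed by Weyl differencing of a form of degree `t + 2`. -/
def BoxBound (n t i C : ℕ) : Prop :=
  ∀ R X : ℕ, 1 ≤ X → X ^ 2 ^ (i + t + 1) ≤ R → ∀ (α B : ℝ) (p G : MvPolynomial (Fin n) ℤ),
    HasLeadingForm p (t + 2 + i) G → (∀ m, |((coeff m G : ℤ) : ℝ)| ≤ B) →
    (∀ m : ℤ, |(m : ℝ)| ≤ C * B * (X : ℝ) ^ (2 ^ (i + 1) - 2) *
        ((X : ℝ) ^ 2 ^ (i + t + 1)) ^ (t + 1) →
      nint (α * m) ≤ ((X : ℝ) ^ 2 ^ (i + t + 1)) ^ (t + 1) / (R : ℝ) ^ (t + 2) → m = 0) →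
    ∀ a b, Finset.Icc a b ⊆ cube n R →
      ‖boxSum α p a b‖ * (X : ℝ) ^ n ≤ C * (R : ℝ) ^ n * (1 + Real.log R) ^ n *
        stdCount (jacIdeal (map (Int.castRingHom ℚ) G)) (C * X)

theorem iterSum_linWeight_le {n : ℕ} (t : ℕ) : ∃ A : ℝ, 0 < A ∧ ∃ C : ℕ, 1 ≤ C ∧
    ∀ R Y : ℕ, 1 ≤ Y → Y ≤ R → ∀ (α B : ℝ) (G : MvPolynomial (Fin n) ℤ),
    G.IsHomogeneous (t + 2) → (∀ m, |((coeff m G : ℤ) : ℝ)| ≤ B) →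
    (∀ m : ℤ, |(m : ℝ)| ≤ C * B * (Y : ℝ) ^ (t + 1) →
      nint (α * m) ≤ (Y : ℝ) ^ (t + 1) / (R : ℝ) ^ (t + 2) → m = 0) →
    iterSum (linWeight R α) (List.replicate (t + 1) R) G * (Y : ℝ) ^ n ≤
      A * (1 + Real.log R) ^ n * (R : ℝ) ^ (n * (t + 2)) *
        stdCount (jacIdeal (map (Int.castRingHom ℚ) G)) (C * Y) := by
  obtain ⟨CZ, hCZ1, hCZ⟩ := iterSum_zero_le (n := n) t
  set K : ℝ := (4 * n + 5) ^ (2 * n) * 3 ^ n with hK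
  refine ⟨12 ^ n * K ^ (t + 1) * 2 ^ (n * (t + 1)) * CZ, by positivity,
    CZ + (n * (t + 2)) ^ (t + 1), by omega, fun R Y hY hYR α B G hG hB hm => ?_⟩
  have hR1 : 1 ≤ R := hY.trans hYR
  have hR0 : (0 : ℝ) < R := by exact_mod_cast hR1
  have hY0 : (0 : ℝ) < Y := by exact_mod_cast hY
  have hB0 : 0 ≤ B := (abs_nonneg _).trans (hB 0)
  have hL : 0 ≤ 1 + Real.log R := by
    have := Real.log_nonneg (show (1 : ℝ) ≤ R by exact_mod_cast hR1)
    linarith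
  set D := stdCount (jacIdeal (map (Int.castRingHom ℚ) G))
  have h1 : iterSum (linWeight R α) (List.replicate (t + 1) R) G ≤
      (12 * R * (1 + Real.log R)) ^ n *
        iterSum (nearWeight α (1 / R)) (List.replicate (t + 1) (2 * R)) G := by
    rw [List.replicate_succ']
    refine (iterSum_append_le (fun Q => iterSum_linWeight_singleton_le α hR1 Q) _ G).trans ?_
    rw [iterSum_perm _ (List.perm_append_comm : (List.replicate t R ++ [2 * R]).Perm _)]
    refine mul_le_mul_of_nonneg_left ?_ (by positivity)
    rw [List.replicate_succ, List.singleton_append, iterSum, iterSum]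
    exact Finset.sum_le_sum fun h _ =>
      iterSum_replicate_mono (nearWeight_nonneg _ _) (by omega) _ _
  have h2 := iterSum_nearWeight_shrink α hY (by omega : Y ≤ 2 * R) (t + 1) 0
    (δ := 1 / (R : ℝ)) (by positivity) (le_of_eq (by push_cast; field_simp)) G
  rw [List.replicate_zero, List.nil_append, zero_add, ← hK] at h2
  have h3 := iterSum_nearWeight_le_zero α (1 / (R : ℝ) * (Y / (2 * R : ℕ)) ^ (t + 1)) (t + 2) Y
    (t + 1) le_rfl B G hG hB fun m hm1 hm2 => hm m (hm1.trans ?_) (hm2.trans ?_)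
  · have h4 := hCZ Y hY G hG
    calc _ ≤ ((12 * R * (1 + Real.log R)) ^ n * ((K * ((2 * R : ℕ) / (Y : ℝ)) ^ n) ^ (t + 1) *
          (CZ * (Y : ℝ) ^ (n * t) * D (CZ * Y)))) * (Y : ℝ) ^ n := by
          gcongr
          refine h1.trans (mul_le_mul_of_nonneg_left (h2.trans ?_) (by positivity))
          gcongr
          exact h3.trans h4
      _ = 12 ^ n * K ^ (t + 1) * 2 ^ (n * (t + 1)) * CZ * (1 + Real.log R) ^ n *
          (R : ℝ) ^ (n * (t + 2)) * D (CZ * Y) := by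
          push_cast
          rw [mul_pow, mul_pow, mul_pow, ← pow_mul, div_pow, mul_pow, pow_mul (Y : ℝ) n (t + 1)]
          field_simp
          ring
      _ ≤ _ := by
          gcongr
          exact stdCount_mono _ (Nat.mul_le_mul_right _ (by omega))
  · push_cast
    rw [mul_pow]
    have : ((n : ℝ) * (t + 2)) ^ (t + 1) ≤ CZ + (n * (t + 2)) ^ (t + 1) := by
      linarith [(Nat.cast_nonneg CZ : (0 : ℝ) ≤ CZ)]
    calc _ = ((n : ℝ) * (t + 2)) ^ (t + 1) * B * (Y : ℝ) ^ (t + 1) := by ring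
      _ ≤ _ := by gcongr
  · push_cast
    calc 1 / (R : ℝ) * (Y / (2 * R)) ^ (t + 1) ≤ 1 / (R : ℝ) * (Y / R) ^ (t + 1) := by
          gcongr
          linarith
      _ = _ := by
          rw [div_pow]
          field_simp
          ring

theorem exists_boxBound_zero (n t : ℕ) : ∃ C : ℕ, 1 ≤ C ∧ BoxBound n t 0 C := by
  obtain ⟨CW, hCW0, hCW⟩ := norm_boxSum_pow_le_iterSum (n := n) (t + 1)
  obtain ⟨A, hA0, CZ, hCZ1, hCZ⟩ := iterSum_linWeight_le (n := n) t
  set C := max n CZ + ⌈CW * A⌉₊ with hC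
  have hCCZ : CZ ≤ C := (le_max_right n CZ).trans (Nat.le_add_right _ _)
  have hCn : max n CZ ≤ C := Nat.le_add_right _ _
  have hCA : CW * A ≤ C := (Nat.le_ceil _).trans (by exact_mod_cast Nat.le_add_left _ _)
  have hC1 : 1 ≤ C := hCZ1.trans hCCZ
  have hC1' : (1 : ℝ) ≤ C := by exact_mod_cast hC1
  refine ⟨C, hC1, fun R X hX hXR α B p G hp hB hm a b hab => ?_⟩
  simp only [zero_add, add_zero, pow_one, Nat.sub_self, pow_zero, mul_one] at hXR hp hm
  set s := t + 1 with hs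
  have hB0 : 0 ≤ B := (abs_nonneg _).trans (hB 0)
  have hX0 : (0 : ℝ) < X := by exact_mod_cast hX
  have hY : 1 ≤ X ^ 2 ^ s := Nat.one_le_pow _ _ hX
  have hR1 : 1 ≤ R := hY.trans hXR
  have hR0 : (0 : ℝ) < R := by exact_mod_cast hR1
  have hL : 1 ≤ 1 + Real.log R := by
    have := Real.log_nonneg (show (1 : ℝ) ≤ R by exact_mod_cast hR1)
    linarith
  have h1 := hCW R hR1 α p G hp a b hab
  have h2 := hCZ R (X ^ 2 ^ s) hY hXR α B G hp.1 hB (fun m hm1 hm2 => by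
    push_cast at hm1 hm2
    exact hm m (hm1.trans (by gcongr)) hm2)
  set I := jacIdeal (map (Int.castRingHom ℚ) G)
  obtain ⟨u, hu⟩ : ∃ u, 2 ^ s = u + 1 := ⟨2 ^ s - 1, by have := Nat.one_le_two_pow (n := s); omega⟩
  have h3 : (stdCount I (CZ * X ^ 2 ^ s) : ℝ) ≤ (stdCount I (C * X) : ℝ) ^ 2 ^ s := by
    have e1 := stdCount_mul_pow_le I CZ hX u
    rw [← hu] at e1
    have e2 := stdCount_mono I (Nat.mul_le_mul_right X hCn)
    calc (stdCount I (CZ * X ^ 2 ^ s) : ℝ) ≤ (stdCount I (max n CZ * X) : ℝ) ^ 2 ^ s := by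
          exact_mod_cast e1
      _ ≤ _ := by gcongr
  have hRpos : (0 : ℝ) < (R : ℝ) ^ (n * (s + 1)) := by positivity
  have h4 : (‖boxSum α p a b‖ * (X : ℝ) ^ n) ^ 2 ^ s ≤
      (C * (R : ℝ) ^ n * (1 + Real.log R) ^ n * stdCount I (C * X)) ^ 2 ^ s := by
    refine le_of_mul_le_mul_right ?_ hRpos
    push_cast at h2
    calc (‖boxSum α p a b‖ * (X : ℝ) ^ n) ^ 2 ^ s * (R : ℝ) ^ (n * (s + 1))
        = (‖boxSum α p a b‖ ^ 2 ^ s * (R : ℝ) ^ (n * (s + 1))) * ((X : ℝ) ^ 2 ^ s) ^ n := by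
          rw [mul_pow, ← pow_mul, mul_comm n, pow_mul]; ring
      _ ≤ (CW * (R : ℝ) ^ (n * 2 ^ s) * iterSum (linWeight R α) (List.replicate s R) G) *
            ((X : ℝ) ^ 2 ^ s) ^ n := by gcongr
      _ = CW * (R : ℝ) ^ (n * 2 ^ s) * (iterSum (linWeight R α) (List.replicate s R) G *
            ((X : ℝ) ^ 2 ^ s) ^ n) := by ring
      _ ≤ CW * (R : ℝ) ^ (n * 2 ^ s) * (A * (1 + Real.log R) ^ n * (R : ℝ) ^ (n * (t + 2)) *
            (stdCount I (C * X) : ℝ) ^ 2 ^ s) := by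
          refine mul_le_mul_of_nonneg_left (h2.trans ?_) (by positivity)
          gcongr
      _ = (CW * A) * ((R : ℝ) ^ n) ^ 2 ^ s * (1 + Real.log R) ^ n *
            (stdCount I (C * X) : ℝ) ^ 2 ^ s * (R : ℝ) ^ (n * (s + 1)) := by
          rw [← pow_mul, hs]; ring
      _ ≤ (C : ℝ) ^ 2 ^ s * ((R : ℝ) ^ n) ^ 2 ^ s * ((1 + Real.log R) ^ n) ^ 2 ^ s *
            (stdCount I (C * X) : ℝ) ^ 2 ^ s * (R : ℝ) ^ (n * (s + 1)) := by
          have e1 : CW * A ≤ (C : ℝ) ^ 2 ^ s := hCA.trans (le_self_pow₀ hC1' (by positivity))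
          have e2 : (1 + Real.log R) ^ n ≤ ((1 + Real.log R) ^ n) ^ 2 ^ s :=
            le_self_pow₀ (one_le_pow₀ hL) (by positivity)
          gcongr
      _ = _ := by rw [mul_pow, mul_pow, mul_pow]
  exact (pow_le_pow_iff_left₀ (by positivity) (by positivity) (by positivity)).mp h4

theorem BoxBound.mono {n t i C C' : ℕ} (h : BoxBound n t i C) (hC : C ≤ C') :
    BoxBound n t i C' := by
  intro R X hX hXR α B p G hp hB hm a b hab
  have hB0 : 0 ≤ B := (abs_nonneg _).trans (hB 0)
  have hR1 : 1 ≤ R := (Nat.one_le_pow _ _ hX).trans hXR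
  have hL : 0 ≤ 1 + Real.log R := by
    have := Real.log_nonneg (show (1 : ℝ) ≤ R by exact_mod_cast hR1)
    linarith
  refine (h R X hX hXR α B p G hp hB (fun m hm1 => hm m (hm1.trans ?_)) a b hab).trans ?_
  · have : (C : ℝ) ≤ C' := by exact_mod_cast hC
    gcongr
  · gcongr
    exact stdCount_mono _ (Nat.mul_le_mul_right _ hC)

theorem BoxBound.succ {n t i C : ℕ} (h : BoxBound n t i C) :
    ∃ C' : ℕ, BoxBound n t (i + 1) C' := by
  set N := n * (t + 2 + (i + 1)) with hN
  set E := max n (C + 2 * n) with hE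
  set K : ℕ := 5 ^ n * C * (C + 2 * n + 1) ^ n with hK
  refine ⟨C * N + E + K, fun R X hX hXR α B p G hp hB hm a b hab => ?_⟩
  set C' := C * N + E + K with hC'
  have hB0 : 0 ≤ B := (abs_nonneg _).trans (hB 0)
  have hX0 : (0 : ℝ) < X := by exact_mod_cast hX
  have hX2 : 1 ≤ X ^ 2 := Nat.one_le_pow _ _ hX
  have hpow : (X ^ 2) ^ 2 ^ (i + t + 1) = X ^ 2 ^ (i + 1 + t + 1) := by
    rw [← pow_mul, ← pow_succ', show i + 1 + t + 1 = i + t + 1 + 1 by ring]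
  have hpow' : ((X : ℝ) ^ 2) ^ 2 ^ (i + t + 1) = (X : ℝ) ^ 2 ^ (i + 1 + t + 1) := by
    exact_mod_cast hpow
  have hX2R : X ^ 2 ≤ R := by
    refine le_trans ?_ hXR
    rw [← hpow]
    exact le_self_pow₀ hX2 (by positivity)
  have hR1 : 1 ≤ R := hX2.trans hX2R
  have hR0 : (0 : ℝ) < R := by exact_mod_cast hR1
  have hL : 1 ≤ 1 + Real.log R := by
    have := Real.log_nonneg (show (1 : ℝ) ≤ R by exact_mod_cast hR1)
    linarith
  set I := jacIdeal (map (Int.castRingHom ℚ) G) with hI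
  set L := (1 + Real.log R) ^ n with hLdef
  have hL1 : 1 ≤ L := one_le_pow₀ hL
  have h1 := norm_boxSum_sq_mul_le α p hab hX2
  have h2 : ∀ h ∈ cube n (X ^ 2),
      ‖boxSum α (shiftPoly h p - p) (a ⊔ (a - h)) (b ⊓ (b - h))‖ * ((X : ℝ) ^ 2) ^ n ≤
        C * (R : ℝ) ^ n * L *
          stdCount (jacIdeal (map (Int.castRingHom ℚ) (dirDeriv h G))) (C * X ^ 2) := by
    intro h' hh'
    have := h R (X ^ 2) hX2 (by rwa [hpow]) α (n * (t + 2 + i + 1 : ℕ) * (X ^ 2 : ℕ) * B) _ _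
      (hp.difference h') (abs_coeff_dirDeriv_le hp.1 hB hh') (fun m hm1 hm2 => ?_) _ _
      ((Icc_sup_inf_subset a b h').trans hab)
    · push_cast at this
      exact this
    · push_cast at hm1 hm2
      rw [hpow'] at hm1 hm2
      refine hm m (hm1.trans ?_) hm2
      have e1 : (X : ℝ) ^ 2 * ((X : ℝ) ^ 2) ^ (2 ^ (i + 1) - 2) = X ^ (2 ^ (i + 1 + 1) - 2) := by
        rw [← pow_mul, ← pow_add]
        congr 1
        have := Nat.one_le_two_pow (n := i)
        rw [pow_succ 2 (i + 1), pow_succ 2 i]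
        omega
      have e2 : (C : ℝ) * N ≤ C' := by
        rw [hC', ← Nat.cast_mul]
        exact_mod_cast (by omega)
      calc _ = (C : ℝ) * N * B * ((X : ℝ) ^ 2 * ((X : ℝ) ^ 2) ^ (2 ^ (i + 1) - 2)) *
            ((X : ℝ) ^ 2 ^ (i + 1 + t + 1)) ^ (t + 1) := by rw [hN]; push_cast; ring
        _ ≤ _ := by rw [e1]; gcongr
  have h3 := sum_stdCount_dirDeriv_le_int hp.1 (by omega) (X ^ 2) (C * X ^ 2)
  have h4 : stdCount I (C * X ^ 2 + 2 * n * X ^ 2) ≤ stdCount I (C' * X) ^ 2 := by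
    rw [← add_mul]
    refine (stdCount_mul_pow_le I _ hX 1).trans ?_
    gcongr
    exact stdCount_mono _ (Nat.mul_le_mul_right _ (by omega))
  have h5 : (C * X ^ 2 + 2 * n * X ^ 2 + 1) ^ n ≤ (C + 2 * n + 1) ^ n * (X ^ 2) ^ n := by
    rw [← mul_pow]
    gcongr
    nlinarith
  have h6 : (∑ h ∈ cube n (X ^ 2),
      (stdCount (jacIdeal (map (Int.castRingHom ℚ) (dirDeriv h G))) (C * X ^ 2) : ℝ)) ≤
      ((C + 2 * n + 1) ^ n : ℕ) * ((X : ℝ) ^ 2) ^ n * (stdCount I (C' * X) : ℝ) ^ 2 := by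
    exact_mod_cast h3.trans (Nat.mul_le_mul h5 h4)
  have h7 : (2 * (R : ℝ) + 2 * (X ^ 2 : ℕ) + 1) ^ n ≤ 5 ^ n * (R : ℝ) ^ n := by
    rw [← mul_pow]
    have e1 : ((X ^ 2 : ℕ) : ℝ) ≤ R := by exact_mod_cast hX2R
    have e2 : (1 : ℝ) ≤ R := by exact_mod_cast hR1
    gcongr
    linarith
  have hpos : (0 : ℝ) < ((X : ℝ) ^ 2) ^ n := by positivity
  have h8 : (‖boxSum α p a b‖ * (X : ℝ) ^ n) ^ 2 ≤
      (C' * (R : ℝ) ^ n * L * stdCount I (C' * X)) ^ 2 := by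
    refine le_of_mul_le_mul_right ?_ hpos
    push_cast at h1
    calc (‖boxSum α p a b‖ * (X : ℝ) ^ n) ^ 2 * ((X : ℝ) ^ 2) ^ n
        = (‖boxSum α p a b‖ ^ 2 * ((X : ℝ) ^ 2) ^ n) * ((X : ℝ) ^ 2) ^ n := by ring
      _ ≤ ((5 ^ n * (R : ℝ) ^ n) * ∑ h ∈ cube n (X ^ 2),
            ‖boxSum α (shiftPoly h p - p) (a ⊔ (a - h)) (b ⊓ (b - h))‖) *
              ((X : ℝ) ^ 2) ^ n := by
          push_cast at h7
          exact mul_le_mul_of_nonneg_right (h1.trans (by gcongr)) hpos.le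
      _ = (5 ^ n * (R : ℝ) ^ n) * ∑ h ∈ cube n (X ^ 2),
            ‖boxSum α (shiftPoly h p - p) (a ⊔ (a - h)) (b ⊓ (b - h))‖ *
              ((X : ℝ) ^ 2) ^ n := by rw [← Finset.sum_mul]; ring
      _ ≤ (5 ^ n * (R : ℝ) ^ n) * ∑ h ∈ cube n (X ^ 2), C * (R : ℝ) ^ n * L *
          stdCount (jacIdeal (map (Int.castRingHom ℚ) (dirDeriv h G))) (C * X ^ 2) :=
          mul_le_mul_of_nonneg_left (Finset.sum_le_sum h2) (by positivity)
      _ ≤ (5 ^ n * (R : ℝ) ^ n) * (C * (R : ℝ) ^ n * L * (((C + 2 * n + 1) ^ n : ℕ) *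
            ((X : ℝ) ^ 2) ^ n * (stdCount I (C' * X) : ℝ) ^ 2)) := by
          rw [← Finset.mul_sum]
          gcongr
      _ = K * ((R : ℝ) ^ n) ^ 2 * L * (stdCount I (C' * X) : ℝ) ^ 2 * ((X : ℝ) ^ 2) ^ n := by
          rw [hK]; push_cast; ring
      _ ≤ (C' : ℝ) ^ 2 * ((R : ℝ) ^ n) ^ 2 * L ^ 2 * (stdCount I (C' * X) : ℝ) ^ 2 *
            ((X : ℝ) ^ 2) ^ n := by
          have e1 : (K : ℝ) ≤ (C' : ℝ) ^ 2 := by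
            have : K ≤ C' ^ 2 := (Nat.le_add_left _ _).trans (Nat.le_self_pow two_ne_zero C')
            exact_mod_cast this
          have e2 : L ≤ L ^ 2 := le_self_pow₀ hL1 two_ne_zero
          gcongr
      _ = _ := by ring
  exact (pow_le_pow_iff_left₀ (by positivity) (by positivity) two_ne_zero).mp h8

theorem exists_boxBound (n t i : ℕ) : ∃ C : ℕ, 1 ≤ C ∧ BoxBound n t i C := by
  induction i with
  | zero => exact exists_boxBound_zero n t
  | succ i ih =>
    obtain ⟨C, -, hC⟩ := ih
    obtain ⟨C', hC'⟩ := hC.succ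
    exact ⟨C' + 1, by omega, hC'.mono (by omega)⟩

/-- Directional derivative along the `i`-th coordinate. -/
def coordDeriv {n : ℕ} (i : Fin n) (v : (Fin n → ℝ) → ℝ) (x : Fin n → ℝ) : ℝ :=
  fderiv ℝ v x (Pi.single i 1)

/-- Forward difference with step `η` along the `i`-th coordinate. -/
def coordDiff {n : ℕ} {A : Type} [AddCommMonoid A] (η : A) (i : Fin n) (v : (Fin n → A) → ℝ)
    (x : Fin n → A) : ℝ :=
  v (x + Pi.single i η) - v x

/-- Iterated forward differences along the coordinates in a list. -/
def mixedDiff {n : ℕ} {A : Type} [AddCommMonoid A] (η : A) (l : List (Fin n))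
    (v : (Fin n → A) → ℝ) : (Fin n → A) → ℝ :=
  l.foldl (fun h i => coordDiff η i h) v

theorem contDiff_coordDeriv {n : ℕ} (i : Fin n) {v : (Fin n → ℝ) → ℝ}
    (hv : ContDiff ℝ (⊤ : ℕ∞) v) : ContDiff ℝ (⊤ : ℕ∞) (coordDeriv i v) :=
  (hv.fderiv_right (m := (⊤ : ℕ∞)) (by simp)).clm_apply contDiff_const

theorem contDiff_coordDiff {n : ℕ} (η : ℝ) (i : Fin n) {v : (Fin n → ℝ) → ℝ}
    (hv : ContDiff ℝ (⊤ : ℕ∞) v) : ContDiff ℝ (⊤ : ℕ∞) (coordDiff η i v) :=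
  (hv.comp (contDiff_id.add contDiff_const)).sub hv

theorem coordDeriv_coordDiff {n : ℕ} (η : ℝ) (i j : Fin n) {v : (Fin n → ℝ) → ℝ}
    (hv : ContDiff ℝ (⊤ : ℕ∞) v) :
    coordDeriv i (coordDiff η j v) = coordDiff η j (coordDeriv i v) := by
  have hd : Differentiable ℝ v := hv.differentiable (by simp)
  funext x
  unfold coordDeriv coordDiff
  rw [fderiv_fun_sub (by fun_prop) (by fun_prop), fderiv_comp_add_right]
  simp

theorem contDiff_mixedDiff {n : ℕ} (η : ℝ) (l : List (Fin n)) {v : (Fin n → ℝ) → ℝ}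
    (hv : ContDiff ℝ (⊤ : ℕ∞) v) : ContDiff ℝ (⊤ : ℕ∞) (mixedDiff η l v) := by
  induction l generalizing v with
  | nil => exact hv
  | cons i l ih => exact ih (contDiff_coordDiff η i hv)

theorem coordDeriv_mixedDiff {n : ℕ} (η : ℝ) (i : Fin n) (l : List (Fin n))
    {v : (Fin n → ℝ) → ℝ} (hv : ContDiff ℝ (⊤ : ℕ∞) v) :
    coordDeriv i (mixedDiff η l v) = mixedDiff η l (coordDeriv i v) := by
  induction l generalizing v with
  | nil => rfl
  | cons j l ih =>
    change coordDeriv i (mixedDiff η l (coordDiff η j v)) =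
      mixedDiff η l (coordDiff η j (coordDeriv i v))
    rw [ih (contDiff_coordDiff η j hv), coordDeriv_coordDiff η i j hv]

theorem abs_coordDiff_le {n : ℕ} {η : ℝ} (hη : 0 ≤ η) (i : Fin n) {v : (Fin n → ℝ) → ℝ}
    (hv : ContDiff ℝ (⊤ : ℕ∞) v) {M : ℝ} (hM : ∀ x, |coordDeriv i v x| ≤ M) (x : Fin n → ℝ) :
    |coordDiff η i v x| ≤ η * M := by
  have hd : Differentiable ℝ v := hv.differentiable (by simp)
  have hg : ∀ t : ℝ, HasDerivAt (fun t : ℝ => v (x + t • Pi.single i (1 : ℝ)))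
      (coordDeriv i v (x + t • Pi.single i (1 : ℝ))) t := by
    intro t
    have h1 : HasDerivAt (fun t : ℝ => x + t • (Pi.single i (1 : ℝ) : Fin n → ℝ))
        (Pi.single i (1 : ℝ)) t := by
      simpa using ((hasDerivAt_id t).smul_const (Pi.single i (1 : ℝ) : Fin n → ℝ)).const_add x
    exact (hd _).hasFDerivAt.comp_hasDerivAt t h1
  have h := norm_image_sub_le_of_norm_deriv_le_segment' (a := 0) (b := η)
    (fun t _ => (hg t).hasDerivWithinAt) (fun t _ => hM _) η ⟨hη, le_rfl⟩
  have e : η • (Pi.single i (1 : ℝ) : Fin n → ℝ) = Pi.single i η := by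
    rw [← Pi.single_smul]; simp
  simp only [e, zero_smul, add_zero, sub_zero, Real.norm_eq_abs] at h
  rw [mul_comm]
  exact h

theorem abs_mixedDiff_le {n : ℕ} {η : ℝ} (hη : 0 ≤ η) (l : List (Fin n)) {v : (Fin n → ℝ) → ℝ}
    (hv : ContDiff ℝ (⊤ : ℕ∞) v) {M : ℝ} (hM : ∀ x, |l.foldr coordDeriv v x| ≤ M)
    (x : Fin n → ℝ) : |mixedDiff η l v x| ≤ η ^ l.length * M := by
  induction l using List.reverseRecOn generalizing v x with
  | nil => simpa [mixedDiff] using hM x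
  | append_singleton l i ih =>
    have h : mixedDiff η (l ++ [i]) v = coordDiff η i (mixedDiff η l v) := by
      simp [mixedDiff, List.foldl_append]
    rw [h, List.length_append, List.length_singleton, pow_succ', mul_assoc]
    refine abs_coordDiff_le hη i (contDiff_mixedDiff η l hv) (fun y => ?_) x
    rw [coordDeriv_mixedDiff η i l hv]
    refine ih (contDiff_coordDeriv i hv) (fun z => ?_) y
    simpa [List.foldr_append] using hM z

theorem mixedDiff_comp_div {n : ℕ} (P : ℝ) (l : List (Fin n)) (v : (Fin n → ℝ) → ℝ) :
    mixedDiff (1 : ℤ) l (fun x => v fun i => (x i : ℝ) / P) =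
      fun x => mixedDiff (1 / P) l v fun i => (x i : ℝ) / P := by
  induction l generalizing v with
  | nil => rfl
  | cons i l ih =>
    change mixedDiff (1 : ℤ) l (coordDiff 1 i fun x => v fun i => (x i : ℝ) / P) = _
    have : (coordDiff 1 i fun x : Fin n → ℤ => v fun i => (x i : ℝ) / P) =
        fun x => coordDiff (1 / P) i v fun i => (x i : ℝ) / P := by
      funext x
      unfold coordDiff
      congr 1
      change v _ = v _
      congr 1
      funext j
      by_cases hj : j = i
      · subst hj; simp [add_div]
      · simp [hj]
    rw [this, ih]
    rfl

theorem SmoothWeight.abs_mixedDiff_le {n : ℕ} {c : ℝ} {cs : ℕ → ℝ} {ω : (Fin n → ℝ) → ℝ}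
    (hω : SmoothWeight n c cs ω) {P : ℝ} (hP : 0 < P) (x : Fin n → ℤ) :
    |mixedDiff (1 : ℤ) (List.finRange n) (fun x => ω fun i => (x i : ℝ) / P) x| ≤
      (1 / P) ^ n * cs n := by
  rw [mixedDiff_comp_div]
  have hM : ∀ x, |(List.finRange n).foldr coordDeriv ω x| ≤ cs n := fun x => by
    have h := hω.2.2.2 (fun _ => 1) x
    simp only [Finset.sum_const, Finset.card_univ, Fintype.card_fin, smul_eq_mul, mul_one] at h
    exact h
  have h := _root_.abs_mixedDiff_le (η := 1 / P) (by positivity) (List.finRange n) hω.1 hM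
    fun i => (x i : ℝ) / P
  simpa using h

/-- `u` vanishes once some coordinate exceeds `R`. -/
def VanishesAbove {n : ℕ} (R : ℤ) (u : (Fin n → ℤ) → ℝ) : Prop :=
  ∀ x i, R < x i → u x = 0

theorem VanishesAbove.coordDiff {n : ℕ} {R : ℤ} {u : (Fin n → ℤ) → ℝ} (hu : VanishesAbove R u)
    (i : Fin n) : VanishesAbove R (coordDiff 1 i u) := by
  intro x j hj
  have h : R < (x + Pi.single i 1 : Fin n → ℤ) j := by
    rw [Pi.add_apply]
    by_cases hij : j = i
    · subst hij; simp; omega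
    · simpa [hij] using hj
  rw [_root_.coordDiff, hu _ j h, hu x j hj, sub_zero]

theorem VanishesAbove.mixedDiff {n : ℕ} {R : ℤ} (l : List (Fin n)) {u : (Fin n → ℤ) → ℝ}
    (hu : VanishesAbove R u) : VanishesAbove R (mixedDiff 1 l u) := by
  induction l generalizing u with
  | nil => exact hu
  | cons i l ih => exact ih (hu.coordDiff i)

theorem sum_coordDiff {n : ℕ} {R : ℤ} {g : (Fin n → ℤ) → ℝ} (hg : VanishesAbove R g)
    {x b : Fin n → ℤ} {i : Fin n} (hb : b i = R) (hx : x i ≤ R) :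
    ∑ y ∈ Finset.Icc x b, coordDiff 1 i g y =
      -∑ y ∈ Finset.Icc x (Function.update b i (x i)), g y := by
  have h1 : ∑ y ∈ Finset.Icc x b, g (y + Pi.single i 1) =
      ∑ y ∈ (Finset.Icc x b).filter (fun y => x i < y i), g y := by
    rw [← Finset.sum_filter_of_ne (p := fun y => y i < R)]
    · refine Finset.sum_nbij' (fun y => y + Pi.single i 1) (fun y => y - Pi.single i 1) ?_ ?_
        (fun y _ => by simp) (fun y _ => by simp) (fun y _ => rfl)
      · intro y hy
        simp only [Finset.mem_filter, Finset.mem_Icc, Pi.le_def, Pi.add_apply] at hy ⊢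
        refine ⟨⟨fun j => ?_, fun j => ?_⟩, ?_⟩
        · have := hy.1.1 j
          by_cases hj : j = i
          · subst hj; simp; omega
          · simpa [hj] using this
        · have := hy.1.2 j
          by_cases hj : j = i
          · subst hj; simp; omega
          · simpa [hj] using this
        · have := hy.1.1 i
          simp; omega
      · intro y hy
        simp only [Finset.mem_filter, Finset.mem_Icc, Pi.le_def, Pi.sub_apply] at hy ⊢
        refine ⟨⟨fun j => ?_, fun j => ?_⟩, ?_⟩
        · have := hy.1.1 j
          by_cases hj : j = i
          · subst hj; simp; omega
          · simpa [hj] using this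
        · have := hy.1.2 j
          by_cases hj : j = i
          · subst hj; simp; omega
          · simpa [hj] using this
        · have := hy.1.2 i
          simp; omega
    · intro y hy hne
      by_contra hlt
      refine hne (hg _ i ?_)
      simp; omega
  have h2 : Finset.Icc x (Function.update b i (x i)) =
      (Finset.Icc x b).filter (fun y => ¬ x i < y i) := by
    ext y
    simp only [Finset.mem_filter, Finset.mem_Icc, Pi.le_def]
    constructor
    · rintro ⟨h1, h2⟩
      refine ⟨⟨h1, fun j => ?_⟩, ?_⟩
      · have := h2 j
        by_cases hj : j = i
        · subst hj; simp at this; omega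
        · simpa [hj] using this
      · have := h2 i
        simp at this; omega
    · rintro ⟨⟨h1, h2⟩, h3⟩
      refine ⟨h1, fun j => ?_⟩
      by_cases hj : j = i
      · subst hj; simp; omega
      · simpa [hj] using h2 j
  simp only [coordDiff, Finset.sum_sub_distrib]
  rw [h1, h2, ← Finset.sum_filter_add_sum_filter_not (Finset.Icc x b) (fun y => x i < y i) g]
  ring

theorem sum_mixedDiff {n : ℕ} {R : ℤ} {u : (Fin n → ℤ) → ℝ} (hu : VanishesAbove R u)
    {x : Fin n → ℤ} (hx : ∀ i, x i ≤ R) (l : List (Fin n)) (hl : l.Nodup) :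
    ∑ y ∈ Finset.Icc x (fun j => if j ∈ l then R else x j), mixedDiff 1 l u y =
      (-1) ^ l.length * u x := by
  induction l using List.reverseRecOn with
  | nil => simp [mixedDiff]
  | append_singleton l i ih =>
    obtain ⟨hl1, -, hl2⟩ := List.nodup_append.mp hl
    have hil : i ∉ l := fun h => hl2 i h i (by simp) rfl
    have h : mixedDiff 1 (l ++ [i]) u = coordDiff 1 i (mixedDiff 1 l u) := by
      simp [mixedDiff, List.foldl_append]
    rw [h, sum_coordDiff (hu.mixedDiff l) (by simp) (hx i), List.length_append,
      List.length_singleton, pow_succ, mul_neg_one, neg_mul, ← ih hl1]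
    congr 2
    congr 1
    funext j
    by_cases hj : j = i
    · subst hj; simp [hil]
    · simp [hj]

/-- Partial summation over a box in `ℤⁿ`. -/
theorem sum_mul_eq_sum_mixedDiff {n R : ℕ} {u : (Fin n → ℤ) → ℝ} (hu : VanishesAbove R u)
    (φ : (Fin n → ℤ) → ℂ) :
    ∑ x ∈ cube n R, (u x : ℂ) * φ x = (-1) ^ n *
      ∑ y ∈ cube n R, (mixedDiff 1 (List.finRange n) u y : ℂ) *
        ∑ x ∈ Finset.Icc (fun _ => -(R : ℤ)) y, φ x := by
  have h1 : ∀ x ∈ cube n R, (u x : ℂ) * φ x = (-1) ^ n *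
      ∑ y ∈ Finset.Icc x (fun _ => (R : ℤ)),
        (mixedDiff 1 (List.finRange n) u y : ℂ) * φ x := by
    intro x hx
    rw [mem_cube] at hx
    have h := sum_mixedDiff hu (x := x) (fun i => (abs_le.mp (hx i)).2) (List.finRange n)
      (List.nodup_finRange n)
    simp only [List.mem_finRange, if_true, List.length_finRange] at h
    rw [← Finset.sum_mul, ← Complex.ofReal_sum, h]
    push_cast
    rw [← mul_assoc, ← mul_assoc, ← mul_pow]
    simp
  rw [Finset.sum_congr rfl h1, ← Finset.mul_sum]
  congr 1
  simp only [Finset.mul_sum]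
  refine Finset.sum_comm' fun x y => ?_
  simp only [mem_cube, Finset.mem_Icc, Pi.le_def, abs_le]
  constructor
  · rintro ⟨h1, h2, h3⟩
    exact ⟨⟨fun i => (h1 i).1, h2⟩, fun i => ⟨(h1 i).1.trans (h2 i), h3 i⟩⟩
  · rintro ⟨⟨h1, h2⟩, h3⟩
    exact ⟨fun i => ⟨h1 i, (h2 i).trans (h3 i).2⟩, h2, fun i => (h3 i).2⟩

/-- A smoothly weighted exponential sum is controlled by the unweighted sums over boxes. -/
theorem SmoothWeight.norm_expSum_le {n R : ℕ} {c : ℝ} {cs : ℕ → ℝ} {ω : (Fin n → ℝ) → ℝ}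
    (hω : SmoothWeight n c cs ω) {P : ℝ} (hP : 0 < P) (hR : c * P ≤ R)
    (f : MvPolynomial (Fin n) ℤ) (α : ℝ) {S : ℝ}
    (hS : ∀ b, Finset.Icc (fun _ => -(R : ℤ)) b ⊆ cube n R →
      ‖boxSum α f (fun _ => -(R : ℤ)) b‖ ≤ S) :
    ‖expSum n f ω α P‖ ≤ ((2 * R + 1) / P) ^ n * cs n * S := by
  set u : (Fin n → ℤ) → ℝ := fun x => ω fun i => (x i : ℝ) / P with hu
  have hsupp : ∀ x i, (R : ℤ) < |x i| → u x = 0 := by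
    intro x i hi
    by_contra hne
    have h := hω.2.2.1 _ hne i
    rw [abs_div, abs_of_pos hP, div_le_iff₀ hP] at h
    have h' : ((R : ℤ) : ℝ) < |(x i : ℝ)| := by exact_mod_cast hi
    push_cast at h'
    linarith
  have h0 : expSum n f ω α P = ∑ x ∈ cube n R, (u x : ℂ) * eC (α * (eval x f : ℤ)) := by
    unfold expSum
    refine tsum_eq_sum fun x hx => ?_
    rw [mem_cube] at hx
    push Not at hx
    obtain ⟨i, hi⟩ := hx
    have := hsupp x i hi
    simp only [hu] at this
    rw [this]
    simp
  rw [h0, sum_mul_eq_sum_mixedDiff (fun x i hi => hsupp x i (hi.trans_le (le_abs_self _)))]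
  rw [norm_mul, norm_pow, norm_neg, norm_one, one_pow, one_mul]
  refine (norm_sum_le _ _).trans ((Finset.sum_le_card_nsmul _ _ ((1 / P) ^ n * cs n * S) ?_).trans
    (le_of_eq ?_))
  · intro y hy
    rw [norm_mul, Complex.norm_real]
    have h1 := hω.abs_mixedDiff_le hP y
    refine mul_le_mul h1 (hS y fun x hx => ?_) (norm_nonneg _) ((abs_nonneg _).trans h1)
    rw [mem_cube] at hy ⊢
    rw [Finset.mem_Icc] at hx
    exact fun i => abs_le.mpr ⟨hx.1 i, (hx.2 i).trans (abs_le.mp (hy i)).2⟩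
  · rw [card_cube, nsmul_eq_mul]
    push_cast
    rw [div_pow, div_pow, one_pow]
    ring

/-- A primitive approximation to `α` forces small multipliers `m` with `‖mα‖` small to vanish. -/
theorem Primitive.eq_zero_of_nint_le {α : ℝ} {q : ℕ} (hq : 0 < q) (h : Primitive α q) {M η : ℝ}
    (h1 : q * η < 1 / 2) (h2 : M * nint (q * α) < 1 / 2) (h3 : M < q ∨ η < nint (q * α))
    {m : ℤ} (hm : |(m : ℝ)| ≤ M) (hη : nint (α * m) ≤ η) : m = 0 := by
  obtain ⟨a, ha, hδ⟩ := h
  set δ := nint (q * α) with hδdef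
  have hδ0 : 0 ≤ δ := nint_nonneg _
  have hq0 : (0 : ℝ) < q := by exact_mod_cast hq
  set r := round (α * m) with hr
  have hr' : |α * m - r| ≤ η := hη
  have hlt : |((q * r - a * m : ℤ) : ℝ)| < 1 := by
    have e : ((q * r - a * m : ℤ) : ℝ) = m * (q * α - a) - q * (α * m - r) := by
      push_cast; ring
    rw [e]
    refine (abs_sub _ _).trans_lt ?_
    rw [abs_mul, abs_mul, ← hδ, abs_of_pos hq0]
    have e1 : |(m : ℝ)| * δ ≤ M * δ := by gcongr
    have e2 : (q : ℝ) * |α * m - r| ≤ q * η := by gcongr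
    linarith
  have hz : (q : ℤ) * r = a * m := by
    have : |q * r - a * m| < 1 := by exact_mod_cast hlt
    rw [Int.abs_lt_one_iff] at this
    omega
  have hdvd : (q : ℤ) ∣ m :=
    (Int.isCoprime_iff_gcd_eq_one.mpr ha).symm.dvd_of_dvd_mul_left ⟨r, hz.symm⟩
  by_contra hne
  have hqm : (q : ℝ) ≤ |(m : ℝ)| := by
    have := Int.le_of_dvd (abs_pos.mpr hne) ((dvd_abs _ _).mpr hdvd)
    exact_mod_cast this
  rcases h3 with h3 | h3
  · linarith
  · have e : (q : ℝ) * |α * m - r| = |(m : ℝ)| * δ := by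
      rw [hδ, ← abs_mul, ← abs_of_pos hq0, ← abs_mul, abs_of_pos hq0]
      congr 1
      have : (q : ℝ) * r = a * m := by exact_mod_cast hz
      linear_combination -this
    have : (q : ℝ) * δ ≤ q * η := by
      calc (q : ℝ) * δ ≤ |(m : ℝ)| * δ := by gcongr
        _ = q * |α * m - r| := e.symm
        _ ≤ q * η := by gcongr
    exact absurd (le_of_mul_le_mul_left this hq0) (not_le.mpr h3)

theorem BkOf_eq {d k : ℕ} (hk : 1 ≤ k) (hd : 1 ≤ d) :
    BkOf d k = ((k - 1) * 2 ^ (d - 1) : ℕ) := by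
  rw [BkOf]
  push_cast [Nat.cast_sub hk]
  rw [← Nat.cast_one, ← Nat.cast_sub hd, Real.rpow_natCast]

theorem VkOf_eq {d k : ℕ} (hkd : k ≤ d) : VkOf d k = (2 ^ (d - k + 1) - 2 : ℕ) := by
  have h : 2 ≤ 2 ^ (d - k + 1) := by
    rw [pow_succ]
    have := Nat.one_le_two_pow (n := d - k)
    omega
  rw [VkOf, Nat.cast_sub h]
  push_cast
  rw [show (d : ℝ) + 1 - k = ((d - k + 1 : ℕ) : ℝ) by push_cast [Nat.cast_sub hkd]; ring,
    Real.rpow_natCast]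

theorem WWof_pos {d k q : ℕ} {P α : ℝ} (hP : 0 < P) : 0 < WWof d k P q α := by
  have h := nint_nonneg (q * α)
  unfold WWof
  have h1 : 0 < P ^ (-((2 : ℝ) ^ (1 - (d : ℝ)))) := by positivity
  have h4 : 0 ≤ min ((q : ℝ) ^ (-(1 / (BkOf d k + VkOf d k))))
      (if nint (q * α) = 0 then (q : ℝ) ^ (-(1 / (BkOf d k + VkOf d k)))
       else (nint (q * α) * P ^ (k : ℝ)) ^ (-(1 / BkOf d k))) := by
    refine le_min (by positivity) ?_
    split_ifs <;> positivity
  have h2 := Real.rpow_nonneg h (1 / (BkOf d k + VkOf d k))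
  positivity

theorem one_le_WWof_one {d q : ℕ} {P α : ℝ} (hP : 0 < P) (hq : 0 < q) : 1 ≤ WWof d 1 P q α := by
  have h := nint_nonneg (q * α)
  have h0 : BkOf d 1 = 0 := by simp [BkOf]
  unfold WWof
  rw [h0]
  simp only [div_zero, Real.rpow_zero]
  have h1 : 0 < P ^ (-((2 : ℝ) ^ (1 - (d : ℝ)))) := by positivity
  have h4 : 0 ≤ min ((q : ℝ) ^ (-(1 / (0 + VkOf d 1))))
      (if nint (q * α) = 0 then (q : ℝ) ^ (-(1 / (0 + VkOf d 1)))
       else (nint (q * α) * P ^ ((1 : ℕ) : ℝ)) ^ (-(0 : ℝ))) := by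
    refine le_min (by positivity) ?_
    split_ifs <;> positivity
  have h2 := Real.rpow_nonneg h (1 / (0 + VkOf d 1))
  linarith

theorem pow_mul_le_of_rpow_le {x c T : ℝ} (hx : 0 ≤ x) (hc0 : 0 ≤ c) (hc1 : c ≤ 1) (hT : 0 < T)
    {N : ℕ} (hN : 1 ≤ N) (h : x ^ (1 / (N : ℝ)) ≤ c / T) : x * T ^ N ≤ c := by
  have h1 : x ≤ (c / T) ^ N := by
    rw [one_div] at h
    calc x = (x ^ ((N : ℝ)⁻¹)) ^ N := (Real.rpow_inv_natCast_pow hx (by omega)).symm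
      _ ≤ _ := by gcongr
  rw [div_pow, le_div_iff₀ (by positivity)] at h1
  exact h1.trans (pow_le_of_le_one hc0 hc1 (by omega))

/-- The consequences of `W_k(α, q) ≤ c / T` used to choose the differencing parameters. -/
theorem bounds_of_WWof_le {d k q : ℕ} (hk : 2 ≤ k) (hkd : k ≤ d) (hq : 0 < q) {P α c T : ℝ}
    (hP : 0 < P) (hc0 : 0 ≤ c) (hc1 : c ≤ 1) (hT : 0 < T) (h : WWof d k P q α ≤ c / T) :
    T ^ 2 ^ (d - 1) ≤ c * P ∧
    nint (q * α) * T ^ ((k - 1) * 2 ^ (d - 1) + (2 ^ (d - k + 1) - 2)) ≤ c ∧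
    q * T ^ ((k - 1) * 2 ^ (d - 1)) ≤ c * P ^ k ∧
    (T ^ ((k - 1) * 2 ^ (d - 1) + (2 ^ (d - k + 1) - 2)) ≤ c * q ∨
      0 < nint (q * α) ∧ T ^ ((k - 1) * 2 ^ (d - 1)) ≤ c * (nint (q * α) * P ^ k)) := by
  have hq0 : (0 : ℝ) < q := by exact_mod_cast hq
  set δ := nint (q * α) with hδ
  have hδ0 : 0 ≤ δ := nint_nonneg _
  set b := (k - 1) * 2 ^ (d - 1) with hb
  set v := 2 ^ (d - k + 1) - 2 with hv
  have hb1 : 1 ≤ b := Nat.mul_pos (by omega) (by positivity)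
  have eBV : BkOf d k + VkOf d k = ((b + v : ℕ) : ℝ) := by
    rw [BkOf_eq (by omega) (by omega), VkOf_eq hkd, ← Nat.cast_add]
  have eB : BkOf d k = (b : ℝ) := BkOf_eq (by omega) (by omega)
  have e2 : (2 : ℝ) ^ (1 - (d : ℝ)) = 1 / ((2 ^ (d - 1) : ℕ) : ℝ) := by
    have hd : 1 ≤ d := by omega
    push_cast
    rw [one_div, ← Real.rpow_natCast, ← Real.rpow_neg (by norm_num), Nat.cast_sub hd]
    congr 1
    push_cast; ring
  unfold WWof at h
  rw [eBV, eB, e2, ← hδ] at h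
  have t1 : 0 ≤ P ^ (-(1 / ((2 ^ (d - 1) : ℕ) : ℝ))) := by positivity
  have t2 : 0 ≤ δ ^ (1 / ((b + v : ℕ) : ℝ)) := by positivity
  have t3 : 0 ≤ ((q : ℝ) * P ^ (-(k : ℝ))) ^ (1 / (b : ℝ)) := by positivity
  have t4 : 0 ≤ min ((q : ℝ) ^ (-(1 / ((b + v : ℕ) : ℝ))))
      (if δ = 0 then (q : ℝ) ^ (-(1 / ((b + v : ℕ) : ℝ)))
       else (δ * P ^ (k : ℝ)) ^ (-(1 / (b : ℝ)))) := by
    refine le_min (by positivity) ?_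
    split_ifs <;> positivity
  have key : ∀ {y : ℝ} {N : ℕ}, 0 < y → 1 ≤ N → y ^ (-(1 / (N : ℝ))) ≤ c / T →
      T ^ N ≤ c * y := by
    intro y N hy hN h
    rw [Real.rpow_neg hy.le, ← Real.inv_rpow hy.le] at h
    have := pow_mul_le_of_rpow_le (by positivity) hc0 hc1 hT hN h
    rwa [inv_mul_le_iff₀ hy, mul_comm] at this
  refine ⟨key hP Nat.one_le_two_pow (by linarith),
    pow_mul_le_of_rpow_le hδ0 hc0 hc1 hT (by omega) (by linarith), ?_, ?_⟩
  · have := pow_mul_le_of_rpow_le (by positivity) hc0 hc1 hT hb1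
      (show ((q : ℝ) * P ^ (-(k : ℝ))) ^ (1 / (b : ℝ)) ≤ c / T by linarith)
    rw [Real.rpow_neg hP.le, Real.rpow_natCast] at this
    have hPk : 0 < P ^ k := by positivity
    calc (q : ℝ) * T ^ b = (q * (P ^ k)⁻¹ * T ^ b) * P ^ k := by field_simp
      _ ≤ _ := by gcongr
  · rcases min_le_iff.mp (show min ((q : ℝ) ^ (-(1 / ((b + v : ℕ) : ℝ))))
      (if δ = 0 then (q : ℝ) ^ (-(1 / ((b + v : ℕ) : ℝ)))
       else (δ * P ^ (k : ℝ)) ^ (-(1 / (b : ℝ)))) ≤ c / T by linarith) with h | h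
    · exact Or.inl (key hq0 (by omega) h)
    · split_ifs at h with h0
      · exact Or.inl (key hq0 (by omega) h)
      · have hδp : 0 < δ := lt_of_le_of_ne hδ0 (Ne.symm h0)
        refine Or.inr ⟨hδp, ?_⟩
        rw [Real.rpow_natCast] at h
        exact key (by positivity) hb1 h

theorem finite_setOf_heightLe (n d : ℕ) (B : ℝ) :
    {G : MvPolynomial (Fin n) ℤ | G.totalDegree ≤ d ∧ HeightLe n G B}.Finite := by
  set S : Finset (Fin n →₀ ℕ) := Finset.Iic (Finsupp.equivFunOnFinite.symm fun _ => d)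
  refine Set.Finite.of_injOn (f := fun G (m : S) => coeff m.1 G)
    (t := Set.pi Set.univ fun _ => Set.Icc (-⌈B⌉) ⌈B⌉) ?_ ?_
    (Set.Finite.pi fun _ => Set.finite_Icc _ _)
  · rintro G ⟨-, hG⟩ m -
    have h := (hG m.1).trans (Int.le_ceil B)
    have h' : |coeff m.1 G| ≤ ⌈B⌉ := by exact_mod_cast h
    exact abs_le.mp h'
  · rintro G ⟨hG, -⟩ G' ⟨hG', -⟩ h
    have hz : ∀ {F : MvPolynomial (Fin n) ℤ}, F.totalDegree ≤ d → ∀ m, m ∉ S → coeff m F = 0 := by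
      intro F hF m hm
      by_contra hne
      refine hm (Finset.mem_Iic.mpr fun i => ?_)
      have h1 := le_totalDegree (mem_support_iff.mpr hne)
      refine le_trans ?_ (h1.trans hF)
      by_cases hi : i ∈ m.support
      · exact Finset.single_le_sum (f := fun i => m i) (fun _ _ => Nat.zero_le _) hi
      · rw [Finsupp.notMem_support_iff.mp hi]
        exact Nat.zero_le _
    ext m
    by_cases hm : m ∈ S
    · exact congrFun h ⟨m, hm⟩
    · rw [hz hG m hm, hz hG' m hm]

theorem singDim_le {n σ : ℕ} {G : MvPolynomial (Fin n) ℚ}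
    (h : singDim n ℚ G = (σ : WithBot (WithTop ℕ))) : σ ≤ n := by
  have h' : singDim n ℚ G = ((σ : ℕ∞) : WithBot ℕ∞) := h
  have h1 := ringKrullDim_quotient_le (Ideal.span (Set.range fun i => pderiv i G))
  have h2 : ringKrullDim (MvPolynomial (Fin n) ℚ) = n := by
    rw [MvPolynomial.ringKrullDim_of_isNoetherianRing]
    simp
  rw [h2] at h1
  have h3 : ((σ : ℕ∞) : WithBot ℕ∞) ≤ ((n : ℕ∞) : WithBot ℕ∞) := h'.symm.le.trans h1
  exact_mod_cast h3

/-- A bound for the number of standard exponents, uniform over polynomials of bounded height. -/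
theorem exists_stdCount_jacIdeal_le (n d : ℕ) (B : ℝ) : ∃ C : ℕ,
    ∀ G : MvPolynomial (Fin n) ℤ, G.totalDegree ≤ d → HeightLe n G B → ∀ σ : ℕ,
    singDim n ℚ (map (Int.castRingHom ℚ) G) = (σ : WithBot (WithTop ℕ)) →
    ∀ m, stdCount (jacIdeal (map (Int.castRingHom ℚ) G)) m ≤ C * (m + 1) ^ σ := by
  have h : ∀ G : MvPolynomial (Fin n) ℤ, ∃ C : ℕ, ∀ σ : ℕ,
      singDim n ℚ (map (Int.castRingHom ℚ) G) = (σ : WithBot (WithTop ℕ)) →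
      ∀ m, stdCount (jacIdeal (map (Int.castRingHom ℚ) G)) m ≤ C * (m + 1) ^ σ := by
    intro G
    by_cases hG : ∃ σ : ℕ, singDim n ℚ (map (Int.castRingHom ℚ) G) = (σ : WithBot (WithTop ℕ))
    · obtain ⟨σ, hσ⟩ := hG
      obtain ⟨C, hC⟩ := exists_stdCount_le_pow hσ
      refine ⟨C, fun τ hτ => ?_⟩
      have h1 : ((σ : ℕ∞) : WithBot ℕ∞) = ((τ : ℕ∞) : WithBot ℕ∞) := hσ.symm.trans hτ
      have h2 : σ = τ := by exact_mod_cast h1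
      exact h2 ▸ hC
    · exact ⟨0, fun σ hσ => absurd ⟨σ, hσ⟩ hG⟩
  choose C hC using h
  refine ⟨∑ G ∈ (finite_setOf_heightLe n d B).toFinset, C G, fun G hG hGB σ hσ m => ?_⟩
  refine (hC G σ hσ m).trans (Nat.mul_le_mul_right _ ?_)
  exact Finset.single_le_sum (f := C) (fun _ _ => Nat.zero_le _)
    ((Set.Finite.mem_toFinset _).mpr ⟨hG, hGB⟩)

theorem exists_one_add_log_pow_le (n : ℕ) {ε A : ℝ} (hε : 0 < ε) (hA : 1 ≤ A) :
    ∃ K : ℝ, 0 < K ∧ ∀ P x : ℝ, 1 ≤ x → x ≤ A * P → (1 + Real.log x) ^ n ≤ K * P ^ ε := by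
  set e : ℝ := ε / (n + 1) with he
  have he0 : 0 < e := by positivity
  have hen : e * n ≤ ε := by
    rw [he, div_mul_eq_mul_div, div_le_iff₀ (by positivity)]
    nlinarith
  refine ⟨(1 + 1 / e) ^ n * A ^ ε, by positivity, fun P x hx hxP => ?_⟩
  have hA0 : 0 < A := by linarith
  have hP0 : 0 < P := by
    by_contra h
    nlinarith
  have h1 : 1 + Real.log x ≤ (1 + 1 / e) * x ^ e := by
    have h2 := Real.log_le_rpow_div (by linarith : 0 ≤ x) he0
    have h3 : 1 ≤ x ^ e := Real.one_le_rpow hx he0.le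
    calc 1 + Real.log x ≤ x ^ e + x ^ e / e := by linarith
      _ = _ := by ring
  have h0 : 0 ≤ 1 + Real.log x := by linarith [Real.log_nonneg hx]
  calc (1 + Real.log x) ^ n ≤ ((1 + 1 / e) * x ^ e) ^ n := by gcongr
    _ = (1 + 1 / e) ^ n * x ^ (e * n) := by
        rw [mul_pow, Real.rpow_mul (by linarith), Real.rpow_natCast]
    _ ≤ (1 + 1 / e) ^ n * x ^ ε := by gcongr
    _ ≤ (1 + 1 / e) ^ n * (A * P) ^ ε := by gcongr
    _ = _ := by rw [Real.mul_rpow hA0.le hP0.le, mul_assoc]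

theorem norm_boxSum_le_card {n R : ℕ} (α : ℝ) (p : MvPolynomial (Fin n) ℤ) {a b : Fin n → ℤ}
    (hab : Finset.Icc a b ⊆ cube n R) : ‖boxSum α p a b‖ ≤ (2 * (R : ℝ) + 1) ^ n := by
  refine (norm_sum_le _ _).trans ?_
  simp only [norm_eC, Finset.sum_const, nsmul_eq_mul, mul_one]
  have := (Finset.card_le_card hab).trans (card_cube n R).le
  exact_mod_cast this

theorem exists_uniform_boxBound (n d : ℕ) : ∃ C : ℕ, 1 ≤ C ∧
    ∀ k, 2 ≤ k → k ≤ d → BoxBound n (k - 2) (d - k) C := by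
  choose C hC1 hC using fun k => exists_boxBound n (k - 2) (d - k)
  refine ⟨1 + ∑ k ∈ Finset.range (d + 1), C k, by omega, fun k _ hkd => (hC k).mono ?_⟩
  have := Finset.single_le_sum (f := C) (fun _ _ => Nat.zero_le _)
    (Finset.mem_range.mpr (by omega : k < d + 1))
  omega

/-- The dichotomy-free bound for box sums at a differencing length `T` with `W_k ≤ c₁ / T`. -/
theorem BoxBound.norm_boxSum_le {n d k C : ℕ} (hk : 2 ≤ k) (hkd : k ≤ d)
    (hC : BoxBound n (k - 2) (d - k) C) {B c₁ : ℝ} (hB : 0 ≤ B) (hc0 : 0 < c₁) (hc1 : c₁ < 1 / 2)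
    (hCB : C * B * c₁ < 1 / 2) {f : MvPolynomial (Fin n) ℤ} (hf : f.totalDegree ≤ d)
    (hfB : HeightLe n f B) {P α : ℝ} (hP : 0 < P) {q T R : ℕ} (hq : 0 < q) (hα : Primitive α q)
    (hT : 1 ≤ T) (hW : WWof d k P q α ≤ c₁ / T) (hR : P ≤ R) {a b : Fin n → ℤ}
    (hab : Finset.Icc a b ⊆ cube n R) :
    ‖boxSum α f a b‖ * (T : ℝ) ^ n ≤ C * (R : ℝ) ^ n * (1 + Real.log R) ^ n *
      stdCount (jacIdeal (map (Int.castRingHom ℚ) (homogeneousComponent d f))) (C * T) := by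
  have hT0 : (0 : ℝ) < T := by exact_mod_cast hT
  obtain ⟨h1, h2, h3, h4⟩ := bounds_of_WWof_le hk hkd hq hP hc0.le (by linarith) hT0 hW
  have e1 : d - k + (k - 2) + 1 = d - 1 := by omega
  have e2 : k + (d - k) = d := by omega
  have e3 : k - 2 + 1 = k - 1 := by omega
  have e4 : k - 2 + 2 = k := by omega
  have hR0 : (0 : ℝ) < R := hP.trans_le hR
  have hq0 : (0 : ℝ) < q := by exact_mod_cast hq
  have hPR : P ^ k ≤ (R : ℝ) ^ k := by gcongr
  unfold BoxBound at hC
  simp only [e1, e3, e4, e2] at hC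
  refine hC R T hT ?_ α B f _ (hasLeadingForm_homogeneousComponent hf) ?_ ?_ a b hab
  · have : (T : ℝ) ^ 2 ^ (d - 1) ≤ R := h1.trans (by nlinarith)
    exact_mod_cast this
  · intro m
    rw [coeff_homogeneousComponent]
    split_ifs
    · exact hfB m
    · simpa using hB
  · intro m hm hη
    have ebv : (T : ℝ) ^ (2 ^ (d - k + 1) - 2) * ((T : ℝ) ^ 2 ^ (d - 1)) ^ (k - 1) =
        (T : ℝ) ^ ((k - 1) * 2 ^ (d - 1) + (2 ^ (d - k + 1) - 2)) := by
      rw [← pow_mul, ← pow_add]; congr 1; ring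
    have eb : ((T : ℝ) ^ 2 ^ (d - 1)) ^ (k - 1) = (T : ℝ) ^ ((k - 1) * 2 ^ (d - 1)) := by
      rw [← pow_mul, mul_comm]
    rw [mul_assoc, ebv] at hm
    rw [eb] at hη
    set TB := (T : ℝ) ^ ((k - 1) * 2 ^ (d - 1))
    set TV := (T : ℝ) ^ ((k - 1) * 2 ^ (d - 1) + (2 ^ (d - k + 1) - 2))
    have hδ0 := nint_nonneg (q * α)
    have hCB0 : 0 ≤ C * B := by positivity
    refine hα.eq_zero_of_nint_le hq ?_ ?_ ?_ hm hη
    · rw [← mul_div_assoc, div_lt_iff₀ (by positivity)]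
      have : 0 < (R : ℝ) ^ k := by positivity
      nlinarith
    · calc C * B * TV * nint (q * α) = C * B * (nint (q * α) * TV) := by ring
        _ ≤ C * B * c₁ := by gcongr
        _ < _ := hCB
    · rcases h4 with h4 | ⟨hδ, h4⟩
      · left
        calc C * B * TV ≤ C * B * (c₁ * q) := by gcongr
          _ = C * B * c₁ * q := by ring
          _ < q := by nlinarith
      · right
        rw [div_lt_iff₀ (by positivity)]
        have h5 : nint (q * α) * P ^ k ≤ nint (q * α) * (R : ℝ) ^ k := by gcongr
        have h6 : 0 < nint (q * α) * (R : ℝ) ^ k := by positivity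
        nlinarith

/-- Van der Corput and Weyl differencing for unweighted sums over boxes of side `≪ P`. -/
theorem exists_norm_boxSum_le (d n : ℕ) {B ε A : ℝ} (hB : 0 < B) (hε : 0 < ε) (hA : 1 ≤ A) :
    ∃ K : ℝ, 0 < K ∧ ∀ k : ℕ, 1 ≤ k → k ≤ d → ∀ f : MvPolynomial (Fin n) ℤ,
      f.totalDegree ≤ d → HeightLe n f B → ∀ σ : ℕ,
      singDim n ℚ (map (Int.castRingHom ℚ) (homogeneousComponent d f)) =
        (σ : WithBot (WithTop ℕ)) →
      ∀ (P : ℝ) (R : ℕ), 1 ≤ P → P ≤ R → R ≤ A * P → ∀ (α : ℝ) (q : ℕ), 0 < q → Primitive α q →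
      ∀ a b, Finset.Icc a b ⊆ cube n R →
        ‖boxSum α f a b‖ ≤ K * P ^ ((n : ℝ) + ε) * (WWof d k P q α) ^ ((n : ℝ) - σ) := by
  obtain ⟨C, hC1, hC⟩ := exists_uniform_boxBound n d
  obtain ⟨F, hF⟩ := exists_stdCount_jacIdeal_le n d B
  obtain ⟨L, hL0, hL⟩ := exists_one_add_log_pow_le n hε hA
  have hC1' : (1 : ℝ) ≤ C := by exact_mod_cast hC1
  set c₁ : ℝ := 1 / (4 * (C * B + 1)) with hc₁
  have hc0 : 0 < c₁ := by positivity
  have hc4 : c₁ ≤ 1 / 4 := by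
    rw [hc₁]
    apply one_div_le_one_div_of_le (by norm_num)
    nlinarith [mul_pos (by linarith : (0 : ℝ) < C) hB]
  have hCB : C * B * c₁ < 1 / 2 := by
    rw [hc₁, mul_one_div, div_lt_iff₀ (by positivity)]
    nlinarith [mul_pos (by linarith : (0 : ℝ) < C) hB]
  set K₁ : ℝ := (3 * A) ^ n * (1 / c₁) ^ n with hK₁
  set K₂ : ℝ := C * A ^ n * L * (F * (C + 1) ^ n) * (2 / c₁) ^ n with hK₂
  refine ⟨K₁ + K₂, by positivity, ?_⟩
  intro k hk hkd f hf hfB σ hσ P R hP hPR hRA α q hq hα a b hab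
  have hP0 : 0 < P := by linarith
  have hσn := singDim_le hσ
  have hR1 : (1 : ℝ) ≤ R := hP.trans hPR
  have hWpos : 0 < WWof d k P q α := WWof_pos hP0
  rw [← Nat.cast_sub hσn, Real.rpow_natCast, Real.rpow_add hP0, Real.rpow_natCast]
  have hPε : 1 ≤ P ^ ε := Real.one_le_rpow hP hε.le
  rcases le_or_gt c₁ (WWof d k P q α) with hW | hW
  · have h1 : 1 ≤ (1 / c₁) ^ n * WWof d k P q α ^ (n - σ) := by
      have e1 : (1 / c₁) ^ (n - σ) ≤ (1 / c₁) ^ n := by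
        refine pow_le_pow_right₀ ?_ (Nat.sub_le _ _)
        rw [le_div_iff₀ hc0]; linarith
      calc (1 : ℝ) ≤ (1 / c₁ * WWof d k P q α) ^ (n - σ) := by
            refine one_le_pow₀ ?_
            rw [one_div_mul_eq_div, le_div_iff₀ hc0]; linarith
        _ = (1 / c₁) ^ (n - σ) * WWof d k P q α ^ (n - σ) := by rw [mul_pow]
        _ ≤ _ := by gcongr
    calc ‖boxSum α f a b‖ ≤ (2 * (R : ℝ) + 1) ^ n := norm_boxSum_le_card α f hab
      _ ≤ (3 * A * P) ^ n := by gcongr; linarith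
      _ = (3 * A) ^ n * (P ^ n * 1) * 1 := by rw [mul_pow]; ring
      _ ≤ (3 * A) ^ n * (P ^ n * P ^ ε) * ((1 / c₁) ^ n * WWof d k P q α ^ (n - σ)) := by gcongr
      _ = K₁ * (P ^ n * P ^ ε) * WWof d k P q α ^ (n - σ) := by ring
      _ ≤ _ := by
        have : K₁ ≤ K₁ + K₂ := le_add_of_nonneg_right (by positivity)
        gcongr
  · have hk2 : 2 ≤ k := by
      by_contra hlt
      obtain rfl : k = 1 := by omega
      have := one_le_WWof_one (d := d) (α := α) hP0 hq
      linarith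
    set W := WWof d k P q α with hWdef
    set T := ⌊c₁ / W⌋₊ with hT
    have hT1 : 1 ≤ T := Nat.le_floor (by rw [Nat.cast_one, le_div_iff₀ hWpos]; linarith)
    have hT0 : (0 : ℝ) < T := by exact_mod_cast hT1
    have hT1' : (1 : ℝ) ≤ T := by exact_mod_cast hT1
    have hTle : (T : ℝ) ≤ c₁ / W := Nat.floor_le (by positivity)
    have hTlt : c₁ / W < T + 1 := Nat.lt_floor_add_one _
    have hWT : W ≤ c₁ / T := by
      rw [le_div_iff₀ hT0, mul_comm]
      rwa [le_div_iff₀ hWpos] at hTle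
    have hTinv : 1 / (T : ℝ) ≤ 2 / c₁ * W := by
      rw [div_lt_iff₀ hWpos] at hTlt
      rw [div_mul_eq_mul_div, div_le_div_iff₀ hT0 hc0]
      nlinarith
    have h := (hC k hk2 hkd).norm_boxSum_le hk2 hkd hB.le hc0 (by linarith) hCB hf hfB hP0 hq hα
      hT1 hWT hPR hab
    set G := homogeneousComponent d f with hG
    have hGB : HeightLe n G B := by
      intro m
      rw [hG, coeff_homogeneousComponent]
      split_ifs
      · exact hfB m
      · simpa using hB.le
    have hGd : G.totalDegree ≤ d := (homogeneousComponent_isHomogeneous d f).totalDegree_le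
    have hstd : (stdCount (jacIdeal (map (Int.castRingHom ℚ) G)) (C * T) : ℝ) ≤
        F * (C + 1) ^ n * (T : ℝ) ^ σ := by
      calc (stdCount (jacIdeal (map (Int.castRingHom ℚ) G)) (C * T) : ℝ)
          ≤ F * (C * T + 1) ^ σ := by exact_mod_cast hF G hGd hGB σ hσ (C * T)
        _ ≤ F * ((C + 1) * T) ^ σ := by gcongr; nlinarith
        _ = F * (C + 1) ^ σ * (T : ℝ) ^ σ := by rw [mul_pow]; ring
        _ ≤ _ := by
          have : ((C : ℝ) + 1) ^ σ ≤ (C + 1) ^ n := pow_le_pow_right₀ (by linarith) hσn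
          gcongr
    have hTn : (T : ℝ) ^ n = (T : ℝ) ^ σ * (T : ℝ) ^ (n - σ) := by
      rw [← pow_add]; congr 1; omega
    have hTW : 1 ≤ (2 / c₁) ^ n * W ^ (n - σ) * (T : ℝ) ^ (n - σ) := by
      have e1 : (2 / c₁) ^ (n - σ) ≤ (2 / c₁) ^ n := by
        refine pow_le_pow_right₀ ?_ (Nat.sub_le _ _)
        rw [le_div_iff₀ hc0]; linarith
      calc (1 : ℝ) ≤ (2 / c₁ * W * T) ^ (n - σ) := by
            refine one_le_pow₀ ?_
            rwa [div_le_iff₀ hT0] at hTinv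
        _ = (2 / c₁) ^ (n - σ) * W ^ (n - σ) * (T : ℝ) ^ (n - σ) := by rw [mul_pow, mul_pow]
        _ ≤ _ := by gcongr
    refine le_of_mul_le_mul_right (h.trans ?_) (by positivity : (0 : ℝ) < (T : ℝ) ^ n)
    have hlog0 : 0 ≤ 1 + Real.log R := by linarith [Real.log_nonneg hR1]
    calc C * (R : ℝ) ^ n * (1 + Real.log R) ^ n *
          stdCount (jacIdeal (map (Int.castRingHom ℚ) G)) (C * T)
        ≤ C * (A * P) ^ n * (L * P ^ ε) * (F * (C + 1) ^ n * (T : ℝ) ^ σ) := by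
          gcongr
          exact hL P R hR1 hRA
      _ = C * A ^ n * L * (F * (C + 1) ^ n) * (P ^ n * P ^ ε) * (T : ℝ) ^ σ * 1 := by
          rw [mul_pow]; ring
      _ ≤ C * A ^ n * L * (F * (C + 1) ^ n) * (P ^ n * P ^ ε) * (T : ℝ) ^ σ *
            ((2 / c₁) ^ n * W ^ (n - σ) * (T : ℝ) ^ (n - σ)) := by gcongr
      _ = K₂ * (P ^ n * P ^ ε) * W ^ (n - σ) * (T : ℝ) ^ n := by rw [hTn, hK₂]; ring
      _ ≤ _ := by
        have : K₂ ≤ K₁ + K₂ := le_add_of_nonneg_left (by positivity)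
        gcongr

/-- van der Corput + Weyl (Proposition `birch + van der corput`). -/
theorem van_der_corput_weyl (d n : ℕ) (hd : 1 ≤ d) (B ε : ℝ) (hB : 0 < B) (hε : 0 < ε)
    (c : ℝ) (cs : ℕ → ℝ) (hc : SuperSeq c cs) :
    ∃ K : ℝ, 0 < K ∧
      ∀ k : ℕ, 1 ≤ k → k ≤ d →
      ∀ (f : MvPolynomial (Fin n) ℤ), f.totalDegree ≤ d → HeightLe n f B →
      ∀ σ : ℕ,
        singDim n ℚ (MvPolynomial.map (Int.castRingHom ℚ)
          (MvPolynomial.homogeneousComponent d f)) = (σ : WithBot (WithTop ℕ)) →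
      ∀ ω : (Fin n → ℝ) → ℝ, SmoothWeight n c cs ω →
      ∀ P : ℝ, 2 ≤ P →
      ∀ (α : ℝ) (q : ℕ), 0 < q → Primitive α q →
        ‖expSum n f ω α P‖ ≤ K * P ^ ((n : ℝ) + ε) * (WWof d k P q α) ^ ((n : ℝ) - σ) := by
  obtain ⟨hc0, hcs0, hmono, -⟩ := hc
  obtain ⟨K, hK0, hK⟩ := exists_norm_boxSum_le d n hB hε (show (1 : ℝ) ≤ c + 2 by linarith)
  have hcn : 0 < cs n := hc0.trans_le (hcs0.trans (hmono (Nat.zero_le n)))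
  refine ⟨(2 * (c + 2) + 1) ^ n * cs n * K, by positivity, ?_⟩
  intro k hk hkd f hf hfB σ hσ ω hω P hP α q hq hα
  have hP0 : 0 < P := by linarith
  set R := ⌈(c + 1) * P⌉₊ with hR
  have hle : (c + 1) * P ≤ R := Nat.le_ceil _
  have hlt : (R : ℝ) < (c + 1) * P + 1 := Nat.ceil_lt_add_one (by positivity)
  have hcP : 0 < c * P := by positivity
  have hW := WWof_pos (d := d) (k := k) (q := q) (α := α) hP0
  refine (hω.norm_expSum_le (R := R) hP0 (by linarith) f α fun b hb =>
    hK k hk hkd f hf hfB σ hσ P R (by linarith) (by linarith) (by linarith) α q hq hα _ b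
      hb).trans ?_
  have h1 : (2 * (R : ℝ) + 1) / P ≤ 2 * (c + 2) + 1 := by
    rw [div_le_iff₀ hP0]
    linarith
  have h2 : ((2 * (R : ℝ) + 1) / P) ^ n ≤ (2 * (c + 2) + 1) ^ n := by gcongr
  have h3 : 0 ≤ K * P ^ ((n : ℝ) + ε) * (WWof d k P q α) ^ ((n : ℝ) - σ) := by positivity
  calc _ ≤ (2 * (c + 2) + 1) ^ n * cs n *
        (K * P ^ ((n : ℝ) + ε) * (WWof d k P q α) ^ ((n : ℝ) - σ)) := by gcongr
    _ = _ := by ring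

end
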